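/- For every V ∈ (0, 2π²) there exists a function u ∈ C^∞(ℝ³) such that Δu ∈ L_{1/2}(ℝ³), e^{3u} ∈ L¹(ℝ³) with ∫_{ℝ³} e^{3u(x)} dx = V, and ∫_{ℝ³} (−Δu)(x)·((−Δ)^{1/2}φ)(x) dx = 2∫_{ℝ³} e^{3u(x)} φ(x) dx for every Schwartz function φ : ℝ³ → ℝ; that is, the problem (−Δ)^{3/2}u = 2e^{3u} in ℝ³ with volume V admits a smooth solution. -/

import Mathlib

open MeasureTheory Real Filter

noncomputable section

abbrev E3 := EuclideanSpace ℝ (Fin 3)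

/-- The Laplacian of `f : ℝ³ → ℝ` as the sum of second partial derivatives. -/
def lap (f : E3 → ℝ) (x : E3) : ℝ :=
  ∑ i, fderiv ℝ (fun y => fderiv ℝ f y (EuclideanSpace.single i 1)) x (EuclideanSpace.single i 1)

/-- The half Laplacian `(-Δ)^{1/2} φ` of a Schwartz function on ℝ³, defined as a
principal value: `(1/π²) lim_{ε→0⁺} ∫_{|x−y|>ε} (φ(x)−φ(y))/|x−y|⁴ dy`. -/
def halfLap (φ : SchwartzMap E3 ℝ) (x : E3) : ℝ :=
  limUnder (nhdsWithin (0:ℝ) (Set.Ioi 0)) fun ε =>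
    (1 / π ^ 2) * ∫ y in {y : E3 | ε < ‖x - y‖}, (φ x - φ y) / ‖x - y‖ ^ 4

/-- `w ∈ L_{1/2}(ℝ³)`. -/
def MemL12 (w : E3 → ℝ) : Prop :=
  LocallyIntegrable w volume ∧ Integrable (fun x => |w x| / (1 + ‖x‖ ^ 4)) volume

/-- `u` is a smooth solution of `(-Δ)^{3/2} u = 2 e^{3u}` in ℝ³ with finite volume. -/
def IsSolution (u : E3 → ℝ) : Prop :=
  ContDiff ℝ (⊤ : ℕ∞) u ∧ MemL12 (lap u) ∧ Integrable (fun x => exp (3 * u x)) volume ∧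
    ∀ φ : SchwartzMap E3 ℝ,
      ∫ x, (-(lap u x)) * halfLap φ x = 2 * ∫ x, exp (3 * u x) * φ x

/-- `u` is a spherical solution. -/
def IsSpherical (u : E3 → ℝ) : Prop :=
  ∃ lam : ℝ, 0 < lam ∧ ∃ x₀ : E3, ∀ x, u x = log (2 * lam / (1 + lam ^ 2 * ‖x - x₀‖ ^ 2))

/-- `α = (1/π²) ∫ e^{3u}`. -/
def solAlpha (u : E3 → ℝ) : ℝ := (1 / π ^ 2) * ∫ y, exp (3 * u y)

/-- `v(x) = (1/π²) ∫ log(|y|/|x−y|) e^{3u(y)} dy`. -/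
def solV (u : E3 → ℝ) (x : E3) : ℝ :=
  (1 / π ^ 2) * ∫ y, log (‖y‖ / ‖x - y‖) * exp (3 * u y)

end

/-! ### Weights and Riesz-type kernels on `ℝ³` -/

/-- The weight `(1 + |y|²)⁻³`. -/
noncomputable def wt (y : E3) : ℝ := ((1 + ‖y‖ ^ 2) ^ 3)⁻¹

lemma finrank_E3 : Module.finrank ℝ E3 = 3 := by simp

lemma wt_pos (y : E3) : 0 < wt y := by unfold wt; positivity

lemma wt_le_one (y : E3) : wt y ≤ 1 := by
  unfold wt
  refine inv_le_one_of_one_le₀ (one_le_pow₀ ?_)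
  nlinarith [sq_nonneg ‖y‖]

lemma continuous_wt : Continuous wt := by
  unfold wt
  refine Continuous.inv₀ (by fun_prop) (fun y => by positivity)

@[fun_prop]
lemma measurable_wt : Measurable wt := continuous_wt.measurable

lemma integrable_sq_mul_wt : Integrable (fun y : E3 => (1 + ‖y‖ ^ 2) * wt y) := by
  have h := integrable_rpow_neg_one_add_norm_sq (E := E3) (r := 4) (μ := volume)
    (by rw [finrank_E3]; norm_num)
  refine h.congr (Eventually.of_forall fun y => ?_)
  have h1 : (0:ℝ) < 1 + ‖y‖ ^ 2 := by positivity
  simp only [wt]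
  rw [show (-4 / 2 : ℝ) = -((2 : ℕ) : ℝ) by norm_num, rpow_neg h1.le, rpow_natCast]
  field_simp

lemma integrable_wt : Integrable wt := by
  refine integrable_sq_mul_wt.mono' measurable_wt.aestronglyMeasurable
    (Eventually.of_forall fun y => ?_)
  rw [Real.norm_of_nonneg (wt_pos y).le]
  nlinarith [wt_pos y, sq_nonneg ‖y‖, mul_nonneg (sq_nonneg ‖y‖) (wt_pos y).le]

lemma integrable_norm_mul_wt : Integrable (fun y : E3 => ‖y‖ * wt y) := by
  refine integrable_sq_mul_wt.mono' (by fun_prop : Measurable _).aestronglyMeasurable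
    (Eventually.of_forall fun y => ?_)
  rw [norm_mul, norm_norm, Real.norm_of_nonneg (wt_pos y).le]
  exact mul_le_mul_of_nonneg_right (by nlinarith [sq_nonneg (‖y‖ - 1), sq_nonneg ‖y‖])
    (wt_pos y).le

lemma integrableOn_ball_rpow {a : ℝ} (ha : a < 3) :
    IntegrableOn (fun z : E3 => ‖z‖ ^ (-a)) (Metric.ball 0 1) := by
  rw [integrableOn_fun_norm_addHaar volume (f := fun r : ℝ => r ^ (-a)), finrank_E3]
  have h : IntegrableOn (fun y : ℝ => y ^ (2 - a)) (Set.Ioo 0 1) := by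
    have := (intervalIntegral.intervalIntegrable_rpow' (a := 0) (b := 1) (r := 2 - a)
      (by linarith)).1
    exact this.mono_set Set.Ioo_subset_Ioc_self
  refine h.congr_fun (fun y hy => ?_) measurableSet_Ioo
  have : (0:ℝ) < y := hy.1
  simp only [smul_eq_mul]
  rw [show (2 - a : ℝ) = ((2:ℕ):ℝ) + -a by norm_num; ring, rpow_add this, rpow_natCast]

lemma measurable_rieszKernel (a : ℝ) (x : E3) :
    Measurable (fun y : E3 => ‖x - y‖ ^ (-a)) := by fun_prop

lemma rieszKernel_mul_wt_le {a : ℝ} (ha0 : 0 ≤ a) (x y : E3) :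
    ‖x - y‖ ^ (-a) * wt y ≤
      (Metric.ball (0 : E3) 1).indicator (fun z => ‖z‖ ^ (-a)) (x - y) + wt y := by
  by_cases h : x - y ∈ Metric.ball (0 : E3) 1
  · rw [Set.indicator_of_mem h]
    have h1 : 0 ≤ ‖x - y‖ ^ (-a) := by positivity
    nlinarith [wt_pos y, wt_le_one y]
  · rw [Set.indicator_of_notMem h]
    rw [mem_ball_zero_iff, not_lt] at h
    have : ‖x - y‖ ^ (-a) ≤ 1 := rpow_le_one_of_one_le_of_nonpos h (by linarith)
    nlinarith [wt_pos y]

lemma integrable_rieszKernel_mul_wt {a : ℝ} (ha0 : 0 ≤ a) (ha : a < 3) (x : E3) :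
    Integrable (fun y : E3 => ‖x - y‖ ^ (-a) * wt y) := by
  have h1 := ((integrable_indicator_iff measurableSet_ball).2
    (integrableOn_ball_rpow ha)).comp_sub_left x
  refine (h1.add integrable_wt).mono'
    ((measurable_rieszKernel a x).mul measurable_wt).aestronglyMeasurable
    (Eventually.of_forall fun y => ?_)
  rw [Real.norm_of_nonneg (mul_nonneg (by positivity) (wt_pos y).le)]
  exact rieszKernel_mul_wt_le ha0 x y

lemma exists_rieszPotential_wt_le {a : ℝ} (ha0 : 0 ≤ a) (ha : a < 3) :
    ∃ M : ℝ, ∀ x : E3, ∫ y, ‖x - y‖ ^ (-a) * wt y ≤ M := by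
  refine ⟨(∫ z, (Metric.ball (0 : E3) 1).indicator (fun z => ‖z‖ ^ (-a)) z) + ∫ y, wt y,
    fun x => ?_⟩
  have h0 := ((integrable_indicator_iff measurableSet_ball).2 (integrableOn_ball_rpow ha))
  have h1 := h0.comp_sub_left x
  calc _ ≤ ∫ y, ((Metric.ball (0 : E3) 1).indicator (fun z => ‖z‖ ^ (-a)) (x - y) + wt y) :=
        integral_mono (integrable_rieszKernel_mul_wt ha0 ha x) (h1.add integrable_wt)
          fun y => rieszKernel_mul_wt_le ha0 x y
    _ = _ := by
        rw [integral_add h1 integrable_wt, integral_sub_left_eq_self]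

lemma abs_log_le_add_inv {t : ℝ} (ht : 0 ≤ t) : |log t| ≤ t + t⁻¹ := by
  rcases ht.eq_or_lt with rfl | ht
  · simp
  have h1 := log_le_sub_one_of_pos ht
  have h2 := log_le_sub_one_of_pos (inv_pos.2 ht)
  rw [log_inv] at h2
  have : 0 < t⁻¹ := inv_pos.2 ht
  rw [abs_le]; constructor <;> linarith

lemma integrable_log_mul_wt (x : E3) : Integrable (fun y : E3 => log ‖x - y‖ * wt y) := by
  have h1 := integrable_rieszKernel_mul_wt zero_le_one (by norm_num : (1:ℝ) < 3) x
  have h2 := (integrable_wt.const_mul ‖x‖).add integrable_norm_mul_wt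
  refine (h2.add h1).mono' (by fun_prop : Measurable _).aestronglyMeasurable
    (Eventually.of_forall fun y => ?_)
  rw [norm_mul, Real.norm_of_nonneg (wt_pos y).le, Real.norm_eq_abs]
  have h3 := abs_log_le_add_inv (norm_nonneg (x - y))
  have h4 := norm_sub_le x y
  simp only [Pi.add_apply, rpow_neg_one]
  nlinarith [wt_pos y]

/-- A measurable function dominated by a multiple of `wt`. -/
structure WtBounded (f : E3 → ℝ) : Prop where
  meas : Measurable f
  bound : ∃ C, ∀ y, |f y| ≤ C * wt y

lemma WtBounded.integrable_mul {f g : E3 → ℝ} (hf : WtBounded f) (hg : Measurable g)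
    (h : Integrable (fun y => g y * wt y)) : Integrable (fun y => g y * f y) := by
  obtain ⟨C, hC⟩ := hf.bound
  refine (h.norm.const_mul C).mono' (hg.mul hf.meas).aestronglyMeasurable
    (Eventually.of_forall fun y => ?_)
  rw [norm_mul, norm_mul, Real.norm_of_nonneg (wt_pos y).le, Real.norm_eq_abs (f y)]
  nlinarith [norm_nonneg (g y), hC y]

lemma WtBounded.integrable {f : E3 → ℝ} (hf : WtBounded f) : Integrable f := by
  simpa using hf.integrable_mul (g := fun _ => 1) measurable_const (by simpa using integrable_wt)

lemma WtBounded.integrable_log {f : E3 → ℝ} (hf : WtBounded f) (x : E3) :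
    Integrable (fun y => log ‖x - y‖ * f y) :=
  hf.integrable_mul (by fun_prop) (integrable_log_mul_wt x)

lemma WtBounded.integrable_log_norm {f : E3 → ℝ} (hf : WtBounded f) :
    Integrable (fun y => log ‖y‖ * f y) := by
  simpa using hf.integrable_log 0

/-- The normalized logarithmic potential (up to a factor): `∫ log (|y| / |x - y|) f(y) dy`. -/
noncomputable def logPot (f : E3 → ℝ) (x : E3) : ℝ := ∫ y, (log ‖y‖ - log ‖x - y‖) * f y

lemma WtBounded.integrable_logPot {f : E3 → ℝ} (hf : WtBounded f) (x : E3) :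
    Integrable (fun y => (log ‖y‖ - log ‖x - y‖) * f y) := by
  simp only [sub_mul]
  exact hf.integrable_log_norm.sub (hf.integrable_log x)

lemma logPot_zero (f : E3 → ℝ) : logPot f 0 = 0 := by simp [logPot]

/-! ### Cylindrical integration of functions of `(|y|, y₀)` -/

open scoped ENNReal in
lemma lintegral_sqrt_sq_add_sq (z : ℝ) (Φ : ℝ → ℝ≥0∞) (hΦ : Measurable Φ) :
    ∫⁻ p : ℝ × ℝ, Φ (√(z ^ 2 + (p.1 ^ 2 + p.2 ^ 2))) =
      ∫⁻ s in Set.Ioi |z|, ENNReal.ofReal (2 * π * s) * Φ s := by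
  rw [← lintegral_comp_polarCoord_symm]
  have h1 : ∀ p : ℝ × ℝ, (ENNReal.ofReal p.1 •
      (fun p : ℝ × ℝ => Φ (√(z ^ 2 + (p.1 ^ 2 + p.2 ^ 2)))) (polarCoord.symm p)) =
      ENNReal.ofReal p.1 * Φ (√(z ^ 2 + p.1 ^ 2)) := by
    intro p
    simp only [polarCoord_symm_apply, smul_eq_mul]
    congr 4
    nlinarith [sin_sq_add_cos_sq p.2]
  simp only [h1]
  rw [polarCoord_target, Measure.volume_eq_prod, setLIntegral_prod _ (by fun_prop)]
  have h2 : Set.Ioi |z| = (fun ρ : ℝ => √(z ^ 2 + ρ ^ 2)) '' Set.Ioi 0 := by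
    ext s
    simp only [Set.mem_Ioi, Set.mem_image]
    constructor
    · intro hs
      have hs0 : 0 < s := (abs_nonneg z).trans_lt hs
      have : z ^ 2 < s ^ 2 := sq_lt_sq.2 (by rwa [abs_of_pos hs0])
      refine ⟨√(s ^ 2 - z ^ 2), sqrt_pos.2 (by linarith), ?_⟩
      rw [sq_sqrt (by linarith)]
      rw [show z ^ 2 + (s ^ 2 - z ^ 2) = s ^ 2 by ring, sqrt_sq hs0.le]
    · rintro ⟨ρ, hρ, rfl⟩
      refine lt_sqrt_of_sq_lt ?_
      rw [sq_abs]
      have := pow_pos hρ 2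
      linarith
  rw [h2, lintegral_image_eq_lintegral_abs_deriv_mul measurableSet_Ioi
    (f' := fun ρ => ρ / √(z ^ 2 + ρ ^ 2))]
  · refine setLIntegral_congr_fun measurableSet_Ioi fun ρ hρ => ?_
    have hρ : 0 < ρ := hρ
    have hs : 0 < √(z ^ 2 + ρ ^ 2) := by positivity
    simp only
    rw [lintegral_const, ← mul_assoc, ← ENNReal.ofReal_mul (by positivity), abs_of_pos (by positivity)]
    simp only [MeasurableSet.univ, Measure.restrict_apply, Set.univ_inter, Real.volume_Ioo]
    rw [mul_right_comm, ← ENNReal.ofReal_mul hρ.le]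
    congr 2
    field_simp
    ring
  · intro ρ hρ
    have hρ : 0 < ρ := hρ
    have h3 : HasDerivAt (fun ρ : ℝ => z ^ 2 + ρ ^ 2) (2 * ρ) ρ := by
      simpa using (hasDerivAt_pow 2 ρ).const_add (z ^ 2)
    have h4 := h3.sqrt (by positivity)
    refine (h4.congr_deriv ?_).hasDerivWithinAt
    field_simp
  · intro a ha b hb hab
    have ha : 0 < a := ha
    have hb : 0 < b := hb
    simp only at hab
    rw [sqrt_inj (by positivity) (by positivity)] at hab
    have : a ^ 2 = b ^ 2 := by linarith
    exact (pow_left_inj₀ ha.le hb.le two_ne_zero).1 this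

/-- The measurable equivalence `ℝ³ ≃ ℝ × (ℝ × ℝ)`. -/
noncomputable def e3Equiv : E3 ≃ᵐ ℝ × (ℝ × ℝ) :=
  (MeasurableEquiv.toLp 2 (Fin 3 → ℝ)).symm.trans
    ((MeasurableEquiv.piFinSuccAbove (fun _ => ℝ) 0).trans
      (MeasurableEquiv.prodCongr (MeasurableEquiv.refl ℝ) MeasurableEquiv.finTwoArrow))

lemma e3Equiv_apply (y : E3) : e3Equiv y = (y 0, y 1, y 2) := by
  simp [e3Equiv, MeasurableEquiv.piFinSuccAbove, MeasurableEquiv.finTwoArrow,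
    MeasurableEquiv.piFinTwo, Fin.insertNthEquiv, MeasurableEquiv.prodCongr]
  constructor <;> rfl

lemma measurePreserving_e3Equiv : MeasurePreserving e3Equiv := by
  refine (PiLp.volume_preserving_ofLp (Fin 3)).trans ?_
  refine (volume_preserving_piFinSuccAbove (fun _ => ℝ) 0).trans ?_
  exact (MeasurePreserving.id volume).prod (volume_preserving_finTwoArrow ℝ)

lemma norm_E3 (y : E3) : ‖y‖ = √(y 0 ^ 2 + (y 1 ^ 2 + y 2 ^ 2)) := by
  rw [EuclideanSpace.norm_eq]
  simp [Fin.sum_univ_three, add_assoc]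

open scoped ENNReal in
lemma lintegral_norm_coord (Φ : ℝ × ℝ → ℝ≥0∞) (hΦ : Measurable Φ) :
    ∫⁻ y : E3, Φ (‖y‖, y 0) =
      ∫⁻ s in Set.Ioi 0, ENNReal.ofReal (2 * π * s) * ∫⁻ z in Set.Ioo (-s) s, Φ (s, z) := by
  have h1 : ∀ y : E3, Φ (‖y‖, y 0) =
      (fun q : ℝ × (ℝ × ℝ) => Φ (√(q.1 ^ 2 + (q.2.1 ^ 2 + q.2.2 ^ 2)), q.1)) (e3Equiv y) := by
    intro y
    simp [e3Equiv_apply, ← norm_E3]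
  rw [lintegral_congr h1]
  refine (measurePreserving_e3Equiv.lintegral_comp (f := fun q : ℝ × (ℝ × ℝ) =>
    Φ (√(q.1 ^ 2 + (q.2.1 ^ 2 + q.2.2 ^ 2)), q.1)) (by fun_prop)).trans ?_
  rw [Measure.volume_eq_prod, lintegral_prod _ (by fun_prop)]
  simp only
  have h2 : ∀ z : ℝ, ∫⁻ p : ℝ × ℝ, Φ (√(z ^ 2 + (p.1 ^ 2 + p.2 ^ 2)), z) =
      ∫⁻ s : ℝ, {q : ℝ × ℝ | |q.2| < q.1}.indicator
        (fun q => ENNReal.ofReal (2 * π * q.1) * Φ q) (s, z) := by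
    intro z
    rw [lintegral_sqrt_sq_add_sq z (fun s => Φ (s, z)) (by fun_prop),
      ← lintegral_indicator measurableSet_Ioi]
    rfl
  simp only [h2]
  have hm : MeasurableSet {q : ℝ × ℝ | |q.2| < q.1} :=
    measurableSet_lt (by fun_prop) (by fun_prop)
  rw [lintegral_lintegral_swap]
  · rw [← lintegral_indicator measurableSet_Ioi]
    refine lintegral_congr fun s => ?_
    by_cases hs : 0 < s
    · rw [Set.indicator_of_mem (by exact hs), ← lintegral_const_mul _ (by fun_prop),
        ← lintegral_indicator measurableSet_Ioo]
      refine lintegral_congr fun z => ?_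
      simp [Set.indicator, abs_lt]
    · rw [Set.indicator_of_notMem (by exact hs)]
      rw [lintegral_eq_zero_iff (by fun_prop)]
      refine Eventually.of_forall fun z => ?_
      have : ¬ |z| < s := fun h => hs ((abs_nonneg z).trans_lt h)
      simp [Set.indicator, this]
  · have : Measurable ({q : ℝ × ℝ | |q.2| < q.1}.indicator
        (fun q => ENNReal.ofReal (2 * π * q.1) * Φ q)) :=
      (by fun_prop : Measurable fun q : ℝ × ℝ => ENNReal.ofReal (2 * π * q.1) * Φ q).indicator hm
    exact (this.comp measurable_swap).aemeasurable

/-- The density of the image of Lebesgue measure under `y ↦ (|y|, y₀)`. -/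
noncomputable def cylDensity : ℝ × ℝ → NNReal :=
  {q : ℝ × ℝ | |q.2| < q.1}.indicator fun q => (2 * π * q.1).toNNReal

lemma measurable_cylDensity : Measurable cylDensity :=
  (by fun_prop : Measurable fun q : ℝ × ℝ => (2 * π * q.1).toNNReal).indicator
    (measurableSet_lt (by fun_prop) (by fun_prop))

lemma cylDensity_nonpos {s : ℝ} (hs : ¬ 0 < s) (z : ℝ) : cylDensity (s, z) = 0 :=
  Set.indicator_of_notMem (s := {q : ℝ × ℝ | |q.2| < q.1})
    (fun h => hs ((abs_nonneg z).trans_lt h)) _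

lemma map_norm_coord : Measure.map (fun y : E3 => ((‖y‖, y 0) : ℝ × ℝ)) volume =
    (volume : Measure (ℝ × ℝ)).withDensity (fun q => cylDensity q) := by
  have hmeas : Measurable (fun y : E3 => ((‖y‖, y 0) : ℝ × ℝ)) := by fun_prop
  refine Measure.ext fun S hS => ?_
  rw [Measure.map_apply hmeas hS, withDensity_apply _ hS, ← lintegral_indicator_one (hmeas hS),
    ← lintegral_indicator hS]
  have h := lintegral_norm_coord (S.indicator 1) (measurable_one.indicator hS)
  refine Eq.trans (by rfl) (h.trans ?_)
  rw [Measure.volume_eq_prod, lintegral_prod _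
    ((measurable_cylDensity.coe_nnreal_ennreal.indicator hS).aemeasurable),
    ← lintegral_indicator measurableSet_Ioi]
  refine lintegral_congr fun s => ?_
  have hm1 : Measurable fun z : ℝ => S.indicator (1 : ℝ × ℝ → ENNReal) (s, z) :=
    (measurable_one.indicator hS).comp measurable_prodMk_left
  have hm2 : Measurable fun z : ℝ => S.indicator (fun q => (cylDensity q : ENNReal)) (s, z) :=
    (measurable_cylDensity.coe_nnreal_ennreal.indicator hS).comp measurable_prodMk_left
  by_cases hs : 0 < s
  · rw [Set.indicator_of_mem (by exact hs), ← lintegral_const_mul _ hm1, ← lintegral_indicator measurableSet_Ioo]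
    refine lintegral_congr fun z => ?_
    by_cases h1 : (s, z) ∈ S <;> by_cases h2 : |z| < s <;>
      simp [Set.indicator, cylDensity, h1, h2, ← abs_lt, ENNReal.ofReal]
  · rw [Set.indicator_of_notMem (by exact hs), eq_comm, lintegral_eq_zero_iff hm2]
    refine Eventually.of_forall fun z => ?_
    simp [Set.indicator, cylDensity_nonpos hs]

lemma integral_cylDensity_mul (G : ℝ × ℝ → ℝ) (s : ℝ) :
    ∫ z, (cylDensity (s, z) : ℝ) * G (s, z) =
      (Set.Ioi (0 : ℝ)).indicator (fun s => 2 * π * s * ∫ z in -s..s, G (s, z)) s := by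
  by_cases hs : 0 < s
  · rw [Set.indicator_of_mem (by exact hs), intervalIntegral.integral_of_le (by linarith),
      ← integral_Ioc_eq_integral_Ioo.symm, ← integral_const_mul,
      ← integral_indicator measurableSet_Ioo]
    refine integral_congr_ae (Eventually.of_forall fun z => ?_)
    have : 0 ≤ 2 * π * s := by positivity
    by_cases h2 : |z| < s <;> simp [Set.indicator, cylDensity, h2, ← abs_lt, this]
  · rw [Set.indicator_of_notMem (by exact hs)]
    simp [cylDensity_nonpos hs]

lemma integral_norm_coord {G : ℝ × ℝ → ℝ} (hG : Measurable G)
    (hFint : Integrable (fun y : E3 => G (‖y‖, y 0))) :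
    IntegrableOn (fun s => 2 * π * s * ∫ z in -s..s, G (s, z)) (Set.Ioi 0) ∧
      ∫ y : E3, G (‖y‖, y 0) = ∫ s in Set.Ioi 0, 2 * π * s * ∫ z in -s..s, G (s, z) := by
  have hmeas : Measurable (fun y : E3 => ((‖y‖, y 0) : ℝ × ℝ)) := by fun_prop
  have h1 : Integrable G (Measure.map (fun y : E3 => ((‖y‖, y 0) : ℝ × ℝ)) volume) :=
    (integrable_map_measure hG.aestronglyMeasurable hmeas.aemeasurable).2 hFint
  rw [map_norm_coord, integrable_withDensity_iff_integrable_smul measurable_cylDensity] at h1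
  have h2 : ∀ s, ∫ z, cylDensity (s, z) • G (s, z) =
      (Set.Ioi (0 : ℝ)).indicator (fun s => 2 * π * s * ∫ z in -s..s, G (s, z)) s :=
    integral_cylDensity_mul G
  constructor
  · rw [← integrable_indicator_iff measurableSet_Ioi]
    exact h1.integral_prod_left.congr (Eventually.of_forall h2)
  · rw [← integral_indicator measurableSet_Ioi,
      ← integral_map hmeas.aemeasurable (f := G) hG.aestronglyMeasurable, map_norm_coord,
      integral_withDensity_eq_integral_smul measurable_cylDensity, Measure.volume_eq_prod,
      integral_prod _ h1]
    exact integral_congr_ae (Eventually.of_forall h2)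

lemma integral_radial (Φ : ℝ → ℝ) :
    ∫ y : E3, Φ ‖y‖ = ∫ s in Set.Ioi 0, 2 * π * s * (2 * s * Φ s) := by
  rw [integral_fun_norm_addHaar volume Φ, finrank_E3, Measure.real,
    EuclideanSpace.volume_ball_fin_three]
  simp only [nsmul_eq_mul, smul_eq_mul]
  rw [← mul_assoc, ← integral_const_mul]
  refine setIntegral_congr_fun measurableSet_Ioi fun s _ => ?_
  have : (ENNReal.ofReal 1 ^ 3 * ENNReal.ofReal (π * 4 / 3)).toReal = π * 4 / 3 := by
    rw [ENNReal.ofReal_one, one_pow, one_mul, ENNReal.toReal_ofReal (by positivity)]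
  simp only [this]
  push_cast
  ring

/-- Averaging over spheres: a function of `(|y|, y₀)` may be replaced by its spherical mean. -/
lemma integral_eq_integral_sphere_mean {G : ℝ × ℝ → ℝ} (hG : Measurable G)
    (hFint : Integrable (fun y : E3 => G (‖y‖, y 0))) {Φ : ℝ → ℝ}
    (hΦ : ∀ s, 0 < s → ∫ z in -s..s, G (s, z) = 2 * s * Φ s) :
    Integrable (fun y : E3 => Φ ‖y‖) ∧ ∫ y : E3, G (‖y‖, y 0) = ∫ y : E3, Φ ‖y‖ := by
  obtain ⟨h1, h2⟩ := integral_norm_coord hG hFint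
  have h3 : Set.EqOn (fun s => 2 * π * s * ∫ z in -s..s, G (s, z))
      (fun s => 2 * π * s * (2 * s * Φ s)) (Set.Ioi 0) := fun s hs => by
    simp only [hΦ s hs]
  constructor
  · rw [integrable_fun_norm_addHaar volume (f := Φ), finrank_E3]
    refine (((h1.congr_fun h3 measurableSet_Ioi)).const_mul (1 / (4 * π))).congr
      (Eventually.of_forall fun s => ?_)
    simp only [smul_eq_mul]
    field_simp
    ring
  · rw [h2, integral_radial, setIntegral_congr_fun measurableSet_Ioi h3]

/-! ### Spherical means of the logarithmic kernel -/

/-- `∫_{-1}^1 log (cosh x - t) dt + 2`. -/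
noncomputable def logMean (x : ℝ) : ℝ :=
  (cosh x + 1) * log (cosh x + 1) - (cosh x - 1) * log (cosh x - 1)

lemma continuous_logMean : Continuous logMean := by
  have h1 : Continuous fun x : ℝ => cosh x + 1 := by fun_prop
  have h2 : Continuous fun x : ℝ => cosh x - 1 := by fun_prop
  exact (continuous_mul_log.comp h1).sub (continuous_mul_log.comp h2)

lemma logMean_abs (x : ℝ) : logMean |x| = logMean x := by simp [logMean]

lemma two_mul_le_log_sub_log {x : ℝ} (h0 : 0 ≤ x) (h1 : x < 1) :
    2 * x ≤ log (1 + x) - log (1 - x) := by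
  have h := hasSum_log_sub_log_of_abs_lt_one (x := x) (by rwa [abs_of_nonneg h0])
  have := le_hasSum h 0 (fun j _ => by positivity)
  simpa using this

lemma hasDerivAt_logMean {x : ℝ} (hx : 0 < x) :
    HasDerivAt logMean (sinh x * (log (cosh x + 1) - log (cosh x - 1))) x := by
  have hc : 1 < cosh x := one_lt_cosh.2 hx.ne'
  have h1 := (hasDerivAt_mul_log (x := cosh x + 1) (by linarith)).comp x
    ((hasDerivAt_cosh x).add_const 1)
  have h2 := (hasDerivAt_mul_log (x := cosh x - 1) (by linarith)).comp x
    ((hasDerivAt_cosh x).sub_const 1)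
  exact (h1.sub h2).congr_deriv (by ring)

lemma hasDerivAt_deriv_logMean {x : ℝ} (hx : 0 < x) :
    HasDerivAt (fun x => sinh x * (log (cosh x + 1) - log (cosh x - 1)))
      (cosh x * (log (cosh x + 1) - log (cosh x - 1)) - 2) x := by
  have hc : 1 < cosh x := one_lt_cosh.2 hx.ne'
  have h1 := ((hasDerivAt_cosh x).add_const 1).log (by linarith)
  have h2 := ((hasDerivAt_cosh x).sub_const 1).log (by linarith)
  refine ((hasDerivAt_sinh x).mul (h1.sub h2)).congr_deriv ?_
  have h3 : sinh x ^ 2 = cosh x ^ 2 - 1 := by rw [sinh_sq]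
  have h4 : cosh x + 1 ≠ 0 := by linarith
  have h5 : cosh x - 1 ≠ 0 := by linarith
  have : sinh x * (sinh x / (cosh x + 1) - sinh x / (cosh x - 1)) = -2 := by
    field_simp
    rw [h3]
    ring
  simp only [Pi.sub_apply]
  rw [this]
  ring

lemma two_le_cosh_mul {c : ℝ} (hc : 1 < c) : 2 ≤ c * (log (c + 1) - log (c - 1)) := by
  have h0 : 0 < c := by linarith
  have h := two_mul_le_log_sub_log (x := c⁻¹) (by positivity) (inv_lt_one_of_one_lt₀ hc)
  rw [show 1 + c⁻¹ = (c + 1) / c by field_simp, show 1 - c⁻¹ = (c - 1) / c by field_simp,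
    log_div (by linarith) h0.ne', log_div (by linarith) h0.ne'] at h
  have := mul_le_mul_of_nonneg_left h h0.le
  have h2 : c * (2 * c⁻¹) = 2 := by field_simp
  linarith

lemma convexOn_logMean_Ici : ConvexOn ℝ (Set.Ici 0) logMean := by
  refine convexOn_of_hasDerivWithinAt2_nonneg (convex_Ici 0) continuous_logMean.continuousOn
    (f' := fun x => sinh x * (log (cosh x + 1) - log (cosh x - 1)))
    (f'' := fun x => cosh x * (log (cosh x + 1) - log (cosh x - 1)) - 2) ?_ ?_ ?_
  all_goals
    intro x hx
    rw [interior_Ici] at hx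
  · exact (hasDerivAt_logMean hx).hasDerivWithinAt
  · exact (hasDerivAt_deriv_logMean hx).hasDerivWithinAt
  · have := two_le_cosh_mul (one_lt_cosh.2 (ne_of_gt (show 0 < x from hx)))
    linarith

lemma monotoneOn_logMean_Ici : MonotoneOn logMean (Set.Ici 0) := by
  refine monotoneOn_of_hasDerivWithinAt_nonneg (convex_Ici 0) continuous_logMean.continuousOn
    (f' := fun x => sinh x * (log (cosh x + 1) - log (cosh x - 1))) ?_ ?_
  all_goals
    intro x hx
    rw [interior_Ici] at hx
    have hx : 0 < x := hx
  · exact (hasDerivAt_logMean hx).hasDerivWithinAt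
  · have h1 := one_lt_cosh.2 hx.ne'
    have h2 := log_le_log (by linarith : 0 < cosh x - 1) (by linarith : cosh x - 1 ≤ cosh x + 1)
    exact mul_nonneg (sinh_nonneg_iff.2 hx.le) (by linarith)

lemma convexOn_logMean : ConvexOn ℝ Set.univ logMean := by
  have himg : (fun x : ℝ => |x|) '' Set.univ = Set.Ici 0 := by
    ext y
    simp only [Set.image_univ, Set.mem_range, Set.mem_Ici]
    exact ⟨fun ⟨x, hx⟩ => hx ▸ abs_nonneg x, fun h => ⟨y, abs_of_nonneg h⟩⟩
  have h := ConvexOn.comp (g := logMean) (f := fun x : ℝ => |x|) (s := Set.univ)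
    (by rw [himg]; exact convexOn_logMean_Ici) (convexOn_univ_norm (E := ℝ))
    (by rw [himg]; exact monotoneOn_logMean_Ici)
  refine h.congr fun x _ => logMean_abs x

/-- The spherical mean of `log |r e - s ω|` is `log s + logGain (log r - log s)`. -/
noncomputable def logGain (x : ℝ) : ℝ := x / 2 + (logMean x - 2) / 4 + log 2 / 2

lemma convexOn_logGain : ConvexOn ℝ Set.univ logGain := by
  have h1 := convexOn_logMean.smul (show (0:ℝ) ≤ 1 / 4 by norm_num)
  have h2 : ConvexOn ℝ Set.univ (fun x : ℝ => x / 2 - 1 / 2 + log 2 / 2) := by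
    refine ⟨convex_univ, fun x _ y _ a b _ _ hab => le_of_eq ?_⟩
    simp only [smul_eq_mul]
    linear_combination (1 / 2 - log 2 / 2) * hab
  refine (h1.add h2).congr fun x _ => ?_
  simp only [Pi.add_apply, smul_eq_mul, logGain]
  ring

lemma integral_log_sphere {r s : ℝ} (hr : 0 < r) (hs : 0 < s) :
    ∫ z in -s..s, log (r ^ 2 + s ^ 2 - 2 * r * z) / 2 =
      2 * s * (log s + logGain (log r - log s)) := by
  have hc : cosh (log r - log s) = (r ^ 2 + s ^ 2) / (2 * r * s) := by
    rw [← log_div hr.ne' hs.ne', cosh_log (by positivity)]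
    field_simp
  have h1 : cosh (log r - log s) + 1 = (r + s) ^ 2 / (2 * r * s) := by
    rw [hc]; field_simp; ring
  have h2 : cosh (log r - log s) - 1 = (r - s) ^ 2 / (2 * r * s) := by
    rw [hc]; field_simp; ring
  have h3 : (r - s) ^ 2 * log ((r - s) ^ 2 / (2 * r * s)) =
      (r - s) ^ 2 * (log ((r - s) ^ 2) - log (2 * r * s)) := by
    by_cases h : r - s = 0
    · simp [h]
    · rw [log_div (by positivity) (by positivity)]
  have h4 : log (2 * r * s) = log 2 + log r + log s := by
    rw [log_mul (by positivity) hs.ne', log_mul two_ne_zero hr.ne']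
  have h5 : logMean (log r - log s) = ((r + s) ^ 2 * log ((r + s) ^ 2) -
      (r - s) ^ 2 * log ((r - s) ^ 2)) / (2 * r * s) - 2 * log (2 * r * s) := by
    rw [logMean, h1, h2, div_mul_eq_mul_div, div_mul_eq_mul_div, h3,
      log_div (by positivity) (by positivity)]
    field_simp
    ring
  rw [intervalIntegral.integral_div,
    intervalIntegral.integral_comp_sub_mul (fun w => log w) (by positivity : 2 * r ≠ 0), integral_log,
    logGain, h5, show r ^ 2 + s ^ 2 - 2 * r * s = (r - s) ^ 2 by ring,
    show r ^ 2 + s ^ 2 - 2 * r * -s = (r + s) ^ 2 by ring, h4, smul_eq_mul]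
  field_simp
  ring

lemma logGain_eq_integral (x : ℝ) :
    2 * logGain x = ∫ z in (-1 : ℝ)..1, log (exp x ^ 2 + 1 ^ 2 - 2 * exp x * z) / 2 := by
  rw [integral_log_sphere (exp_pos x) one_pos]
  simp

lemma logGain_le_log_two {x : ℝ} (hx : x ≤ 0) : logGain x ≤ log 2 := by
  have hr := exp_pos x
  have hr1 : exp x ≤ 1 := exp_le_one_iff.2 hx
  have h : 2 * logGain x ≤ ∫ z in (-1 : ℝ)..1, log 2 := by
    rw [logGain_eq_integral]
    by_cases hI : IntervalIntegrable
        (fun z => log (exp x ^ 2 + 1 ^ 2 - 2 * exp x * z) / 2) volume (-1) 1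
    · refine intervalIntegral.integral_mono_on (by norm_num) hI (by simp) fun z hz => ?_
      rcases (by nlinarith [hz.1, hz.2, sq_nonneg (exp x - 1)] : 0 ≤ exp x ^ 2 + 1 ^ 2 - 2 * exp x * z).eq_or_lt with h0 | h0
      · rw [← h0]; simp [log_nonneg]
      · have := log_le_log h0 (by nlinarith [hz.1, hz.2] :
          exp x ^ 2 + 1 ^ 2 - 2 * exp x * z ≤ 2 ^ 2)
        rw [log_pow] at this
        rw [div_le_iff₀' two_pos]
        exact_mod_cast this
    · rw [intervalIntegral.integral_undef hI]
      simp [log_nonneg]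
  norm_num at h
  linarith

lemma log_le_logGain {x : ℝ} (hx : x < 0) : log (1 - exp x) ≤ logGain x := by
  have hr := exp_pos x
  have hr1 : exp x < 1 := exp_zero ▸ exp_lt_exp.2 hx
  have h : ∫ z in (-1 : ℝ)..1, log (1 - exp x) ≤ 2 * logGain x := by
    rw [logGain_eq_integral]
    have hp : ∀ z ∈ Set.Icc (-1 : ℝ) 1,
        (1 - exp x) ^ 2 ≤ exp x ^ 2 + 1 ^ 2 - 2 * exp x * z := fun z hz => by
      nlinarith [hz.2]
    have hp0 : 0 < (1 - exp x) ^ 2 := pow_pos (by linarith) 2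
    refine intervalIntegral.integral_mono_on (by norm_num) (by simp) ?_ fun z hz => ?_
    · refine ContinuousOn.intervalIntegrable ?_
      rw [Set.uIcc_of_le (by norm_num)]
      exact (ContinuousOn.log (by fun_prop) fun z hz => (hp0.trans_le (hp z hz)).ne').div_const 2
    · have := log_le_log hp0 (hp z hz)
      rw [log_pow] at this
      rw [le_div_iff₀' two_pos]
      exact_mod_cast this
  norm_num at h
  linarith

lemma monotone_logGain : Monotone logGain := by
  intro a b hab
  by_contra! hlt
  have hab : a < b := hab.lt_of_ne (fun h => by simp [h] at hlt)
  set m := (logGain a - logGain b) / (b - a) with hm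
  have hm0 : 0 < m := div_pos (by linarith) (by linarith)
  have key : ∀ x < a, logGain a + m * (a - x) ≤ logGain x := by
    intro x hx
    have h := convexOn_logGain.slope_mono_adjacent (Set.mem_univ x) (Set.mem_univ b) hx hab
    have h2 : (logGain b - logGain a) / (b - a) = -m := by rw [hm]; ring
    rw [h2, div_le_iff₀ (by linarith)] at h
    linarith
  set x := min (min (a - 1) 0) (a - (log 2 - logGain a + 1) / m)
  have h1 : x ≤ a - 1 := (min_le_left _ _).trans (min_le_left _ _)
  have h2 : x ≤ 0 := (min_le_left _ _).trans (min_le_right _ _)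
  have h3 : x ≤ a - (log 2 - logGain a + 1) / m := min_le_right _ _
  have h4 := key x (by linarith)
  have h5 := logGain_le_log_two h2
  have h6 : log 2 - logGain a + 1 ≤ m * (a - x) := by
    rw [← div_le_iff₀' hm0]
    linarith
  linarith

lemma logGain_nonneg (x : ℝ) : 0 ≤ logGain x := by
  have h1 : Tendsto (fun y : ℝ => log (1 - exp y)) atBot (nhds 0) := by
    have : Tendsto (fun y : ℝ => 1 - exp y) atBot (nhds (1 - 0)) :=
      tendsto_exp_atBot.const_sub 1
    rw [sub_zero] at this
    simpa using this.log one_ne_zero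
  refine le_of_tendsto h1 ?_
  filter_upwards [eventually_lt_atBot (0:ℝ), eventually_le_atBot x] with y hy hyx
  exact (log_le_logGain hy).trans (monotone_logGain hyx)

/-- The mean of `log |x - y|` over `|y| = s`, as a function of `r = |x|`. -/
noncomputable def logSphere (r s : ℝ) : ℝ :=
  if r = 0 then log s else log s + logGain (log r - log s)

lemma integral_log_eq_logSphere {r s : ℝ} (hr : 0 ≤ r) (hs : 0 < s) :
    ∫ z in -s..s, log (r ^ 2 + s ^ 2 - 2 * r * z) / 2 = 2 * s * logSphere r s := by
  rcases hr.eq_or_lt with rfl | hr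
  · simp only [logSphere, if_true, ne_eq, OfNat.ofNat_ne_zero, not_false_eq_true, zero_pow, zero_add,
      mul_zero, zero_mul, sub_zero, intervalIntegral.integral_const, smul_eq_mul, log_pow]
    push_cast
    ring
  · rw [integral_log_sphere hr hs, logSphere, if_neg hr.ne']

lemma logSphere_mono {r r' s : ℝ} (hr : 0 ≤ r) (h : r ≤ r') : logSphere r s ≤ logSphere r' s := by
  unfold logSphere
  rcases hr.eq_or_lt with rfl | hr
  · rw [if_pos rfl]
    split_ifs
    · exact le_rfl
    · linarith [logGain_nonneg (log r' - log s)]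
  · rw [if_neg hr.ne', if_neg (hr.trans_le h).ne']
    have := monotone_logGain (sub_le_sub_right (log_le_log hr h) (log s))
    linarith

lemma convexOn_sub_antitone {g : ℝ → ℝ} (hg : ConvexOn ℝ Set.univ g) {a b t : ℝ} (hab : a ≤ b)
    (ht : 0 ≤ t) : g (b - t) - g (a - t) ≤ g b - g a := by
  rcases hab.eq_or_lt with rfl | hab
  · simp
  rcases ht.eq_or_lt with rfl | ht
  · simp
  have hL : 0 < b - a + t := by linarith
  have h1 := hg.2 (Set.mem_univ (a - t)) (Set.mem_univ b) (div_nonneg ht.le hL.le)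
    (div_nonneg (sub_nonneg.2 hab.le) hL.le) (by field_simp; ring)
  have h2 := hg.2 (Set.mem_univ (a - t)) (Set.mem_univ b) (div_nonneg (sub_nonneg.2 hab.le) hL.le)
    (div_nonneg ht.le hL.le) (by field_simp)
  simp only [smul_eq_mul] at h1 h2
  rw [show t / (b - a + t) * (a - t) + (b - a) / (b - a + t) * b = b - t by field_simp; ring] at h1
  rw [show (b - a) / (b - a + t) * (a - t) + t / (b - a + t) * b = a by field_simp; ring] at h2
  have h3 : t / (b - a + t) = 1 - (b - a) / (b - a + t) := by field_simp; ring
  rw [h3] at h1 h2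
  linarith

lemma logSphere_sub_antitone {r r' s s' : ℝ} (hr : 0 ≤ r) (h : r ≤ r') (hs : 0 < s)
    (hss : s ≤ s') :
    logSphere r' s' - logSphere r s' ≤ logSphere r' s - logSphere r s := by
  unfold logSphere
  have hl := log_le_log hs hss
  rcases hr.eq_or_lt with rfl | hr
  · rw [if_pos rfl, if_pos rfl]
    split_ifs
    · simp
    · have := monotone_logGain (sub_le_sub_left hl (log r'))
      linarith
  · rw [if_neg hr.ne', if_neg (hr.trans_le h).ne', if_neg hr.ne', if_neg (hr.trans_le h).ne']
    have := convexOn_sub_antitone convexOn_logGain (sub_le_sub_right (log_le_log hr h) (log s))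
      (sub_nonneg.2 hl)
    simp only [sub_sub_sub_cancel_right] at this
    linarith

/-! ### Logarithmic potentials of radial functions -/

/-- A function on `ℝ³` that depends only on the norm. -/
def IsRadial (f : E3 → ℝ) : Prop := ∀ x y, ‖x‖ = ‖y‖ → f x = f y

/-- The first coordinate vector. -/
noncomputable def axis : E3 := EuclideanSpace.single 0 1

lemma norm_axis : ‖axis‖ = 1 := by simp [axis]

lemma norm_smul_axis {r : ℝ} (hr : 0 ≤ r) : ‖r • axis‖ = r := by
  rw [norm_smul, norm_axis, mul_one, norm_of_nonneg hr]

lemma norm_smul_axis_sub_sq (r : ℝ) (y : E3) :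
    ‖r • axis - y‖ ^ 2 = r ^ 2 + ‖y‖ ^ 2 - 2 * r * y 0 := by
  rw [norm_sub_sq_real, norm_smul, norm_axis, mul_one, norm_eq_abs, sq_abs, real_inner_smul_left]
  simp only [axis, EuclideanSpace.inner_single_left]
  simp
  ring

lemma log_norm_smul_axis_sub (r : ℝ) (y : E3) :
    log ‖r • axis - y‖ = log (r ^ 2 + ‖y‖ ^ 2 - 2 * r * y 0) / 2 := by
  rw [← norm_smul_axis_sub_sq, log_pow]
  push_cast
  ring

lemma exists_isometry_eq {x x' : E3} (h : ‖x‖ = ‖x'‖) : ∃ ρ : E3 ≃ₗᵢ[ℝ] E3, ρ x = x' :=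
  ⟨(Submodule.span ℝ {x - x'})ᗮ.reflection, Submodule.reflection_sub h⟩

lemma IsRadial.logPot {f : E3 → ℝ} (hf : IsRadial f) : IsRadial (logPot f) := by
  intro x x' h
  obtain ⟨ρ, hρ⟩ := exists_isometry_eq h
  have := (ρ.measurePreserving).integral_comp ρ.toHomeomorph.measurableEmbedding
    (fun y => (log ‖y‖ - log ‖x' - y‖) * f y)
  rw [_root_.logPot, _root_.logPot, ← this]
  refine integral_congr_ae (Eventually.of_forall fun y => ?_)
  simp only [← hρ, ← map_sub, LinearIsometryEquiv.norm_map]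
  rw [hf y (ρ y) (by simp)]

lemma integral_log_mul_radial {f : E3 → ℝ} (hf : WtBounded f) (hr : IsRadial f) {r : ℝ}
    (hr0 : 0 ≤ r) :
    Integrable (fun y => logSphere r ‖y‖ * f y) ∧
      ∫ y, log ‖r • axis - y‖ * f y = ∫ y, logSphere r ‖y‖ * f y := by
  set F : ℝ → ℝ := fun s => f (|s| • axis) with hF
  have hFm : Measurable F := hf.meas.comp (by fun_prop)
  have hfF : ∀ y, f y = F ‖y‖ := fun y => hr _ _ (by
    rw [abs_norm, norm_smul_axis (norm_nonneg y)])
  have h := integral_eq_integral_sphere_mean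
    (G := fun q => log (r ^ 2 + q.1 ^ 2 - 2 * r * q.2) / 2 * F q.1) (by fun_prop)
    (by
      refine (hf.integrable_log (r • axis)).congr (Eventually.of_forall fun y => ?_)
      simp only
      rw [log_norm_smul_axis_sub, hfF])
    (Φ := fun s => logSphere r s * F s) (fun s hs => by
      simp only
      rw [intervalIntegral.integral_mul_const, integral_log_eq_logSphere hr0 hs]
      ring)
  constructor
  · refine h.1.congr (Eventually.of_forall fun y => ?_)
    simp only
    rw [hfF]
  · calc ∫ y, log ‖r • axis - y‖ * f y = _ := ?_
      _ = _ := h.2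
      _ = _ := ?_
    · refine integral_congr_ae (Eventually.of_forall fun y => ?_)
      simp only
      rw [log_norm_smul_axis_sub, hfF]
    · refine integral_congr_ae (Eventually.of_forall fun y => ?_)
      simp only
      rw [hfF]

lemma logPot_sub_logPot_radial {f : E3 → ℝ} (hf : WtBounded f) (hr : IsRadial f) (x x' : E3) :
    Integrable (fun y => (logSphere ‖x'‖ ‖y‖ - logSphere ‖x‖ ‖y‖) * f y) ∧
      logPot f x - logPot f x' = ∫ y, (logSphere ‖x'‖ ‖y‖ - logSphere ‖x‖ ‖y‖) * f y := by
  have e : ∀ x : E3, logPot f x =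
      (∫ y, log ‖y‖ * f y) - ∫ y, logSphere ‖x‖ ‖y‖ * f y := by
    intro x
    rw [hr.logPot x (‖x‖ • axis) (by rw [norm_smul_axis (norm_nonneg x)]), logPot,
      ← (integral_log_mul_radial hf hr (norm_nonneg x)).2,
      ← integral_sub hf.integrable_log_norm (hf.integrable_log _)]
    simp only [sub_mul]
  have h1 := (integral_log_mul_radial hf hr (norm_nonneg x)).1
  have h2 := (integral_log_mul_radial hf hr (norm_nonneg x')).1
  constructor
  · simp only [sub_mul]
    exact h2.sub h1
  · rw [e, e]
    simp only [sub_mul]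
    rw [integral_sub h2 h1]
    ring

/-! ### The potential of the standard bubble -/

lemma hasDerivAt_bubble_primitive (s : ℝ) :
    HasDerivAt (fun s : ℝ => (arctan s + (s * (s ^ 2 - 1)) / (1 + s ^ 2) ^ 2) / 8)
      (s ^ 2 / (1 + s ^ 2) ^ 3) s := by
  have h0 : (1 + s ^ 2) ≠ 0 := by positivity
  have h1 : HasDerivAt (fun s : ℝ => s * (s ^ 2 - 1)) (3 * s ^ 2 - 1) s := by
    refine ((hasDerivAt_id' s).mul ((hasDerivAt_pow 2 s).sub_const 1)).congr_deriv ?_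
    simp
    ring
  have h2 : HasDerivAt (fun s : ℝ => (1 + s ^ 2) ^ 2) (4 * s * (1 + s ^ 2)) s := by
    refine (((hasDerivAt_pow 2 s).const_add 1).pow 2).congr_deriv ?_
    simp
    ring
  refine (((hasDerivAt_arctan s).add (h1.div h2 (by positivity))).div_const 8).congr_deriv ?_
  field_simp
  ring

lemma integral_wt : ∫ y, wt y = π ^ 2 / 4 := by
  have h := integral_radial (fun s => ((1 + s ^ 2) ^ 3)⁻¹)
  have hlim : Tendsto (fun s : ℝ => (arctan s + (s * (s ^ 2 - 1)) / (1 + s ^ 2) ^ 2) / 8) atTop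
      (nhds (π / 16)) := by
    have h2 : Tendsto (fun s : ℝ => (s * (s ^ 2 - 1)) / (1 + s ^ 2) ^ 2) atTop (nhds 0) := by
      refine squeeze_zero_norm' ?_ tendsto_inv_atTop_zero
      filter_upwards [eventually_gt_atTop 0] with s hs
      rw [norm_div, norm_mul, norm_of_nonneg hs.le, norm_of_nonneg (by positivity : 0 ≤ (1 + s ^ 2) ^ 2),
        div_le_iff₀ (by positivity), inv_mul_eq_div, le_div_iff₀ hs, norm_eq_abs]
      have : |s ^ 2 - 1| ≤ 1 + s ^ 2 := abs_le.2 ⟨by nlinarith, by nlinarith⟩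
      nlinarith [sq_nonneg s, abs_nonneg (s ^ 2 - 1)]
    have h1 := tendsto_nhds_of_tendsto_nhdsWithin tendsto_arctan_atTop
    have := (h1.add h2).div_const 8
    convert this using 2
    ring
  have h3 := integral_Ioi_of_hasDerivAt_of_nonneg' (a := 0)
    (fun s _ => hasDerivAt_bubble_primitive s) (fun s _ => by positivity) hlim
  calc ∫ y, wt y = _ := h
    _ = ∫ s in Set.Ioi (0 : ℝ), 4 * π * (s ^ 2 / (1 + s ^ 2) ^ 3) :=
      integral_congr_ae (Eventually.of_forall fun s => by ring)
    _ = _ := by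
      rw [integral_const_mul, h3]
      simp
      ring

/-- The squared chordal distance of two points, up to a constant factor. -/
noncomputable def chordSq (x y : E3) : ℝ := ‖x - y‖ ^ 2 / ((1 + ‖x‖ ^ 2) * (1 + ‖y‖ ^ 2))

open EuclideanGeometry in
lemma one_add_norm_inversion_sq {c y : E3} {R : ℝ} (hR : R ^ 2 = 1 + ‖c‖ ^ 2) (hy : y ≠ c) :
    1 + ‖inversion c R y‖ ^ 2 = R ^ 2 / ‖y - c‖ ^ 2 * (1 + ‖y‖ ^ 2) := by
  have h0 : ‖y - c‖ ≠ 0 := norm_ne_zero_iff.2 (sub_ne_zero.2 hy)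
  have h1 : ‖y‖ ^ 2 = ‖y - c‖ ^ 2 + 2 * inner ℝ (y - c) c + ‖c‖ ^ 2 := by
    rw [← norm_add_sq_real, sub_add_cancel]
  rw [inversion, vsub_eq_sub, vadd_eq_add, norm_add_sq_real, norm_smul, real_inner_smul_left,
    dist_eq_norm, h1, norm_pow, norm_div, norm_norm, mul_pow, ← pow_mul, norm_eq_abs, div_pow, div_pow,
    pow_mul |R|, sq_abs, hR]
  field_simp
  ring

open EuclideanGeometry in
lemma chordSq_inversion {c y z : E3} {R : ℝ} (hR : R ^ 2 = 1 + ‖c‖ ^ 2) (hy : y ≠ c) (hz : z ≠ c) :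
    chordSq (inversion c R y) (inversion c R z) = chordSq y z := by
  have h1 : ‖y - c‖ ≠ 0 := norm_ne_zero_iff.2 (sub_ne_zero.2 hy)
  have h2 : ‖z - c‖ ≠ 0 := norm_ne_zero_iff.2 (sub_ne_zero.2 hz)
  have h3 : R ^ 2 ≠ 0 := by rw [hR]; positivity
  have h4 : R ≠ 0 := fun h => by simp [h] at h3
  rw [chordSq, chordSq, one_add_norm_inversion_sq hR hy, one_add_norm_inversion_sq hR hz,
    ← dist_eq_norm, dist_inversion_inversion hy hz, dist_eq_norm, dist_eq_norm, dist_eq_norm]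
  field_simp

open EuclideanGeometry in
lemma abs_det_fderiv_inversion (c y : E3) (R : ℝ) :
    |((R / dist y c) ^ 2 • ((Submodule.span ℝ {y - c})ᗮ.reflection : E3 →L[ℝ] E3)).det| =
      (R ^ 2 / ‖y - c‖ ^ 2) ^ 3 := by
  have h : (((Submodule.span ℝ {y - c})ᗮ.reflection : E3 →L[ℝ] E3)).det =
      LinearMap.det ((Submodule.span ℝ {y - c})ᗮ.reflection).toLinearMap := rfl
  rw [ContinuousLinearMap.det, ContinuousLinearMap.toLinearMap_smul, LinearMap.det_smul, finrank_E3]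
  change |_ * ((((Submodule.span ℝ {y - c})ᗮ.reflection : E3 →L[ℝ] E3)).det)| = _
  rw [h, Submodule.det_reflection, abs_mul, abs_pow, abs_pow, abs_pow]
  simp [dist_eq_norm, abs_div, div_pow]

open EuclideanGeometry in
lemma integral_log_chordSq (x : E3) :
    ∫ y, log (chordSq x y) * wt y = ∫ y, log (chordSq 0 y) * wt y := by
  rcases eq_or_ne x 0 with rfl | hx
  · rfl
  have hx0 : ‖x‖ ≠ 0 := norm_ne_zero_iff.2 hx
  set c : E3 := -(‖x‖ ^ 2)⁻¹ • x with hc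
  set R : ℝ := √(1 + ‖c‖ ^ 2) with hRdef
  have hR : R ^ 2 = 1 + ‖c‖ ^ 2 := sq_sqrt (by positivity)
  have hR0 : R ≠ 0 := (sqrt_pos.2 (by positivity)).ne'
  have hcn : ‖c‖ = ‖x‖⁻¹ := by
    rw [hc, norm_smul, norm_neg, norm_inv, norm_pow, norm_norm]
    field_simp
  have hc0 : (0 : E3) ≠ c := by
    intro h
    rw [← h, norm_zero] at hcn
    exact inv_ne_zero hx0 hcn.symm
  have hT0 : inversion c R 0 = x := by
    rw [inversion, dist_eq_norm, div_pow, hR]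
    simp only [zero_sub, norm_neg, hcn, vsub_eq_sub, vadd_eq_add]
    rw [hc, neg_smul, neg_neg, smul_smul, ← sub_eq_add_neg, ← sub_smul]
    convert one_smul ℝ x using 2
    field_simp
    ring
  have himg : inversion c R '' {c}ᶜ = {c}ᶜ := by
    rw [Set.image_compl_eq (inversion_bijective c hR0), Set.image_singleton, inversion_self]
  have key := integral_image_eq_integral_abs_det_fderiv_smul volume
    (measurableSet_singleton c).compl (f := inversion c R)
    (fun y hy => (hasFDerivAt_inversion hy).hasFDerivWithinAt)
    (inversion_injective c hR0).injOn (fun y => log (chordSq x y) * wt y)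
  rw [himg, restrict_compl_singleton] at key
  rw [key]
  have hae : ∀ᵐ y : E3, y ≠ c := by simp [ae_iff]
  refine integral_congr_ae (hae.mono fun y hy => ?_)
  simp only
  have h1 : ‖y - c‖ ≠ 0 := norm_ne_zero_iff.2 (sub_ne_zero.2 hy)
  rw [abs_det_fderiv_inversion, smul_eq_mul]
  nth_rewrite 1 [← hT0]
  rw [chordSq_inversion hR hc0 hy, wt, wt, one_add_norm_inversion_sq hR hy]
  have h3 : R ^ 2 ≠ 0 := pow_ne_zero 2 hR0
  field_simp

lemma integrable_log_one_add_sq_mul_wt : Integrable (fun y => log (1 + ‖y‖ ^ 2) * wt y) := by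
  refine integrable_sq_mul_wt.mono' (by fun_prop : Measurable _).aestronglyMeasurable
    (Eventually.of_forall fun y => ?_)
  have h0 : 0 ≤ ‖y‖ ^ 2 := by positivity
  have h1 := log_le_sub_one_of_pos (by positivity : 0 < 1 + ‖y‖ ^ 2)
  rw [norm_mul, norm_of_nonneg (wt_pos y).le, norm_of_nonneg (log_nonneg (by linarith))]
  exact mul_le_mul_of_nonneg_right (by linarith) (wt_pos y).le

lemma integral_log_chordSq_eq (x : E3) :
    ∫ y, log (chordSq x y) * wt y = 2 * (∫ y, log ‖x - y‖ * wt y) -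
      log (1 + ‖x‖ ^ 2) * (π ^ 2 / 4) - ∫ y, log (1 + ‖y‖ ^ 2) * wt y := by
  have hae : ∀ᵐ y : E3, y ≠ x := by simp [ae_iff]
  have h1 := (integrable_log_mul_wt x).const_mul 2
  have h2 := integrable_wt.const_mul (log (1 + ‖x‖ ^ 2))
  rw [← integral_wt, ← integral_const_mul, ← integral_const_mul, ← integral_sub h1 h2,
    ← integral_sub (by exact h1.sub h2) integrable_log_one_add_sq_mul_wt]
  refine integral_congr_ae (hae.mono fun y hy => ?_)
  have h1 : ‖x - y‖ ≠ 0 := norm_ne_zero_iff.2 (sub_ne_zero.2 hy.symm)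
  simp only
  rw [chordSq, log_div (by positivity) (by positivity), log_mul (by positivity) (by positivity),
    log_pow]
  push_cast
  ring

lemma wtBounded_const_mul_wt (a : ℝ) : WtBounded (fun y => a * wt y) where
  meas := by fun_prop
  bound := ⟨|a|, fun y => by rw [abs_mul, abs_of_pos (wt_pos y)]⟩

lemma logPot_bubble (x : E3) : logPot (fun y => 8 * wt y) x = -(π ^ 2 * log (1 + ‖x‖ ^ 2)) := by
  have h1 := integral_log_chordSq_eq x
  have h2 := integral_log_chordSq_eq 0
  rw [integral_log_chordSq x, h2] at h1
  simp only [zero_sub, norm_neg, norm_zero] at h1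
  have h0 := integrable_log_mul_wt 0
  simp only [zero_sub, norm_neg] at h0
  have h3 : logPot (fun y => 8 * wt y) x =
      8 * ((∫ y, log ‖y‖ * wt y) - ∫ y, log ‖x - y‖ * wt y) := by
    rw [logPot, ← integral_sub h0 (integrable_log_mul_wt x), ← integral_const_mul]
    exact integral_congr_ae (Eventually.of_forall fun y => by ring)
  rw [h3]
  norm_num at h1
  linarith

/-! ### Monotone iteration -/

/-- Chebyshev's correlation inequality. -/
lemma chebyshev_integral {p q D : E3 → ℝ} (hp : Integrable p) (hq : Integrable q)
    (hDp : Integrable fun y => D y * p y) (hDq : Integrable fun y => D y * q y)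
    (h : ∀ y z, y ≠ 0 → z ≠ 0 → (D y - D z) * (p y * q z - q y * p z) ≤ 0) :
    (∫ y, D y * p y) * (∫ y, q y) ≤ (∫ y, D y * q y) * ∫ y, p y := by
  have hae : ∀ᵐ y : E3, y ≠ 0 := by simp [ae_iff]
  set a := ∫ y, D y * p y
  set b := ∫ y, D y * q y
  set P := ∫ y, p y
  set Q := ∫ y, q y
  have h1 : ∀ z, z ≠ 0 → a * q z - b * p z - (P * (D z * q z) - Q * (D z * p z)) ≤ 0 := by
    intro z hz
    have h2 : ∫ y, (((D y * p y) * q z - (D y * q y) * p z) -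
        (p y * (D z * q z) - q y * (D z * p z))) ≤ 0 :=
      integral_nonpos_of_ae (hae.mono fun y hy => by
        have := h y z hy hz
        simp only [Pi.zero_apply]
        linarith)
    rwa [integral_sub (by exact (hDp.mul_const _).sub (hDq.mul_const _))
      (by exact (hp.mul_const _).sub (hq.mul_const _)),
      integral_sub (by exact hDp.mul_const _) (by exact hDq.mul_const _),
      integral_sub (by exact hp.mul_const _) (by exact hq.mul_const _),
      integral_mul_const, integral_mul_const, integral_mul_const, integral_mul_const] at h2
  have h2 : ∫ z, (a * q z - b * p z - (P * (D z * q z) - Q * (D z * p z))) ≤ 0 :=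
    integral_nonpos_of_ae (hae.mono h1)
  rw [integral_sub (by exact (hq.const_mul _).sub (hp.const_mul _))
      (by exact (hDq.const_mul _).sub (hDp.const_mul _)),
    integral_sub (by exact hq.const_mul _) (by exact hp.const_mul _),
    integral_sub (by exact hDq.const_mul _) (by exact hDp.const_mul _),
    integral_const_mul, integral_const_mul, integral_const_mul, integral_const_mul] at h2
  linarith

/-- The density `e^{3 v - 3 l |y|²}`. -/
noncomputable def gaussDensity (l : ℝ) (v : E3 → ℝ) (y : E3) : ℝ := exp (3 * v y - 3 * l * ‖y‖ ^ 2)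

lemma exp_neg_le_mul_wt {l : ℝ} (hl : 0 < l) (y : E3) :
    exp (-(3 * l * ‖y‖ ^ 2)) ≤ exp (3 * l) / l ^ 3 * wt y := by
  have h1 : l * (1 + ‖y‖ ^ 2) ≤ exp (l * (1 + ‖y‖ ^ 2)) := by
    have := add_one_le_exp (l * (1 + ‖y‖ ^ 2)); linarith
  have h2 := pow_le_pow_left₀ (by positivity) h1 3
  rw [← exp_nat_mul, mul_pow] at h2
  rw [wt, ← div_eq_mul_inv, div_div, le_div_iff₀ (by positivity), exp_neg,
    inv_mul_le_iff₀ (exp_pos _), ← exp_add]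
  refine h2.trans (exp_le_exp.2 (le_of_eq ?_))
  push_cast
  ring

lemma gaussDensity_le {l : ℝ} {v : E3 → ℝ} (hv : ∀ y, v y ≤ 0) (y : E3) :
    gaussDensity l v y ≤ exp (-(3 * l * ‖y‖ ^ 2)) :=
  exp_le_exp.2 (by linarith [hv y])

lemma wtBounded_gaussDensity {l : ℝ} (hl : 0 < l) {v : E3 → ℝ} (hm : Measurable v)
    (hv : ∀ y, v y ≤ 0) : WtBounded (gaussDensity l v) where
  meas := by unfold gaussDensity; fun_prop
  bound := ⟨exp (3 * l) / l ^ 3, fun y => by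
    rw [gaussDensity, abs_of_pos (exp_pos _)]
    exact (gaussDensity_le hv y).trans (exp_neg_le_mul_wt hl y)⟩

/-- One step of the iteration. -/
noncomputable def logStep (V l : ℝ) (v : E3 → ℝ) (x : E3) : ℝ :=
  V / (π ^ 2 * ∫ y, gaussDensity l v y) * logPot (gaussDensity l v) x

/-- The class of functions preserved by the iteration. -/
structure Admissible (v : E3 → ℝ) : Prop where
  meas : Measurable v
  radial : IsRadial v
  zero : v 0 = 0
  nonpos : ∀ x, v x ≤ 0

/-- `v` decreases less than `w` along rays. -/
def Flatter (v w : E3 → ℝ) : Prop := ∀ x x', ‖x‖ ≤ ‖x'‖ → v x - v x' ≤ w x - w x'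

lemma Flatter.le {v w : E3 → ℝ} (h : Flatter v w) (hv : v 0 = 0) (hw : w 0 = 0) (x : E3) :
    w x ≤ v x := by
  have := h 0 x (by simp)
  linarith

section

variable {V l : ℝ} {v w : E3 → ℝ}

lemma Admissible.wtBounded (hv : Admissible v) (hl : 0 < l) : WtBounded (gaussDensity l v) :=
  wtBounded_gaussDensity hl hv.meas hv.nonpos

lemma Admissible.isRadial_gaussDensity (hv : Admissible v) : IsRadial (gaussDensity l v) :=
  fun x y h => by rw [gaussDensity, gaussDensity, hv.radial x y h, h]

lemma integral_gaussDensity_pos (hl : 0 < l) (hm : Measurable v) (hv : ∀ y, v y ≤ 0) :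
    0 < ∫ y, gaussDensity l v y :=
  integral_exp_pos (wtBounded_gaussDensity hl hm hv).integrable

lemma measurable_logPot {f : E3 → ℝ} (hf : Measurable f) : Measurable (logPot f) := by
  have : StronglyMeasurable fun p : E3 × E3 => (log ‖p.2‖ - log ‖p.1 - p.2‖) * f p.2 :=
    Measurable.stronglyMeasurable (by fun_prop)
  exact this.integral_prod_right.measurable

lemma logStep_sub (hv : Admissible v) (hl : 0 < l) (x x' : E3) :
    logStep V l v x - logStep V l v x' = V / (π ^ 2 * ∫ y, gaussDensity l v y) *
      ∫ y, (logSphere ‖x'‖ ‖y‖ - logSphere ‖x‖ ‖y‖) * gaussDensity l v y := by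
  rw [← (logPot_sub_logPot_radial (hv.wtBounded hl) hv.isRadial_gaussDensity x x').2, logStep, logStep]
  ring

lemma Admissible.logStep (hV : 0 < V) (hl : 0 < l) (hv : Admissible v) :
    Admissible (logStep V l v) where
  meas := (measurable_logPot (hv.wtBounded hl).meas).const_mul _
  radial := fun x y h => by
    rw [_root_.logStep, _root_.logStep, hv.isRadial_gaussDensity.logPot x y h]
  zero := by rw [_root_.logStep, logPot_zero, mul_zero]
  nonpos := fun x => by
    have h := logStep_sub (V := V) hv hl 0 x
    rw [_root_.logStep, logPot_zero, mul_zero, zero_sub] at h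
    have h1 := integral_gaussDensity_pos hl hv.meas hv.nonpos
    have h2 : 0 ≤ ∫ y, (logSphere ‖x‖ ‖y‖ - logSphere ‖(0 : E3)‖ ‖y‖) * gaussDensity l v y :=
      integral_nonneg fun y => mul_nonneg
        (sub_nonneg.2 (logSphere_mono (norm_nonneg _) (by simp))) (exp_pos _).le
    have h3 : 0 ≤ -_root_.logStep V l v x := h ▸ by positivity
    linarith

lemma Flatter.logStep (hV : 0 < V) (hl : 0 < l) (hv : Admissible v) (hw : Admissible w)
    (h : Flatter v w) : Flatter (logStep V l v) (logStep V l w) := by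
  intro x x' hx
  have hNv := integral_gaussDensity_pos hl hv.meas hv.nonpos
  have hNw := integral_gaussDensity_pos hl hw.meas hw.nonpos
  rw [logStep_sub hv hl, logStep_sub hw hl]
  have key := chebyshev_integral (hv.wtBounded hl).integrable (hw.wtBounded hl).integrable
    (logPot_sub_logPot_radial (hv.wtBounded hl) hv.isRadial_gaussDensity x x').1
    (logPot_sub_logPot_radial (hw.wtBounded hl) hw.isRadial_gaussDensity x x').1 (by
      intro y z hy hz
      wlog hyz : ‖y‖ ≤ ‖z‖ generalizing y z
      · have := this z y hz hy (le_of_not_ge hyz)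
        linarith
      have hD := logSphere_sub_antitone (norm_nonneg x) hx (norm_pos_iff.2 hy) hyz
      refine mul_nonpos_of_nonneg_of_nonpos (by linarith) (sub_nonpos.2 ?_)
      have := h y z hyz
      rw [gaussDensity, gaussDensity, gaussDensity, gaussDensity, ← exp_add, ← exp_add]
      exact exp_le_exp.2 (by linarith))
  rw [div_mul_eq_mul_div, div_mul_eq_mul_div, div_le_div_iff₀ (by positivity) (by positivity)]
  have h0 : 0 < V * π ^ 2 := by positivity
  nlinarith [mul_le_mul_of_nonneg_left key h0.le]

end

/-- The starting point of the iteration. -/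
noncomputable def bubble (x : E3) : ℝ := -log (1 + ‖x‖ ^ 2)

lemma admissible_bubble : Admissible bubble where
  meas := by unfold bubble; fun_prop
  radial := fun x y h => by rw [bubble, bubble, h]
  zero := by simp [bubble]
  nonpos := fun x => neg_nonpos.2 (log_nonneg (by nlinarith [sq_nonneg ‖x‖]))

lemma gaussDensity_bubble (l : ℝ) (y : E3) :
    gaussDensity l bubble y = wt y * exp (-(3 * l * ‖y‖ ^ 2)) := by
  have h : exp (log (1 + ‖y‖ ^ 2)) = 1 + ‖y‖ ^ 2 := exp_log (by positivity)
  rw [gaussDensity, bubble, sub_eq_add_neg, exp_add, wt, ← h, ← exp_nat_mul, ← exp_neg]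
  congr 2
  rw [log_exp]
  push_cast
  ring

lemma flatter_logStep_bubble {V l : ℝ} (hl : 0 < l)
    (hVl : V ≤ 8 * ∫ y, gaussDensity l bubble y) : Flatter (logStep V l bubble) bubble := by
  intro x x' hx
  have hN := integral_gaussDensity_pos hl admissible_bubble.meas admissible_bubble.nonpos
  rw [logStep_sub admissible_bubble hl]
  have h1 := logPot_sub_logPot_radial (wtBounded_const_mul_wt 8)
    (fun x y h => by simp only [wt, h]) x x'
  have h2 := logPot_sub_logPot_radial (admissible_bubble.wtBounded hl)
    admissible_bubble.isRadial_gaussDensity x x'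
  set J := ∫ y, (logSphere ‖x'‖ ‖y‖ - logSphere ‖x‖ ‖y‖) * gaussDensity l bubble y with hJ
  have hD : ∀ y : E3, 0 ≤ logSphere ‖x'‖ ‖y‖ - logSphere ‖x‖ ‖y‖ := fun y =>
    sub_nonneg.2 (logSphere_mono (norm_nonneg _) hx)
  have hJ0 : 0 ≤ J := integral_nonneg fun y => mul_nonneg (hD y) (exp_pos _).le
  have h3 : 8 * J ≤ π ^ 2 * (bubble x - bubble x') := by
    have e : π ^ 2 * (bubble x - bubble x') =
        logPot (fun y => 8 * wt y) x - logPot (fun y => 8 * wt y) x' := by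
      rw [logPot_bubble, logPot_bubble, bubble, bubble]
      ring
    rw [e, h1.2, hJ, ← integral_const_mul]
    refine integral_mono (h2.1.const_mul 8) h1.1 fun y => ?_
    have hE : gaussDensity l bubble y ≤ wt y := by
      rw [gaussDensity_bubble]
      exact mul_le_of_le_one_right (wt_pos y).le (exp_le_one_iff.2 (by
        have : 0 ≤ 3 * l * ‖y‖ ^ 2 := by positivity
        linarith))
    have := mul_le_mul_of_nonneg_left hE (hD y)
    simp only
    linarith
  rw [div_mul_eq_mul_div, div_le_iff₀ (by positivity)]
  have h4 : V * J ≤ (8 * ∫ y, gaussDensity l bubble y) * J := mul_le_mul_of_nonneg_right hVl hJ0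
  nlinarith [mul_le_mul_of_nonneg_left h3 hN.le]

lemma exists_gauss_parameter {V : ℝ} (hV : V < 2 * π ^ 2) :
    ∃ l : ℝ, 0 < l ∧ V ≤ 8 * ∫ y, gaussDensity l bubble y := by
  have h : Tendsto (fun n : ℕ => ∫ y, gaussDensity (1 / ((n : ℝ) + 1)) bubble y) atTop
      (nhds (∫ y, wt y)) := by
    refine tendsto_integral_of_dominated_convergence wt (fun n => ?_) integrable_wt (fun n => ?_) ?_
    · exact (admissible_bubble.wtBounded (by positivity)).meas.aestronglyMeasurable
    · refine Eventually.of_forall fun y => ?_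
      rw [gaussDensity_bubble, norm_mul, norm_of_nonneg (wt_pos y).le, norm_of_nonneg (exp_pos _).le]
      exact mul_le_of_le_one_right (wt_pos y).le (exp_le_one_iff.2 (by
        have : 0 ≤ 3 * (1 / ((n : ℝ) + 1)) * ‖y‖ ^ 2 := by positivity
        linarith))
    · refine Eventually.of_forall fun y => ?_
      simp only [gaussDensity_bubble]
      have h0 := ((tendsto_one_div_add_atTop_nhds_zero_nat (𝕜 := ℝ)).const_mul 3).mul_const (‖y‖ ^ 2)
      have := ((continuous_exp.tendsto _).comp h0.neg).const_mul (wt y)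
      simpa using this
  have h1 := h.const_mul 8
  rw [integral_wt] at h1
  have h2 := h1.eventually_const_lt (show V < 8 * (π ^ 2 / 4) by linarith)
  obtain ⟨n, hn⟩ := h2.exists
  exact ⟨_, by positivity, hn.le⟩

lemma exists_fixedPoint_logStep {V l : ℝ} (hV : 0 < V) (hl : 0 < l)
    (hVl : V ≤ 8 * ∫ y, gaussDensity l bubble y) :
    ∃ v : E3 → ℝ, Measurable v ∧ (∀ x, v x ≤ 0) ∧ ∀ x, v x = logStep V l v x := by
  set v : ℕ → E3 → ℝ := fun n => (logStep V l)^[n] bubble with hvdef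
  have hsucc : ∀ n, v (n + 1) = logStep V l (v n) := fun n => Function.iterate_succ_apply' _ _ _
  have hadm : ∀ n, Admissible (v n) := by
    intro n
    induction n with
    | zero => exact admissible_bubble
    | succ n ih => rw [hsucc]; exact ih.logStep hV hl
  have hflat : ∀ n, Flatter (v (n + 1)) (v n) := by
    intro n
    induction n with
    | zero => exact flatter_logStep_bubble hl hVl
    | succ n ih =>
      rw [hsucc (n + 1)]
      nth_rewrite 2 [hsucc n]
      exact ih.logStep hV hl (hadm _) (hadm _)
  have hmono : ∀ x, Monotone fun n => v n x := fun x =>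
    monotone_nat_of_le_succ fun n => (hflat n).le (hadm _).zero (hadm _).zero x
  have hlim : ∀ x, Tendsto (fun n => v n x) atTop (nhds (⨆ n, v n x)) := fun x =>
    tendsto_atTop_ciSup (hmono x) ⟨0, by rintro _ ⟨n, rfl⟩; exact (hadm n).nonpos x⟩
  set vlim : E3 → ℝ := fun x => ⨆ n, v n x
  have hm : Measurable vlim := measurable_of_tendsto_metrizable (fun n => (hadm n).meas)
    (tendsto_pi_nhds.2 hlim)
  have hle : ∀ x, vlim x ≤ 0 := fun x => le_of_tendsto' (hlim x) fun n => (hadm n).nonpos x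
  refine ⟨vlim, hm, hle, fun x => ?_⟩
  have hE : ∀ y, Tendsto (fun n => gaussDensity l (v n) y) atTop (nhds (gaussDensity l vlim y)) :=
    fun y => (continuous_exp.tendsto _).comp (((hlim y).const_mul 3).sub_const _)
  have hbd : ∀ n y, |gaussDensity l (v n) y| ≤ exp (3 * l) / l ^ 3 * wt y := fun n y => by
    rw [gaussDensity, abs_of_pos (exp_pos _)]
    exact (gaussDensity_le (hadm n).nonpos y).trans (exp_neg_le_mul_wt hl y)
  have hN : Tendsto (fun n => ∫ y, gaussDensity l (v n) y) atTop
      (nhds (∫ y, gaussDensity l vlim y)) :=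
    tendsto_integral_of_dominated_convergence (fun y => exp (3 * l) / l ^ 3 * wt y)
      (fun n => ((hadm n).wtBounded hl).meas.aestronglyMeasurable) (integrable_wt.const_mul _)
      (fun n => Eventually.of_forall (hbd n)) (Eventually.of_forall hE)
  have hP : Tendsto (fun n => logPot (gaussDensity l (v n)) x) atTop
      (nhds (logPot (gaussDensity l vlim) x)) := by
    refine tendsto_integral_of_dominated_convergence
      (fun y => ‖(log ‖y‖ - log ‖x - y‖) * (exp (3 * l) / l ^ 3 * wt y)‖)
      (fun n => (((hadm n).wtBounded hl).integrable_logPot x).aestronglyMeasurable)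
      ((wtBounded_const_mul_wt _).integrable_logPot x).norm
      (fun n => Eventually.of_forall fun y => ?_) (Eventually.of_forall fun y => (hE y).const_mul _)
    rw [norm_mul, norm_mul]
    refine mul_le_mul_of_nonneg_left ((hbd n y).trans (le_abs_self _)) (norm_nonneg _)
  have hNpos := integral_gaussDensity_pos hl hm hle
  have hstep : Tendsto (fun n => v (n + 1) x) atTop (nhds (logStep V l vlim x)) := by
    simp only [hsucc]
    exact ((tendsto_const_nhds).div (hN.const_mul _) (by positivity)).mul hP
  exact tendsto_nhds_unique ((tendsto_add_atTop_iff_nat 1).2 (hlim x)) hstep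

/-- Existence of a solution of the integral equation. -/
theorem exists_solution_logPot {V : ℝ} (hV0 : 0 < V) (hV1 : V < 2 * π ^ 2) :
    ∃ (l c C : ℝ) (u : E3 → ℝ), 0 < l ∧ Measurable u ∧
      (∀ x, exp (3 * u x) ≤ C * exp (-(3 * l * ‖x‖ ^ 2))) ∧ ∫ x, exp (3 * u x) = V ∧
      ∀ x, u x = 1 / π ^ 2 * logPot (fun y => exp (3 * u y)) x - l * ‖x‖ ^ 2 + c := by
  obtain ⟨l, hl, hVl⟩ := exists_gauss_parameter hV1
  obtain ⟨v, hm, hle, hv⟩ := exists_fixedPoint_logStep hV0 hl hVl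
  have hN := integral_gaussDensity_pos hl hm hle
  set N := ∫ y, gaussDensity l v y with hNdef
  have hexp : ∀ x, exp (3 * (v x - l * ‖x‖ ^ 2 + log (V / N) / 3)) = V / N * gaussDensity l v x := by
    intro x
    rw [gaussDensity, ← exp_log (div_pos hV0 hN), ← exp_add, log_exp]
    congr 1
    ring
  refine ⟨l, log (V / N) / 3, V / N, fun x => v x - l * ‖x‖ ^ 2 + log (V / N) / 3, hl, by fun_prop,
    fun x => ?_, ?_, fun x => ?_⟩
  · rw [hexp]
    exact mul_le_mul_of_nonneg_left (gaussDensity_le hle x) (by positivity)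
  · simp only [hexp]
    rw [integral_const_mul, ← hNdef]
    field_simp
  · simp only [hexp]
    have : logPot (fun y => V / N * gaussDensity l v y) x = V / N * logPot (gaussDensity l v) x := by
      rw [logPot, logPot, ← integral_const_mul]
      exact integral_congr_ae (Eventually.of_forall fun y => by ring)
    rw [this]
    nth_rewrite 1 [hv x]
    rw [logStep, ← hNdef]
    field_simp

/-! ### The gradient of the logarithmic potential -/

/-- The gradient of `z ↦ log (|z|² + ε²) / 2`. -/
noncomputable def gradKernel (ε : ℝ) (z : E3) : E3 →L[ℝ] ℝ :=
  (‖z‖ ^ 2 + ε ^ 2)⁻¹ • innerSL ℝ z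

lemma measurable_gradKernel (ε : ℝ) : Measurable (gradKernel ε) := by
  unfold gradKernel
  exact Measurable.smul (by fun_prop : Measurable fun z : E3 => (‖z‖ ^ 2 + ε ^ 2)⁻¹)
    (innerSL ℝ (E := E3)).continuous.measurable

lemma norm_gradKernel (ε : ℝ) (z : E3) : ‖gradKernel ε z‖ = (‖z‖ ^ 2 + ε ^ 2)⁻¹ * ‖z‖ := by
  rw [gradKernel, norm_smul, innerSL_apply_norm, Real.norm_of_nonneg (by positivity)]

lemma norm_gradKernel_le {ε : ℝ} (hε : 0 < ε) (z : E3) : ‖gradKernel ε z‖ ≤ (2 * ε)⁻¹ := by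
  rw [norm_gradKernel, inv_mul_le_iff₀ (by positivity), mul_inv, ← sub_nonneg]
  have : (‖z‖ ^ 2 + ε ^ 2) * (2⁻¹ * ε⁻¹) - ‖z‖ = (‖z‖ - ε) ^ 2 * (2⁻¹ * ε⁻¹) := by
    field_simp; ring
  rw [this]; positivity

lemma norm_gradKernel_le_inv (ε : ℝ) (z : E3) : ‖gradKernel ε z‖ ≤ ‖z‖⁻¹ := by
  rw [norm_gradKernel]
  rcases (norm_nonneg z).eq_or_lt with h | h
  · simp [← h]
  · rw [inv_mul_le_iff₀ (by positivity)]
    have : (‖z‖ ^ 2 + ε ^ 2) * ‖z‖⁻¹ = ‖z‖ + ε ^ 2 * ‖z‖⁻¹ := by field_simp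
    rw [this]
    have : 0 ≤ ε ^ 2 * ‖z‖⁻¹ := by positivity
    linarith

lemma norm_gradKernel_sub_le {ε : ℝ} (hε : 0 < ε) (z : E3) :
    ‖gradKernel 0 z - gradKernel ε z‖ ≤ ε * (‖z‖ ^ 2)⁻¹ := by
  have h0 : gradKernel 0 z - gradKernel ε z =
      ((‖z‖ ^ 2 + 0 ^ 2)⁻¹ - (‖z‖ ^ 2 + ε ^ 2)⁻¹) • innerSL ℝ z := (sub_smul _ _ _).symm
  rw [h0, norm_smul, innerSL_apply_norm]
  rcases (norm_nonneg z).eq_or_lt with h | h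
  · rw [← h]; simp
  · have h1 : (‖z‖ ^ 2 + 0 ^ 2)⁻¹ - (‖z‖ ^ 2 + ε ^ 2)⁻¹ =
        ε ^ 2 * ((‖z‖ ^ 2)⁻¹ * (‖z‖ ^ 2 + ε ^ 2)⁻¹) := by
      field_simp; ring
    rw [h1, Real.norm_of_nonneg (by positivity)]
    have h2 : ε * ‖z‖ ≤ ‖z‖ ^ 2 + ε ^ 2 := by nlinarith [sq_nonneg (‖z‖ - ε), sq_nonneg (‖z‖ + ε)]
    have h3 : ε * ‖z‖ * (‖z‖ ^ 2 + ε ^ 2)⁻¹ ≤ 1 := by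
      rw [← div_eq_mul_inv]; exact div_le_one_of_le₀ h2 (by positivity)
    calc _ = ε * (‖z‖ ^ 2)⁻¹ * (ε * ‖z‖ * (‖z‖ ^ 2 + ε ^ 2)⁻¹) := by ring
      _ ≤ ε * (‖z‖ ^ 2)⁻¹ * 1 := mul_le_mul_of_nonneg_left h3 (by positivity)
      _ = _ := mul_one _

lemma hasFDerivAt_log_norm_sq_add {ε : ℝ} (hε : 0 < ε) (y x : E3) :
    HasFDerivAt (fun x : E3 => log (‖x - y‖ ^ 2 + ε ^ 2) / 2) (gradKernel ε (x - y)) x := by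
  have h1 : HasFDerivAt (fun x : E3 => ‖x - y‖ ^ 2 + ε ^ 2) (2 • innerSL ℝ (x - y)) x := by
    have := ((hasFDerivAt_id x).sub_const y).norm_sq.add_const (ε ^ 2)
    simpa using this
  have h2 := (h1.log (by positivity)).mul_const (2⁻¹ : ℝ)
  simp only [← div_eq_mul_inv] at h2
  refine h2.congr_fderiv ?_
  ext v
  change (2:ℝ)⁻¹ * ((‖x - y‖ ^ 2 + ε ^ 2)⁻¹ * (2 • inner ℝ (x - y) v)) =
    (‖x - y‖ ^ 2 + ε ^ 2)⁻¹ * inner ℝ (x - y) v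
  rw [nsmul_eq_mul]
  push_cast
  ring

lemma WtBounded.integrable_rpow_mul {f : E3 → ℝ} (hf : WtBounded f) {a : ℝ} (ha0 : 0 ≤ a)
    (ha : a < 3) (x : E3) : Integrable (fun y => ‖x - y‖ ^ (-a) * f y) :=
  hf.integrable_mul (measurable_rieszKernel a x) (integrable_rieszKernel_mul_wt ha0 ha x)

lemma WtBounded.exists_integral_rpow_mul_le {f : E3 → ℝ} (hf : WtBounded f) {a : ℝ} (ha0 : 0 ≤ a)
    (ha : a < 3) : ∃ M, ∀ x : E3, ∫ y, ‖x - y‖ ^ (-a) * |f y| ≤ M := by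
  obtain ⟨C, hC⟩ := hf.bound
  obtain ⟨M, hM⟩ := exists_rieszPotential_wt_le ha0 ha
  have hC0 : 0 ≤ C := nonneg_of_mul_nonneg_left ((abs_nonneg _).trans (hC 0)) (wt_pos 0)
  refine ⟨C * M, fun x => ?_⟩
  calc _ ≤ ∫ y, C * (‖x - y‖ ^ (-a) * wt y) := by
        refine integral_mono_of_nonneg (Eventually.of_forall fun y => by positivity)
          ((integrable_rieszKernel_mul_wt ha0 ha x).const_mul C)
          (Eventually.of_forall fun y => ?_)
        have : 0 ≤ ‖x - y‖ ^ (-a) := by positivity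
        nlinarith [hC y, mul_le_mul_of_nonneg_left (hC y) this]
    _ ≤ C * M := by
        rw [integral_const_mul]
        exact mul_le_mul_of_nonneg_left (hM x) hC0

lemma WtBounded.integrable_gradKernel {f : E3 → ℝ} (hf : WtBounded f) (ε : ℝ) (x : E3) :
    Integrable (fun y => f y • gradKernel ε (x - y)) := by
  refine (hf.integrable_rpow_mul zero_le_one (by norm_num) x).norm.mono'
    (hf.meas.smul ((measurable_gradKernel ε).comp
      (measurable_const.sub measurable_id))).aestronglyMeasurable
    (Eventually.of_forall fun y => ?_)
  rw [norm_smul, norm_mul, rpow_neg_one, mul_comm, norm_inv, norm_norm]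
  exact mul_le_mul_of_nonneg_right (norm_gradKernel_le_inv ε _) (norm_nonneg _)

lemma abs_log_sub_half_log_le {ε r : ℝ} (hε : 0 < ε) (hr : 0 < r) :
    |log r - log (r ^ 2 + ε ^ 2) / 2| ≤ ε * r⁻¹ := by
  have h1 : log (r ^ 2 + ε ^ 2) = 2 * log r + log (1 + (ε * r⁻¹) ^ 2) := by
    rw [show r ^ 2 + ε ^ 2 = r ^ 2 * (1 + (ε * r⁻¹) ^ 2) by field_simp,
      log_mul (by positivity) (by positivity), log_pow]
    norm_num
  have h0 : 0 < ε * r⁻¹ := by positivity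
  have h2 : log (1 + (ε * r⁻¹) ^ 2) ≤ 2 * (ε * r⁻¹) := by
    have h3 : log (1 + (ε * r⁻¹) ^ 2) ≤ log ((1 + ε * r⁻¹) ^ 2) :=
      log_le_log (by positivity) (by nlinarith)
    rw [log_pow] at h3
    have h4 := log_le_sub_one_of_pos (show 0 < 1 + ε * r⁻¹ by positivity)
    push_cast at h3
    linarith
  have h5 : 0 ≤ log (1 + (ε * r⁻¹) ^ 2) := log_nonneg (by nlinarith)
  rw [h1, abs_le]
  constructor <;> linarith

lemma WtBounded.integrable_log_norm_sq_add {f : E3 → ℝ} (hf : WtBounded f) {ε : ℝ} (hε : 0 < ε)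
    (x : E3) : Integrable (fun y => (log ‖y‖ - log (‖x - y‖ ^ 2 + ε ^ 2) / 2) * f y) := by
  have h1 : Integrable (fun y => (log ‖x - y‖ - log (‖x - y‖ ^ 2 + ε ^ 2) / 2) * f y) := by
    refine ((hf.integrable_rpow_mul zero_le_one (by norm_num) x).norm.const_mul ε).mono'
      (Measurable.mul (by fun_prop) hf.meas).aestronglyMeasurable ?_
    filter_upwards [Measure.ae_ne volume x] with y hy
    have hr : 0 < ‖x - y‖ := norm_pos_iff.2 (sub_ne_zero.2 hy.symm)
    rw [norm_mul, norm_mul, rpow_neg_one, ← mul_assoc, norm_inv, norm_norm, Real.norm_eq_abs]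
    exact mul_le_mul_of_nonneg_right (abs_log_sub_half_log_le hε hr) (norm_nonneg _)
  refine ((hf.integrable_logPot x).add h1).congr (Eventually.of_forall fun y => ?_)
  simp only [Pi.add_apply]
  ring

lemma WtBounded.hasFDerivAt_regularized {f : E3 → ℝ} (hf : WtBounded f) {ε : ℝ} (hε : 0 < ε)
    (x : E3) :
    HasFDerivAt (fun x => ∫ y, (log ‖y‖ - log (‖x - y‖ ^ 2 + ε ^ 2) / 2) * f y)
      (-∫ y, f y • gradKernel ε (x - y)) x := by
  rw [← integral_neg]
  refine hasFDerivAt_integral_of_dominated_of_fderiv_le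
    (F := fun x y => (log ‖y‖ - log (‖x - y‖ ^ 2 + ε ^ 2) / 2) * f y)
    (F' := fun x y => -(f y • gradKernel ε (x - y))) (s := Set.univ)
    (bound := fun y => (2 * ε)⁻¹ * ‖f y‖)
    univ_mem (Eventually.of_forall fun x => (hf.integrable_log_norm_sq_add hε x).1)
    (hf.integrable_log_norm_sq_add hε x) (hf.integrable_gradKernel ε x).neg.1
    (Eventually.of_forall fun y x _ => ?_) (hf.integrable.norm.const_mul _)
    (Eventually.of_forall fun y x _ => ?_)
  · rw [norm_neg, norm_smul, mul_comm]
    exact mul_le_mul_of_nonneg_right (norm_gradKernel_le hε _) (norm_nonneg _)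
  · have h := ((hasFDerivAt_log_norm_sq_add hε y x).const_sub (log ‖y‖)).mul_const (f y)
    rwa [smul_neg] at h

lemma WtBounded.hasFDerivAt_logPot {f : E3 → ℝ} (hf : WtBounded f) (x : E3) :
    HasFDerivAt (logPot f) (-∫ y, f y • gradKernel 0 (x - y)) x := by
  obtain ⟨M, hM⟩ := hf.exists_integral_rpow_mul_le (a := 2) (by norm_num) (by norm_num)
  obtain ⟨M', hM'⟩ := hf.exists_integral_rpow_mul_le (a := 1) (by norm_num) (by norm_num)
  have hlim : ∀ K : ℝ, Tendsto (fun ε : ℝ => ε * K) (nhdsWithin 0 (Set.Ioi 0)) (nhds 0) := by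
    intro K
    have : Tendsto (fun ε : ℝ => ε * K) (nhds 0) (nhds (0 * K)) := by
      exact (continuous_id.mul continuous_const).tendsto 0
    rw [zero_mul] at this
    exact this.mono_left nhdsWithin_le_nhds
  refine hasFDerivAt_of_tendstoUniformly (l := nhdsWithin (0:ℝ) (Set.Ioi 0))
    (f := fun ε x => if 0 < ε then
      ∫ y, (log ‖y‖ - log (‖x - y‖ ^ 2 + ε ^ 2) / 2) * f y else 0)
    (f' := fun ε x => if 0 < ε then -∫ y, f y • gradKernel ε (x - y) else 0)
    (g' := fun x => -∫ y, f y • gradKernel 0 (x - y)) ?_ (fun ε x => ?_) (fun x => ?_) x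
  · rw [Metric.tendstoUniformly_iff]
    intro δ hδ
    filter_upwards [(hlim M).eventually (gt_mem_nhds hδ), self_mem_nhdsWithin] with ε h1 hε x
    have hε : 0 < ε := hε
    rw [if_pos hε, dist_neg_neg, dist_eq_norm,
      ← integral_sub (hf.integrable_gradKernel 0 x) (hf.integrable_gradKernel ε x)]
    refine lt_of_le_of_lt ((norm_integral_le_of_norm_le (g := fun y =>
      ε * (‖x - y‖ ^ (-2 : ℝ) * |f y|)) ?_ (Eventually.of_forall fun y => ?_)).trans ?_) h1
    · have := (hf.integrable_rpow_mul (a := 2) (by norm_num) (by norm_num) x).norm.const_mul ε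
      refine this.congr (Eventually.of_forall fun y => ?_)
      simp only [norm_mul, Real.norm_eq_abs]
      rw [abs_of_nonneg (by positivity : 0 ≤ ‖x - y‖ ^ (-2 : ℝ))]
    · have h : f y • gradKernel 0 (x - y) - f y • gradKernel ε (x - y) =
          f y • (gradKernel 0 (x - y) - gradKernel ε (x - y)) := (smul_sub _ _ _).symm
      rw [h, norm_smul, rpow_neg (norm_nonneg _), rpow_two, mul_comm ‖f y‖, ← mul_assoc,
        Real.norm_eq_abs]
      exact mul_le_mul_of_nonneg_right (norm_gradKernel_sub_le hε _) (abs_nonneg _)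
    · rw [integral_const_mul]
      exact mul_le_mul_of_nonneg_left (hM x) hε.le
  · by_cases hε : 0 < ε
    · simp only [if_pos hε]
      exact hf.hasFDerivAt_regularized hε x
    · simp only [if_neg hε]
      exact hasFDerivAt_const _ _
  · rw [tendsto_iff_norm_sub_tendsto_zero]
    refine squeeze_zero' (Eventually.of_forall fun _ => norm_nonneg _) ?_ (hlim M')
    filter_upwards [self_mem_nhdsWithin] with ε hε
    have hε : 0 < ε := hε
    rw [if_pos hε, logPot, ← integral_sub (hf.integrable_log_norm_sq_add hε x)
      (hf.integrable_logPot x)]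
    refine (norm_integral_le_of_norm_le (g := fun y =>
      ε * (‖x - y‖ ^ (-1 : ℝ) * |f y|)) ?_ ?_).trans ?_
    · have := (hf.integrable_rpow_mul (a := 1) (by norm_num) (by norm_num) x).norm.const_mul ε
      refine this.congr (Eventually.of_forall fun y => ?_)
      simp only [norm_mul, Real.norm_eq_abs]
      rw [abs_of_nonneg (by positivity : 0 ≤ ‖x - y‖ ^ (-1 : ℝ))]
    · filter_upwards [Measure.ae_ne volume x] with y hy
      have hr : 0 < ‖x - y‖ := norm_pos_iff.2 (sub_ne_zero.2 hy.symm)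
      rw [← sub_mul, norm_mul, rpow_neg_one, ← mul_assoc, Real.norm_eq_abs, Real.norm_eq_abs,
        sub_sub_sub_cancel_left]
      exact mul_le_mul_of_nonneg_right (abs_log_sub_half_log_le hε hr) (abs_nonneg _)
    · rw [integral_const_mul]
      exact mul_le_mul_of_nonneg_left (hM' x) hε.le

/-! ### Derivative classes -/

/-- `f` has `n` continuous derivatives, and `f` and all its iterated directional derivatives of order
at most `n` satisfy `B`. -/
def DerivClass (B : (E3 → ℝ) → Prop) : ℕ → (E3 → ℝ) → Prop
  | 0, f => Continuous f ∧ B f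
  | n + 1, f => Differentiable ℝ f ∧ B f ∧ ∀ v, DerivClass B n (fun x => fderiv ℝ f x v)

/-- Faster than polynomial decay. -/
def RapidDecay (f : E3 → ℝ) : Prop := ∀ N : ℕ, ∃ C, ∀ x, |f x| * (1 + ‖x‖) ^ N ≤ C

/-- At most polynomial growth. -/
def PolyGrowth (f : E3 → ℝ) : Prop := ∃ (N : ℕ) (C : ℝ), ∀ x, |f x| ≤ C * (1 + ‖x‖) ^ N

namespace DerivClass

variable {B : (E3 → ℝ) → Prop} {n : ℕ} {f g : E3 → ℝ}

lemma prop (h : DerivClass B n f) : B f := by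
  cases n with
  | zero => exact h.2
  | succ n => exact h.2.1

lemma continuous (h : DerivClass B n f) : Continuous f := by
  cases n with
  | zero => exact h.1
  | succ n => exact h.1.continuous

lemma contDiff (h : DerivClass B n f) : ContDiff ℝ n f := by
  induction n generalizing f with
  | zero => exact contDiff_zero.2 h.1
  | succ n ih =>
    push_cast
    refine contDiff_succ_iff_fderiv_apply.2 ⟨h.1, fun h0 => ?_, fun v => ih (h.2.2 v)⟩
    exact absurd h0 (by simp)

lemma of_succ (h : DerivClass B (n + 1) f) : DerivClass B n f := by
  induction n generalizing f with
  | zero => exact ⟨h.continuous, h.prop⟩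
  | succ n ih => exact ⟨h.1, h.2.1, fun v => ih (h.2.2 v)⟩

lemma add (hB : ∀ f g, B f → B g → B (fun x => f x + g x)) (hf : DerivClass B n f)
    (hg : DerivClass B n g) : DerivClass B n (fun x => f x + g x) := by
  induction n generalizing f g with
  | zero => exact ⟨hf.1.add hg.1, hB _ _ hf.2 hg.2⟩
  | succ n ih =>
    refine ⟨hf.1.add hg.1, hB _ _ hf.2.1 hg.2.1, fun v => ?_⟩
    have : (fun x => fderiv ℝ (fun x => f x + g x) x v) =
        fun x => fderiv ℝ f x v + fderiv ℝ g x v := by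
      ext x
      rw [((hf.1 x).hasFDerivAt.fun_add (hg.1 x).hasFDerivAt).fderiv]
      rfl
    rw [this]
    exact ih (hf.2.2 v) (hg.2.2 v)

lemma const_mul (hB : ∀ (c : ℝ) f, B f → B (fun x => c * f x)) (c : ℝ) (hf : DerivClass B n f) :
    DerivClass B n (fun x => c * f x) := by
  induction n generalizing f with
  | zero => exact ⟨continuous_const.mul hf.1, hB _ _ hf.2⟩
  | succ n ih =>
    refine ⟨hf.1.const_mul c, hB _ _ hf.2.1, fun v => ?_⟩
    have : (fun x => fderiv ℝ (fun x => c * f x) x v) = fun x => c * fderiv ℝ f x v := by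
      ext x
      rw [((hf.1 x).hasFDerivAt.const_mul c).fderiv]
      rfl
    rw [this]
    exact ih (hf.2.2 v)

end DerivClass

lemma RapidDecay.add (f g : E3 → ℝ) (hf : RapidDecay f) (hg : RapidDecay g) :
    RapidDecay (fun x => f x + g x) := by
  intro N
  obtain ⟨C, hC⟩ := hf N
  obtain ⟨D, hD⟩ := hg N
  refine ⟨C + D, fun x => ?_⟩
  have h : (0:ℝ) ≤ (1 + ‖x‖) ^ N := by positivity
  nlinarith [hC x, hD x, mul_le_mul_of_nonneg_right (abs_add_le (f x) (g x)) h]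

lemma RapidDecay.mul_polyGrowth {f g : E3 → ℝ} (hf : RapidDecay f) (hg : PolyGrowth g) :
    RapidDecay (fun x => f x * g x) := by
  intro N
  obtain ⟨M, D, hD⟩ := hg
  obtain ⟨C, hC⟩ := hf (N + M)
  have hD0 : 0 ≤ D := by simpa using (abs_nonneg _).trans (hD 0)
  refine ⟨C * D, fun x => ?_⟩
  calc |f x * g x| * (1 + ‖x‖) ^ N = |f x| * (1 + ‖x‖) ^ N * |g x| := by rw [abs_mul]; ring
    _ ≤ |f x| * (1 + ‖x‖) ^ N * (D * (1 + ‖x‖) ^ M) :=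
        mul_le_mul_of_nonneg_left (hD x) (by positivity)
    _ = |f x| * (1 + ‖x‖) ^ (N + M) * D := by rw [pow_add]; ring
    _ ≤ C * D := mul_le_mul_of_nonneg_right (hC x) hD0

lemma PolyGrowth.add (f g : E3 → ℝ) (hf : PolyGrowth f) (hg : PolyGrowth g) :
    PolyGrowth (fun x => f x + g x) := by
  obtain ⟨M, C, hC⟩ := hf
  obtain ⟨N, D, hD⟩ := hg
  have hC0 : 0 ≤ C := by simpa using (abs_nonneg _).trans (hC 0)
  have hD0 : 0 ≤ D := by simpa using (abs_nonneg _).trans (hD 0)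
  refine ⟨M + N, C + D, fun x => (abs_add_le _ _).trans ?_⟩
  have h1 : (1:ℝ) ≤ 1 + ‖x‖ := by linarith [norm_nonneg x]
  rw [add_mul]
  exact add_le_add
    ((hC x).trans (mul_le_mul_of_nonneg_left (pow_le_pow_right₀ h1 (by omega)) hC0))
    ((hD x).trans (mul_le_mul_of_nonneg_left (pow_le_pow_right₀ h1 (by omega)) hD0))

lemma PolyGrowth.const_mul (c : ℝ) (f : E3 → ℝ) (hf : PolyGrowth f) :
    PolyGrowth (fun x => c * f x) := by
  obtain ⟨M, C, hC⟩ := hf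
  refine ⟨M, |c| * C, fun x => ?_⟩
  rw [abs_mul, mul_assoc]
  exact mul_le_mul_of_nonneg_left (hC x) (abs_nonneg c)

lemma DerivClass.mul {n : ℕ} {f g : E3 → ℝ} (hf : DerivClass RapidDecay n f)
    (hg : DerivClass PolyGrowth n g) : DerivClass RapidDecay n (fun x => f x * g x) := by
  induction n generalizing f g with
  | zero => exact ⟨hf.1.mul hg.1, hf.2.mul_polyGrowth hg.2⟩
  | succ n ih =>
    refine ⟨hf.1.mul hg.1, hf.2.1.mul_polyGrowth hg.2.1, fun v => ?_⟩
    have : (fun x => fderiv ℝ (fun x => f x * g x) x v) =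
        fun x => f x * fderiv ℝ g x v + fderiv ℝ f x v * g x := by
      ext x
      rw [((hf.1 x).hasFDerivAt.fun_mul (hg.1 x).hasFDerivAt).fderiv]
      change f x * fderiv ℝ g x v + g x * fderiv ℝ f x v = _
      ring
    rw [this]
    exact (ih hf.of_succ (hg.2.2 v)).add RapidDecay.add (ih (hf.2.2 v) hg.of_succ)

lemma DerivClass.const_polyGrowth (n : ℕ) (c : ℝ) : DerivClass PolyGrowth n (fun _ => c) := by
  have hc : ∀ c : ℝ, PolyGrowth (fun _ => c) := fun c => ⟨0, |c|, fun x => by simp⟩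
  induction n generalizing c with
  | zero => exact ⟨continuous_const, hc c⟩
  | succ n ih =>
    refine ⟨differentiable_const c, hc c, fun v => ?_⟩
    simpa using ih 0

lemma DerivClass.inner_polyGrowth (n : ℕ) (v : E3) :
    DerivClass PolyGrowth n (fun x => inner ℝ v x) := by
  have h0 : PolyGrowth (fun x : E3 => inner ℝ v x) := by
    refine ⟨1, ‖v‖, fun x => (abs_real_inner_le_norm v x).trans ?_⟩
    rw [pow_one]
    exact mul_le_mul_of_nonneg_left (by linarith) (norm_nonneg v)
  cases n with
  | zero => exact ⟨by fun_prop, h0⟩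
  | succ n =>
    refine ⟨(innerSL ℝ v).differentiable, h0, fun w => ?_⟩
    have : (fun x => fderiv ℝ (fun x => inner ℝ v x) x w) = fun _ : E3 => inner ℝ v w := by
      ext x
      have h : HasFDerivAt (fun x => inner ℝ v x) (innerSL ℝ v) x := (innerSL ℝ v).hasFDerivAt
      rw [h.fderiv]
      rfl
    rw [this]
    exact DerivClass.const_polyGrowth n _

lemma RapidDecay.exists_le_wt {f : E3 → ℝ} (hf : RapidDecay f) : ∃ C, ∀ x, |f x| ≤ C * wt x := by
  obtain ⟨C, hC⟩ := hf 6
  refine ⟨C, fun x => ?_⟩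
  rw [wt, ← div_eq_mul_inv, le_div_iff₀ (by positivity)]
  refine le_trans (mul_le_mul_of_nonneg_left ?_ (abs_nonneg _)) (hC x)
  rw [show 6 = 2 * 3 from rfl, pow_mul]
  exact pow_le_pow_left₀ (by positivity) (by nlinarith [norm_nonneg x]) 3

lemma RapidDecay.wtBounded {f : E3 → ℝ} (hf : RapidDecay f) (hm : Continuous f) : WtBounded f :=
  ⟨hm.measurable, hf.exists_le_wt⟩

lemma norm_le_sum_abs_single (L : E3 →L[ℝ] ℝ) :
    ‖L‖ ≤ ∑ i, |L (EuclideanSpace.single i 1)| := by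
  refine L.opNorm_le_bound (Finset.sum_nonneg fun i _ => abs_nonneg _) fun v => ?_
  have hv : v = ∑ i, v i • EuclideanSpace.single i (1:ℝ) := by
    simpa using ((EuclideanSpace.basisFun (Fin 3) ℝ).sum_repr v).symm
  conv_lhs => rw [hv, map_sum]
  rw [Finset.sum_mul]
  refine (norm_sum_le _ _).trans (Finset.sum_le_sum fun i _ => ?_)
  rw [map_smul, smul_eq_mul, norm_mul, mul_comm]
  exact mul_le_mul_of_nonneg_left (PiLp.norm_apply_le v i) (abs_nonneg _)

lemma DerivClass.exists_norm_fderiv_le {n : ℕ} {f : E3 → ℝ} (hf : DerivClass RapidDecay (n + 1) f) :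
    ∃ C, ∀ x, ‖fderiv ℝ f x‖ ≤ C * wt x := by
  choose C hC using fun i : Fin 3 => (hf.2.2 (EuclideanSpace.single i 1)).prop.exists_le_wt
  refine ⟨∑ i, C i, fun x => (norm_le_sum_abs_single _).trans ?_⟩
  rw [Finset.sum_mul]
  exact Finset.sum_le_sum fun i _ => hC i x

lemma DerivClass.continuous_fderiv {n : ℕ} {f : E3 → ℝ} (hf : DerivClass RapidDecay (n + 1) f) :
    Continuous (fderiv ℝ f) :=
  hf.contDiff.continuous_fderiv (by simp)

lemma wt_sub_le (x z : E3) : wt (x - z) ≤ (2 * (1 + ‖x‖ ^ 2)) ^ 3 * wt z := by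
  unfold wt
  rw [inv_le_iff_one_le_mul₀ (by positivity), mul_right_comm, ← mul_pow, ← div_eq_mul_inv,
    one_le_div (by positivity)]
  refine pow_le_pow_left₀ (by positivity) ?_ 3
  have h1 : ‖z‖ ≤ ‖x‖ + ‖x - z‖ := by
    calc ‖z‖ = ‖x - (x - z)‖ := by simp
      _ ≤ _ := norm_sub_le _ _
  nlinarith [norm_nonneg z, norm_nonneg x, norm_nonneg (x - z), sq_nonneg (‖x‖ - ‖x - z‖),
    mul_nonneg (sq_nonneg ‖x‖) (sq_nonneg ‖x - z‖)]

/-! ### Smoothness of gradients of logarithmic potentials -/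

/-- The directional derivative of `z ↦ log |z|` convolved with `f`. -/
noncomputable def gradConv (v : E3) (f : E3 → ℝ) (x : E3) : ℝ := ∫ z, gradKernel 0 z v * f (x - z)

lemma measurable_gradKernel_apply (ε : ℝ) (v : E3) : Measurable (fun z => gradKernel ε z v) :=
  (ContinuousLinearMap.apply ℝ ℝ v).continuous.measurable.comp (measurable_gradKernel ε)

lemma abs_gradKernel_apply_le (ε : ℝ) (z v : E3) : |gradKernel ε z v| ≤ ‖v‖ * ‖z‖⁻¹ := by
  rw [mul_comm]
  exact ((gradKernel ε z).le_opNorm v).trans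
    (mul_le_mul_of_nonneg_right (norm_gradKernel_le_inv ε z) (norm_nonneg v))

lemma WtBounded.integral_gradKernel_apply {f : E3 → ℝ} (hf : WtBounded f) (x v : E3) :
    (∫ y, f y • gradKernel 0 (x - y)) v = gradConv v f x := by
  rw [ContinuousLinearMap.integral_apply (hf.integrable_gradKernel 0 x), gradConv,
    ← integral_sub_left_eq_self _ volume x]
  refine integral_congr_ae (Eventually.of_forall fun y => ?_)
  change f (x - y) * gradKernel 0 (x - (x - y)) v = _
  rw [sub_sub_cancel, mul_comm]

lemma integrable_inv_mul_wt : Integrable (fun z : E3 => ‖z‖⁻¹ * wt z) := by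
  simpa [rpow_neg_one] using integrable_rieszKernel_mul_wt zero_le_one (by norm_num) (0 : E3)

lemma norm_mul_comp_sub_le {F : Type*} [NormedAddCommGroup F] [NormedSpace ℝ F] {g : E3 → F} {C : ℝ}
    (hC : ∀ y, ‖g y‖ ≤ C * wt y) {x₀ x : E3} (hx : x ∈ Metric.ball x₀ 1) (ε : ℝ) (v z : E3) :
    ‖gradKernel ε z v • g (x - z)‖ ≤
      ‖v‖ * C * (2 * (1 + (‖x₀‖ + 1) ^ 2)) ^ 3 * (‖z‖⁻¹ * wt z) := by
  have hC0 : 0 ≤ C := nonneg_of_mul_nonneg_left ((norm_nonneg _).trans (hC 0)) (wt_pos 0)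
  have hxn : ‖x‖ ≤ ‖x₀‖ + 1 := by
    have := norm_le_norm_add_norm_sub x₀ x
    rw [Metric.mem_ball, dist_eq_norm, norm_sub_rev] at hx
    linarith
  have h1 : wt (x - z) ≤ (2 * (1 + (‖x₀‖ + 1) ^ 2)) ^ 3 * wt z := by
    refine (wt_sub_le x z).trans (mul_le_mul_of_nonneg_right ?_ (wt_pos z).le)
    gcongr
  calc ‖gradKernel ε z v • g (x - z)‖ ≤ (‖v‖ * ‖z‖⁻¹) * (C * wt (x - z)) := by
        rw [norm_smul]
        exact mul_le_mul (abs_gradKernel_apply_le ε z v) (hC _) (norm_nonneg _) (by positivity)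
    _ ≤ (‖v‖ * ‖z‖⁻¹) * (C * ((2 * (1 + (‖x₀‖ + 1) ^ 2)) ^ 3 * wt z)) := by gcongr
    _ = _ := by ring

lemma integrable_gradKernel_smul {F : Type*} [NormedAddCommGroup F] [NormedSpace ℝ F]
    {g : E3 → F} (hg : Continuous g) {C : ℝ} (hC : ∀ y, ‖g y‖ ≤ C * wt y) (ε : ℝ) (v x : E3) :
    Integrable (fun z => gradKernel ε z v • g (x - z)) :=
  (integrable_inv_mul_wt.const_mul _).mono'
    ((measurable_gradKernel_apply ε v).aestronglyMeasurable.smul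
      (hg.comp (continuous_const.sub continuous_id)).aestronglyMeasurable)
    (Eventually.of_forall fun z =>
      norm_mul_comp_sub_le hC (Metric.mem_ball_self one_pos) ε v z)

lemma continuous_gradConv {f : E3 → ℝ} (hf : Continuous f) (hd : RapidDecay f) (v : E3) :
    Continuous (gradConv v f) := by
  obtain ⟨C, hC⟩ := hd.exists_le_wt
  refine continuous_iff_continuousAt.2 fun x₀ => ?_
  refine continuousAt_of_dominated
    (bound := fun z => ‖v‖ * C * (2 * (1 + (‖x₀‖ + 1) ^ 2)) ^ 3 * (‖z‖⁻¹ * wt z))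
    (Eventually.of_forall fun x => (integrable_gradKernel_smul hf hC 0 v x).1) ?_
    (integrable_inv_mul_wt.const_mul _) (Eventually.of_forall fun z => by fun_prop)
  filter_upwards [Metric.ball_mem_nhds x₀ one_pos] with x hx
  exact Eventually.of_forall fun z => norm_mul_comp_sub_le hC hx 0 v z

lemma DerivClass.hasFDerivAt_gradConv {n : ℕ} {f : E3 → ℝ} (hf : DerivClass RapidDecay (n + 1) f)
    (v x₀ : E3) :
    HasFDerivAt (gradConv v f) (∫ z, gradKernel 0 z v • fderiv ℝ f (x₀ - z)) x₀ := by
  obtain ⟨C, hC⟩ := hf.prop.exists_le_wt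
  obtain ⟨D, hD⟩ := hf.exists_norm_fderiv_le
  refine hasFDerivAt_integral_of_dominated_of_fderiv_le
    (F := fun x z => gradKernel 0 z v * f (x - z))
    (F' := fun x z => gradKernel 0 z v • fderiv ℝ f (x - z))
    (bound := fun z => ‖v‖ * D * (2 * (1 + (‖x₀‖ + 1) ^ 2)) ^ 3 * (‖z‖⁻¹ * wt z))
    (Metric.ball_mem_nhds x₀ one_pos)
    (Eventually.of_forall fun x => (integrable_gradKernel_smul hf.continuous hC 0 v x).1)
    (integrable_gradKernel_smul hf.continuous hC 0 v x₀)
    (integrable_gradKernel_smul hf.continuous_fderiv hD 0 v x₀).1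
    (Eventually.of_forall fun z x hx => norm_mul_comp_sub_le hD hx 0 v z)
    (integrable_inv_mul_wt.const_mul _) (Eventually.of_forall fun z x _ => ?_)
  have h := (hf.1 (x - z)).hasFDerivAt.comp x ((hasFDerivAt_id x).sub_const z)
  exact (h.congr_fderiv (ContinuousLinearMap.comp_id _)).const_mul _

lemma DerivClass.fderiv_gradConv {n : ℕ} {f : E3 → ℝ} (hf : DerivClass RapidDecay (n + 1) f)
    (v x w : E3) :
    fderiv ℝ (gradConv v f) x w = gradConv v (fun y => fderiv ℝ f y w) x := by
  obtain ⟨D, hD⟩ := hf.exists_norm_fderiv_le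
  rw [(hf.hasFDerivAt_gradConv v x).fderiv, ContinuousLinearMap.integral_apply
    (integrable_gradKernel_smul hf.continuous_fderiv hD 0 v x)]
  rfl

lemma polyGrowth_gradConv {f : E3 → ℝ} (hf : Continuous f) (hd : RapidDecay f) (v : E3) :
    PolyGrowth (gradConv v f) := by
  have hw := hd.wtBounded hf
  obtain ⟨M, hM⟩ := hw.exists_integral_rpow_mul_le zero_le_one (by norm_num)
  refine ⟨0, ‖v‖ * M, fun x => ?_⟩
  rw [pow_zero, mul_one, gradConv,
    ← integral_sub_left_eq_self (fun z => gradKernel 0 z v * f (x - z)) volume x, ← Real.norm_eq_abs]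
  refine (norm_integral_le_of_norm_le (g := fun y => ‖v‖ * (‖x - y‖ ^ (-1 : ℝ) * |f y|))
    ?_ (Eventually.of_forall fun y => ?_)).trans ?_
  · have := (hw.integrable_rpow_mul zero_le_one (by norm_num) x).norm.const_mul ‖v‖
    refine this.congr (Eventually.of_forall fun y => ?_)
    simp only [norm_mul, Real.norm_eq_abs]
    rw [abs_of_nonneg (by positivity : 0 ≤ ‖x - y‖ ^ (-1 : ℝ))]
  · rw [sub_sub_cancel, norm_mul, rpow_neg_one, ← mul_assoc]
    exact mul_le_mul_of_nonneg_right (abs_gradKernel_apply_le 0 _ v) (norm_nonneg _)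
  · rw [integral_const_mul]
    exact mul_le_mul_of_nonneg_left (hM x) (norm_nonneg v)

lemma DerivClass.gradConv {n : ℕ} {f : E3 → ℝ} (hf : DerivClass RapidDecay n f) (v : E3) :
    DerivClass PolyGrowth n (gradConv v f) := by
  induction n generalizing f with
  | zero => exact ⟨continuous_gradConv hf.1 hf.2 v, polyGrowth_gradConv hf.1 hf.2 v⟩
  | succ n ih =>
    refine ⟨fun x => (hf.hasFDerivAt_gradConv v x).differentiableAt,
      polyGrowth_gradConv hf.continuous hf.prop v, fun w => ?_⟩
    simp only [hf.fderiv_gradConv]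
    exact ih (hf.2.2 w)

/-! ### Smoothness of the solution -/

lemma rapidDecay_of_le_gauss {f : E3 → ℝ} {l C : ℝ} (hl : 0 < l)
    (hf : ∀ x, |f x| ≤ C * exp (-(3 * l * ‖x‖ ^ 2))) : RapidDecay f := by
  intro N
  have hC : 0 ≤ C := by simpa using (abs_nonneg _).trans (hf 0)
  refine ⟨C * (2 ^ N * (N.factorial / (3 * l) ^ N * exp (3 * l))), fun x => ?_⟩
  have h1 : (3 * l * (1 + ‖x‖ ^ 2)) ^ N ≤ N.factorial * exp (3 * l * (1 + ‖x‖ ^ 2)) := by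
    have := pow_div_factorial_le_exp (3 * l * (1 + ‖x‖ ^ 2)) (by positivity) N
    rwa [div_le_iff₀ (by positivity), mul_comm (exp _)] at this
  have h2 : (1 + ‖x‖) ^ N ≤ 2 ^ N * (1 + ‖x‖ ^ 2) ^ N := by
    rw [← mul_pow]
    exact pow_le_pow_left₀ (by positivity)
      (by nlinarith [sq_nonneg (‖x‖ - 1), sq_nonneg ‖x‖]) N
  have h3 : (1 + ‖x‖ ^ 2) ^ N ≤ N.factorial / (3 * l) ^ N * exp (3 * l * (1 + ‖x‖ ^ 2)) := by
    rw [div_mul_eq_mul_div, le_div_iff₀ (by positivity), ← mul_pow, mul_comm (1 + ‖x‖ ^ 2)]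
    exact h1
  calc |f x| * (1 + ‖x‖) ^ N ≤ C * exp (-(3 * l * ‖x‖ ^ 2)) *
        (2 ^ N * (N.factorial / (3 * l) ^ N * exp (3 * l * (1 + ‖x‖ ^ 2)))) :=
        mul_le_mul (hf x) (h2.trans (mul_le_mul_of_nonneg_left h3 (by positivity)))
          (by positivity) (by positivity)
    _ = C * (2 ^ N * (N.factorial / (3 * l) ^ N *
        (exp (-(3 * l * ‖x‖ ^ 2)) * exp (3 * l * (1 + ‖x‖ ^ 2))))) := by ring
    _ = _ := by
        rw [← exp_add]
        congr 5
        ring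

/-- The setting of the integral equation produced by the fixed point argument. -/
structure LogSolution (l c C : ℝ) (u : E3 → ℝ) : Prop where
  pos : 0 < l
  meas : Measurable u
  le : ∀ x, exp (3 * u x) ≤ C * exp (-(3 * l * ‖x‖ ^ 2))
  eq : ∀ x, u x = 1 / π ^ 2 * logPot (fun y => exp (3 * u y)) x - l * ‖x‖ ^ 2 + c

namespace LogSolution

variable {l c C : ℝ} {u : E3 → ℝ}

lemma rapidDecay (h : LogSolution l c C u) : RapidDecay (fun x => exp (3 * u x)) :=
  rapidDecay_of_le_gauss h.pos (C := C) fun x => by rw [abs_of_pos (exp_pos _)]; exact h.le x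

lemma wtBounded (h : LogSolution l c C u) : WtBounded (fun x => exp (3 * u x)) :=
  ⟨by have := h.meas; fun_prop, h.rapidDecay.exists_le_wt⟩

lemma hasFDerivAt (h : LogSolution l c C u) (x : E3) :
    HasFDerivAt u ((1 / π ^ 2) • (-∫ y, exp (3 * u y) • gradKernel 0 (x - y)) -
      l • (2 • innerSL ℝ x)) x := by
  have h1 := (h.wtBounded.hasFDerivAt_logPot x).const_mul (1 / π ^ 2)
  have h2 := ((hasStrictFDerivAt_norm_sq x).hasFDerivAt).const_mul l
  have h3 := (h1.fun_sub h2).add_const c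
  rwa [show (fun x => 1 / π ^ 2 * logPot (fun y => exp (3 * u y)) x - l * ‖x‖ ^ 2 + c) = u from
    funext fun x => (h.eq x).symm] at h3

lemma differentiable (h : LogSolution l c C u) : Differentiable ℝ u :=
  fun x => (h.hasFDerivAt x).differentiableAt

lemma fderiv_apply (h : LogSolution l c C u) (x v : E3) :
    fderiv ℝ u x v =
      -(1 / π ^ 2) * gradConv v (fun y => exp (3 * u y)) x + -(2 * l) * inner ℝ v x := by
  rw [(h.hasFDerivAt x).fderiv]
  have := h.wtBounded.integral_gradKernel_apply x v
  change (1 / π ^ 2) * (-((∫ y, exp (3 * u y) • gradKernel 0 (x - y)) v)) -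
    l * (2 • inner ℝ x v) = _
  rw [this, real_inner_comm, nsmul_eq_mul]
  push_cast
  ring

lemma derivClass_fderiv (h : LogSolution l c C u) {n : ℕ}
    (hn : DerivClass RapidDecay n (fun x => exp (3 * u x))) (v : E3) :
    DerivClass PolyGrowth n (fun x => fderiv ℝ u x v) := by
  simp only [h.fderiv_apply]
  exact ((hn.gradConv v).const_mul PolyGrowth.const_mul _).add PolyGrowth.add
    ((DerivClass.inner_polyGrowth n v).const_mul PolyGrowth.const_mul _)

lemma derivClass_exp (h : LogSolution l c C u) (n : ℕ) :
    DerivClass RapidDecay n (fun x => exp (3 * u x)) := by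
  induction n with
  | zero =>
    have := h.differentiable.continuous
    exact ⟨by fun_prop, h.rapidDecay⟩
  | succ n ih =>
    have hd := h.differentiable
    refine ⟨by fun_prop, h.rapidDecay, fun v => ?_⟩
    have : (fun x => fderiv ℝ (fun x => exp (3 * u x)) x v) =
        fun x => exp (3 * u x) * (3 * fderiv ℝ u x v) := by
      ext x
      rw [(((hd x).hasFDerivAt.const_mul 3).exp).fderiv]
      rfl
    rw [this]
    exact ih.mul ((h.derivClass_fderiv ih v).const_mul PolyGrowth.const_mul 3)

lemma contDiff (h : LogSolution l c C u) : ContDiff ℝ (⊤ : ℕ∞) u := by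
  rw [contDiff_infty]
  intro n
  cases n with
  | zero => exact contDiff_zero.2 h.differentiable.continuous
  | succ n =>
    push_cast
    refine contDiff_succ_iff_fderiv_apply.2 ⟨h.differentiable, fun h0 => ?_,
      fun v => (h.derivClass_fderiv (h.derivClass_exp n) v).contDiff⟩
    exact absurd h0 (by simp)

end LogSolution

/-! ### The Laplacian of the solution -/

lemma hasFDerivAt_gradKernel_single {ε : ℝ} (hε : 0 < ε) (z : E3) (i : Fin 3) :
    ∃ L : E3 →L[ℝ] ℝ, HasFDerivAt (fun z => gradKernel ε z (EuclideanSpace.single i 1)) L z ∧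
      L (EuclideanSpace.single i 1) =
        (‖z‖ ^ 2 + ε ^ 2)⁻¹ - 2 * z i ^ 2 / (‖z‖ ^ 2 + ε ^ 2) ^ 2 := by
  have hpos : ‖z‖ ^ 2 + ε ^ 2 ≠ 0 := by positivity
  have h1 := (hasDerivAt_inv hpos).comp_hasFDerivAt z
    ((hasStrictFDerivAt_norm_sq z).hasFDerivAt.add_const (ε ^ 2))
  have h2 : HasFDerivAt (fun z : E3 => z i) (EuclideanSpace.proj i : E3 →L[ℝ] ℝ) z :=
    (EuclideanSpace.proj i : E3 →L[ℝ] ℝ).hasFDerivAt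
  have h3 := h1.fun_mul h2
  have hin : ∀ z : E3, inner ℝ z (EuclideanSpace.single i (1:ℝ)) = z i := fun z => by
    rw [EuclideanSpace.inner_single_right]
    simp
  have h4 : (fun z : E3 => gradKernel ε z (EuclideanSpace.single i 1)) =
      fun z => (‖z‖ ^ 2 + ε ^ 2)⁻¹ * z i := by
    ext z
    change _ * inner ℝ z (EuclideanSpace.single i 1) = _
    rw [hin]
  refine ⟨_, h4 ▸ h3, ?_⟩
  change (‖z‖ ^ 2 + ε ^ 2)⁻¹ * (EuclideanSpace.single i (1:ℝ) : E3) i +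
    z i * (-((‖z‖ ^ 2 + ε ^ 2) ^ 2)⁻¹ * (2 • inner ℝ z (EuclideanSpace.single i 1))) = _
  rw [hin]
  simp
  ring

lemma abs_divKernel_le (ε : ℝ) {z : E3} (hz : z ≠ 0) (i : Fin 3) :
    |(‖z‖ ^ 2 + ε ^ 2)⁻¹ - 2 * z i ^ 2 / (‖z‖ ^ 2 + ε ^ 2) ^ 2| ≤ 3 * (‖z‖ ^ 2)⁻¹ := by
  have hr : 0 < ‖z‖ := norm_pos_iff.2 hz
  have h1 : (‖z‖ ^ 2 + ε ^ 2)⁻¹ ≤ (‖z‖ ^ 2)⁻¹ := inv_anti₀ (by positivity) (by nlinarith)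
  have h0 : 0 < (‖z‖ ^ 2 + ε ^ 2)⁻¹ := by positivity
  have h2 : z i ^ 2 ≤ ‖z‖ ^ 2 := by
    have := PiLp.norm_apply_le z i
    rw [← sq_abs]
    exact pow_le_pow_left₀ (abs_nonneg _) this 2
  have h3 : 2 * z i ^ 2 / (‖z‖ ^ 2 + ε ^ 2) ^ 2 ≤ 2 * (‖z‖ ^ 2 + ε ^ 2)⁻¹ := by
    rw [div_le_iff₀ (by positivity)]
    have : 2 * (‖z‖ ^ 2 + ε ^ 2)⁻¹ * (‖z‖ ^ 2 + ε ^ 2) ^ 2 = 2 * (‖z‖ ^ 2 + ε ^ 2) := by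
      field_simp
    rw [this]
    nlinarith [sq_nonneg ε]
  have h4 : 0 ≤ 2 * z i ^ 2 / (‖z‖ ^ 2 + ε ^ 2) ^ 2 := by positivity
  rw [abs_le]
  constructor <;> linarith

lemma sum_divKernel (z : E3) :
    ∑ i, ((‖z‖ ^ 2 + 0 ^ 2)⁻¹ - 2 * z i ^ 2 / (‖z‖ ^ 2 + 0 ^ 2) ^ 2) = (‖z‖ ^ 2)⁻¹ := by
  rcases eq_or_ne z 0 with rfl | hz
  · simp
  have hr : 0 < ‖z‖ := norm_pos_iff.2 hz
  have h : ∑ i, z i ^ 2 = ‖z‖ ^ 2 := by rw [EuclideanSpace.norm_sq_eq]; simp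
  rw [Finset.sum_sub_distrib, ← Finset.sum_div, ← Finset.mul_sum, h]
  simp only [Finset.sum_const, Finset.card_univ, Fintype.card_fin]
  rw [nsmul_eq_mul]
  field_simp
  push_cast
  ring

lemma WtBounded.integrable_inv_sq_mul {f : E3 → ℝ} (hf : WtBounded f) (x : E3) :
    Integrable (fun z => (‖z‖ ^ 2)⁻¹ * f (x - z)) := by
  have := (hf.integrable_rpow_mul (a := 2) (by norm_num) (by norm_num) x).comp_sub_left x
  refine this.congr (Eventually.of_forall fun z => ?_)
  simp only [sub_sub_cancel]
  rw [rpow_neg (norm_nonneg _), rpow_two]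

lemma measurable_divKernel (ε : ℝ) (i : Fin 3) :
    Measurable fun z : E3 => (‖z‖ ^ 2 + ε ^ 2)⁻¹ - 2 * z i ^ 2 / (‖z‖ ^ 2 + ε ^ 2) ^ 2 := by
  fun_prop

lemma WtBounded.norm_divKernel_mul_le {f : E3 → ℝ} (ε : ℝ) (x : E3)
    (i : Fin 3) : ∀ᵐ z, ‖((‖z‖ ^ 2 + ε ^ 2)⁻¹ - 2 * z i ^ 2 / (‖z‖ ^ 2 + ε ^ 2) ^ 2) * f (x - z)‖ ≤
      3 * ‖(‖z‖ ^ 2)⁻¹ * f (x - z)‖ := by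
  filter_upwards [Measure.ae_ne volume (0 : E3)] with z hz
  rw [norm_mul, norm_mul, ← mul_assoc]
  refine mul_le_mul_of_nonneg_right ?_ (norm_nonneg _)
  rw [Real.norm_eq_abs, Real.norm_of_nonneg (by positivity)]
  exact abs_divKernel_le ε hz i

lemma WtBounded.integrable_divKernel {f : E3 → ℝ} (hf : WtBounded f) (ε : ℝ) (x : E3) (i : Fin 3) :
    Integrable (fun z =>
      ((‖z‖ ^ 2 + ε ^ 2)⁻¹ - 2 * z i ^ 2 / (‖z‖ ^ 2 + ε ^ 2) ^ 2) * f (x - z)) :=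
  ((hf.integrable_inv_sq_mul x).norm.const_mul 3).mono'
    ((measurable_divKernel ε i).mul
      (hf.meas.comp (measurable_const.sub measurable_id))).aestronglyMeasurable
    (WtBounded.norm_divKernel_mul_le ε x i)

lemma DerivClass.integral_gradKernel_mul_fderiv {n : ℕ} {f : E3 → ℝ}
    (hf : DerivClass RapidDecay (n + 1) f) {ε : ℝ} (hε : 0 < ε) (x : E3) (i : Fin 3) :
    ∫ z, gradKernel ε z (EuclideanSpace.single i 1) *
        fderiv ℝ f (x - z) (EuclideanSpace.single i 1) =
      ∫ z, ((‖z‖ ^ 2 + ε ^ 2)⁻¹ - 2 * z i ^ 2 / (‖z‖ ^ 2 + ε ^ 2) ^ 2) * f (x - z) := by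
  obtain ⟨C, hC⟩ := hf.prop.exists_le_wt
  obtain ⟨D, hD⟩ := (hf.2.2 (EuclideanSpace.single i 1)).prop.exists_le_wt
  have hk : ∀ z, fderiv ℝ (fun z => gradKernel ε z (EuclideanSpace.single i 1)) z
      (EuclideanSpace.single i 1) =
      (‖z‖ ^ 2 + ε ^ 2)⁻¹ - 2 * z i ^ 2 / (‖z‖ ^ 2 + ε ^ 2) ^ 2 := by
    intro z
    obtain ⟨L, hL, h⟩ := hasFDerivAt_gradKernel_single hε z i
    rw [hL.fderiv, h]
  have hg : ∀ z, HasFDerivAt (fun z => f (x - z)) (-fderiv ℝ f (x - z)) z := by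
    intro z
    have h := (hf.1 (x - z)).hasFDerivAt.comp z ((hasFDerivAt_id z).const_sub x)
    exact h.congr_fderiv (by ext v; simp)
  have hg' : ∀ z v, fderiv ℝ (fun z => f (x - z)) z v = -fderiv ℝ f (x - z) v := by
    intro z v
    rw [(hg z).fderiv]
    rfl
  have h := integral_mul_fderiv_eq_neg_fderiv_mul_of_integrable (μ := (volume : Measure E3))
    (f := fun z => gradKernel ε z (EuclideanSpace.single i 1)) (g := fun z => f (x - z))
    (v := EuclideanSpace.single i 1) ?_ ?_ ?_
    (fun z _ => (hasFDerivAt_gradKernel_single hε z i).choose_spec.1.differentiableAt)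
    (fun z _ => (hg z).differentiableAt)
  · simp only [hk, hg', mul_neg, integral_neg, neg_inj] at h
    exact h
  · simp only [hk]
    exact (hf.prop.wtBounded hf.continuous).integrable_divKernel ε x i
  · simp only [hg', mul_neg]
    exact (integrable_gradKernel_smul (hf.2.2 _).continuous hD ε _ x).neg
  · exact integrable_gradKernel_smul hf.continuous hC ε _ x

lemma DerivClass.sum_gradConv_fderiv {n : ℕ} {f : E3 → ℝ}
    (hf : DerivClass RapidDecay (n + 1) f) (x : E3) :
    ∑ i : Fin 3, _root_.gradConv (EuclideanSpace.single i 1)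
      (fun y => fderiv ℝ f y (EuclideanSpace.single i 1)) x = ∫ z, (‖z‖ ^ 2)⁻¹ * f (x - z) := by
  have hw := hf.prop.wtBounded hf.continuous
  have key : ∀ i : Fin 3, _root_.gradConv (EuclideanSpace.single i 1)
      (fun y => fderiv ℝ f y (EuclideanSpace.single i 1)) x =
      ∫ z, ((‖z‖ ^ 2 + 0 ^ 2)⁻¹ - 2 * z i ^ 2 / (‖z‖ ^ 2 + 0 ^ 2) ^ 2) * f (x - z) := by
    intro i
    obtain ⟨D, hD⟩ := (hf.2.2 (EuclideanSpace.single i 1)).prop.exists_le_wt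
    have hε : Tendsto (fun ε : ℝ => ε) (nhdsWithin 0 (Set.Ioi 0)) (nhds 0) := nhdsWithin_le_nhds
    have hr : ∀ z : E3, z ≠ 0 → Tendsto (fun ε : ℝ => (‖z‖ ^ 2 + ε ^ 2)⁻¹)
        (nhdsWithin 0 (Set.Ioi 0)) (nhds (‖z‖ ^ 2 + 0 ^ 2)⁻¹) := by
      intro z hz
      have : 0 < ‖z‖ := norm_pos_iff.2 hz
      exact ((hε.pow 2).const_add _).inv₀ (by positivity)
    have h1 : Tendsto (fun ε : ℝ => ∫ z, gradKernel ε z (EuclideanSpace.single i 1) *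
        fderiv ℝ f (x - z) (EuclideanSpace.single i 1)) (nhdsWithin 0 (Set.Ioi 0))
        (nhds (_root_.gradConv (EuclideanSpace.single i 1)
          (fun y => fderiv ℝ f y (EuclideanSpace.single i 1)) x)) := by
      refine tendsto_integral_filter_of_dominated_convergence _
        (Eventually.of_forall fun ε =>
          (integrable_gradKernel_smul (hf.2.2 _).continuous hD ε _ x).1)
        (Eventually.of_forall fun ε => Eventually.of_forall fun z =>
          norm_mul_comp_sub_le (g := fun y => fderiv ℝ f y (EuclideanSpace.single i 1)) hD (Metric.mem_ball_self one_pos) ε _ z)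
        (integrable_inv_mul_wt.const_mul _) ?_
      filter_upwards [Measure.ae_ne volume (0 : E3)] with z hz
      exact ((hr z hz).mul_const _).mul_const _
    have h2 : Tendsto (fun ε : ℝ =>
        ∫ z, ((‖z‖ ^ 2 + ε ^ 2)⁻¹ - 2 * z i ^ 2 / (‖z‖ ^ 2 + ε ^ 2) ^ 2) * f (x - z))
        (nhdsWithin 0 (Set.Ioi 0))
        (nhds (∫ z, ((‖z‖ ^ 2 + 0 ^ 2)⁻¹ - 2 * z i ^ 2 / (‖z‖ ^ 2 + 0 ^ 2) ^ 2) * f (x - z))) := by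
      refine tendsto_integral_filter_of_dominated_convergence _
        (Eventually.of_forall fun ε => (hw.integrable_divKernel ε x i).1)
        (Eventually.of_forall fun ε => WtBounded.norm_divKernel_mul_le ε x i)
        ((hw.integrable_inv_sq_mul x).norm.const_mul 3) ?_
      filter_upwards [Measure.ae_ne volume (0 : E3)] with z hz
      have h3 := (hr z hz)
      simp only [div_eq_mul_inv, ← inv_pow]
      exact (h3.sub ((h3.pow 2).const_mul _)).mul_const _
    refine tendsto_nhds_unique h1 (h2.congr' ?_)
    filter_upwards [self_mem_nhdsWithin] with ε hε
    exact (hf.integral_gradKernel_mul_fderiv hε x i).symm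
  rw [Finset.sum_congr rfl fun i _ => key i,
    ← integral_finsetSum _ fun i _ => hw.integrable_divKernel 0 x i]
  refine integral_congr_ae (Eventually.of_forall fun z => ?_)
  simp only
  rw [← Finset.sum_mul, sum_divKernel]

lemma LogSolution.lap_eq {l c C : ℝ} {u : E3 → ℝ} (h : LogSolution l c C u) (x : E3) :
    lap u x = -(1 / π ^ 2) * (∫ y, (‖x - y‖ ^ 2)⁻¹ * exp (3 * u y)) - 6 * l := by
  have hf := h.derivClass_exp 1
  have hi : ∀ i : Fin 3, fderiv ℝ (fun y => fderiv ℝ u y (EuclideanSpace.single i 1)) x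
      (EuclideanSpace.single i 1) = -(1 / π ^ 2) * gradConv (EuclideanSpace.single i 1)
      (fun y => fderiv ℝ (fun x => exp (3 * u x)) y (EuclideanSpace.single i 1)) x - 2 * l := by
    intro i
    simp only [h.fderiv_apply]
    have h1 := ((hf.gradConv (EuclideanSpace.single i 1)).1 x).hasFDerivAt.const_mul (-(1 / π ^ 2))
    have h2 : HasFDerivAt (fun x : E3 => -(2 * l) * inner ℝ (EuclideanSpace.single i 1) x)
        (-(2 * l) • innerSL ℝ (EuclideanSpace.single i (1:ℝ) : E3)) x :=
      ((innerSL ℝ (EuclideanSpace.single i (1:ℝ) : E3)).hasFDerivAt).const_mul _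
    rw [(h1.fun_add h2).fderiv]
    change -(1 / π ^ 2) * fderiv ℝ (gradConv (EuclideanSpace.single i 1)
        fun x => exp (3 * u x)) x (EuclideanSpace.single i 1) +
      -(2 * l) * inner ℝ (EuclideanSpace.single i (1:ℝ) : E3) (EuclideanSpace.single i 1) = _
    rw [hf.fderiv_gradConv]
    simp
    ring
  rw [lap, Finset.sum_congr rfl fun i _ => hi i, Finset.sum_sub_distrib, ← Finset.mul_sum,
    hf.sum_gradConv_fderiv, ← integral_sub_left_eq_self _ volume x]
  simp only [Finset.sum_const, Finset.card_univ, Fintype.card_fin, sub_sub_cancel, nsmul_eq_mul]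
  push_cast
  ring

/-! ### Symmetric second differences of Schwartz functions -/

lemma SchwartzMap.exists_norm_le_wt {F : Type*} [NormedAddCommGroup F] [NormedSpace ℝ F]
    (ψ : SchwartzMap E3 F) : ∃ C, 0 ≤ C ∧ ∀ x, ‖ψ x‖ ≤ C * wt x := by
  obtain ⟨C₀, h₀⟩ := ψ.decay 0 0
  obtain ⟨C₆, h₆⟩ := ψ.decay 6 0
  refine ⟨4 * (C₀ + C₆), by linarith [h₀.1, h₆.1], fun x => ?_⟩
  have h1 := h₀.2 x
  have h2 := h₆.2 x
  rw [norm_iteratedFDeriv_zero] at h1 h2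
  rw [pow_zero, one_mul] at h1
  rw [wt, ← div_eq_mul_inv, le_div_iff₀ (by positivity)]
  have h3 : (1 + ‖x‖ ^ 2) ^ 3 ≤ 4 * (1 + ‖x‖ ^ 6) := by
    have : 4 * (1 + ‖x‖ ^ 6) - (1 + ‖x‖ ^ 2) ^ 3 = 3 * (1 - ‖x‖ ^ 2) ^ 2 * (1 + ‖x‖ ^ 2) := by ring
    have : 0 ≤ 3 * (1 - ‖x‖ ^ 2) ^ 2 * (1 + ‖x‖ ^ 2) := by positivity
    linarith
  calc ‖ψ x‖ * (1 + ‖x‖ ^ 2) ^ 3 ≤ ‖ψ x‖ * (4 * (1 + ‖x‖ ^ 6)) := by gcongr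
    _ = 4 * (‖ψ x‖ + ‖x‖ ^ 6 * ‖ψ x‖) := by ring
    _ ≤ _ := by linarith

/-- The symmetric second difference `2φ(x) - φ(x+z) - φ(x-z)`. -/
def secondDiff (φ : E3 → ℝ) (x z : E3) : ℝ := 2 * φ x - φ (x + z) - φ (x - z)

lemma wt_add_le {x w : E3} (hw : ‖w‖ ≤ 1) : wt (x + w) ≤ 64 * wt x := by
  have h := wt_sub_le w (-x)
  rw [sub_neg_eq_add, add_comm, show wt (-x) = wt x by simp [wt]] at h
  refine h.trans (mul_le_mul_of_nonneg_right ?_ (wt_pos x).le)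
  calc (2 * (1 + ‖w‖ ^ 2)) ^ 3 ≤ (2 * (1 + 1 ^ 2)) ^ 3 := by gcongr
    _ = 64 := by norm_num

lemma exists_secondDiff_le (φ : SchwartzMap E3 ℝ) :
    ∃ C, 0 ≤ C ∧ ∀ x z, ‖z‖ ≤ 1 → |secondDiff φ x z| ≤ C * wt x * ‖z‖ ^ 2 := by
  obtain ⟨C, hC0, hC⟩ := (SchwartzMap.fderivCLM ℝ E3 (E3 →L[ℝ] ℝ)
    (SchwartzMap.fderivCLM ℝ E3 ℝ φ)).exists_norm_le_wt
  refine ⟨128 * C, by positivity, fun x z hz => ?_⟩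
  have hd : ∀ y, HasFDerivAt φ (fderiv ℝ φ y) y := fun y => (φ.differentiable y).hasFDerivAt
  have hd2 : Differentiable ℝ (fderiv ℝ φ) := (SchwartzMap.fderivCLM ℝ E3 ℝ φ).differentiable
  have hgrad : ∀ w : E3, ‖w‖ ≤ 1 →
      ‖fderiv ℝ φ (x + w) - fderiv ℝ φ (x - w)‖ ≤ C * (64 * wt x) * (2 * ‖w‖) := by
    intro w hw
    have h := (convex_closedBall x 1).norm_image_sub_le_of_norm_fderiv_le (𝕜 := ℝ)
      (f := fderiv ℝ φ) (C := C * (64 * wt x)) (x := x - w) (y := x + w) (fun y _ => hd2 y)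
      (fun y hy => ?_) (by simpa using hw) (by simpa using hw)
    · rwa [show x + w - (x - w) = (2:ℝ) • w by rw [two_smul]; abel, norm_smul,
        Real.norm_of_nonneg zero_le_two] at h
    · have h1 := wt_add_le (x := x) (w := y - x) (by simpa [dist_eq_norm] using hy)
      rw [add_sub_cancel] at h1
      exact (hC y).trans (mul_le_mul_of_nonneg_left h1 hC0)
  have hF : ∀ w : E3, HasFDerivAt (fun w => φ (x + w) + φ (x - w))
      (fderiv ℝ φ (x + w) - fderiv ℝ φ (x - w)) w := by
    intro w
    have h1 := (hd (x + w)).comp w ((hasFDerivAt_id w).const_add x)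
    have h2 := (hd (x - w)).comp w ((hasFDerivAt_id w).const_sub x)
    refine (h1.fun_add h2).congr_fderiv ?_
    ext v
    simp [sub_eq_add_neg]
  have h := (convex_closedBall (0 : E3) ‖z‖).norm_image_sub_le_of_norm_hasFDerivWithin_le (𝕜 := ℝ)
    (C := C * (64 * wt x) * (2 * ‖z‖)) (x := 0) (y := z) (fun w _ => (hF w).hasFDerivWithinAt)
    (fun w hw => (hgrad w ?_).trans ?_) (by simp) (by simp)
  · rw [← abs_neg, ← Real.norm_eq_abs]
    convert h using 1
    · congr 1
      simp [secondDiff]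
      ring
    · rw [sub_zero]; ring
  · exact (mem_closedBall_zero_iff.1 hw).trans hz
  · have := mem_closedBall_zero_iff.1 hw
    have := wt_pos x
    gcongr

/-- An integrable function dominating `|z|⁻⁴ min(1, |z|²)`. -/
noncomputable def levyWeight (z : E3) : ℝ := ‖z‖ ^ (-2 : ℝ) * wt z + (1 + ‖z‖ ^ 2) * wt z

lemma integrable_levyWeight : Integrable levyWeight := by
  have := integrable_rieszKernel_mul_wt (a := 2) (by norm_num) (by norm_num) (0 : E3)
  simp only [zero_sub, norm_neg] at this
  exact this.add integrable_sq_mul_wt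

lemma levyWeight_nonneg (z : E3) : 0 ≤ levyWeight z := by
  have := (wt_pos z).le
  unfold levyWeight
  positivity

lemma div_pow_four_le_levyWeight {A B t : ℝ} {z : E3} (hA : 0 ≤ A) (hB : 0 ≤ B)
    (h1 : ‖z‖ ≤ 1 → t ≤ A * ‖z‖ ^ 2) (h2 : t ≤ B) :
    t / ‖z‖ ^ 4 ≤ (8 * A + 4 * B) * levyWeight z := by
  rcases eq_or_ne z 0 with rfl | hz
  · simp only [norm_zero, ne_eq, OfNat.ofNat_ne_zero, not_false_eq_true, zero_pow, div_zero]
    exact mul_nonneg (by positivity) (levyWeight_nonneg 0)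
  have hr : 0 < ‖z‖ := norm_pos_iff.2 hz
  have hw := wt_pos z
  have hA1 : 0 ≤ ‖z‖ ^ (-2 : ℝ) * wt z := by positivity
  have hB1 : 0 ≤ (1 + ‖z‖ ^ 2) * wt z := by positivity
  rcases le_or_gt ‖z‖ 1 with hz1 | hz1
  · have h3 : 1 ≤ 8 * wt z := by
      rw [wt, ← div_eq_mul_inv, one_le_div (by positivity)]
      calc (1 + ‖z‖ ^ 2) ^ 3 ≤ (1 + 1 ^ 2) ^ 3 := by gcongr
        _ = 8 := by norm_num
    have h4 : t / ‖z‖ ^ 4 ≤ A * ‖z‖ ^ (-2 : ℝ) := by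
      rw [div_le_iff₀ (by positivity), rpow_neg hr.le, rpow_two]
      refine (h1 hz1).trans_eq ?_
      field_simp
    have h5 : A * ‖z‖ ^ (-2 : ℝ) * 1 ≤ A * ‖z‖ ^ (-2 : ℝ) * (8 * wt z) :=
      mul_le_mul_of_nonneg_left h3 (by positivity)
    unfold levyWeight
    nlinarith [mul_nonneg hB hA1, mul_nonneg hA hB1, mul_nonneg hB hB1]
  · have h3 : t / ‖z‖ ^ 4 ≤ B / ‖z‖ ^ 4 := by gcongr
    have h4 : B / ‖z‖ ^ 4 ≤ 4 * B * ((1 + ‖z‖ ^ 2) * wt z) := by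
      have : (1 + ‖z‖ ^ 2) * wt z = ((1 + ‖z‖ ^ 2) ^ 2)⁻¹ := by
        rw [wt]; field_simp
      rw [this, ← div_eq_mul_inv, div_le_div_iff₀ (by positivity) (by positivity)]
      have : (1 + ‖z‖ ^ 2) ^ 2 ≤ (2 * ‖z‖ ^ 2) ^ 2 := pow_le_pow_left₀ (by positivity)
        (by nlinarith) 2
      nlinarith
    unfold levyWeight
    nlinarith [mul_nonneg hB hA1, mul_nonneg hA hB1, mul_nonneg hA hA1]

lemma continuous_secondDiff (φ : SchwartzMap E3 ℝ) :
    Continuous fun p : E3 × E3 => secondDiff φ p.1 p.2 := by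
  have := φ.continuous
  unfold secondDiff
  fun_prop

lemma measurable_secondDiff_div (φ : SchwartzMap E3 ℝ) :
    Measurable fun p : E3 × E3 => secondDiff φ p.1 p.2 / ‖p.2‖ ^ 4 :=
  (continuous_secondDiff φ).measurable.div (by fun_prop)

lemma exists_secondDiff_div_le (φ : SchwartzMap E3 ℝ) :
    ∃ C, 0 ≤ C ∧ ∀ x z, |secondDiff φ x z| / ‖z‖ ^ 4 ≤ C * levyWeight z := by
  obtain ⟨A, hA, h1⟩ := exists_secondDiff_le φ
  obtain ⟨B, hB, h2⟩ := φ.exists_norm_le_wt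
  refine ⟨8 * A + 4 * (4 * B), by positivity, fun x z => ?_⟩
  refine div_pow_four_le_levyWeight hA (by positivity) (fun hz => (h1 x z hz).trans ?_) ?_
  · have : A * wt x ≤ A * 1 := mul_le_mul_of_nonneg_left (wt_le_one x) hA
    nlinarith [sq_nonneg ‖z‖]
  · have h3 : ∀ y, |φ y| ≤ B := fun y => (h2 y).trans (mul_le_of_le_one_right hB (wt_le_one y))
    have := abs_le.1 (h3 x)
    have := abs_le.1 (h3 (x + z))
    have := abs_le.1 (h3 (x - z))
    rw [secondDiff, abs_le]
    constructor <;> linarith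

lemma integrable_secondDiff_div_right (φ : SchwartzMap E3 ℝ) (x : E3) :
    Integrable fun z => secondDiff φ x z / ‖z‖ ^ 4 := by
  obtain ⟨C, -, h⟩ := exists_secondDiff_div_le φ
  refine (integrable_levyWeight.const_mul C).mono'
    ((measurable_secondDiff_div φ).comp measurable_prodMk_left).aestronglyMeasurable
    (Eventually.of_forall fun z => ?_)
  rw [norm_div, norm_pow, norm_norm]
  exact h x z

lemma integrable_secondDiff_left (φ : SchwartzMap E3 ℝ) (z : E3) :
    Integrable fun x => secondDiff φ x z :=
  ((φ.integrable.const_mul 2).sub (φ.integrable.comp_add_right z)).sub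
    (φ.integrable.comp_sub_right z)

lemma integral_secondDiff_left (φ : SchwartzMap E3 ℝ) (z : E3) :
    ∫ x, secondDiff φ x z = 0 := by
  have h0 : Integrable φ := φ.integrable
  have h1 : Integrable fun x => 2 * φ x - φ (x + z) := (h0.const_mul 2).sub (h0.comp_add_right z)
  unfold secondDiff
  rw [integral_sub h1 (h0.comp_sub_right z),
    integral_sub (h0.const_mul 2) (h0.comp_add_right z), integral_const_mul,
    integral_add_right_eq_self (fun x => φ x) z, integral_sub_right_eq_self (fun x => φ x) z]
  ring

lemma exists_integral_secondDiff_le (φ : SchwartzMap E3 ℝ) :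
    ∃ C, ∀ z, (∫ x, |secondDiff φ x z|) / ‖z‖ ^ 4 ≤ C * levyWeight z := by
  obtain ⟨A, hA, h1⟩ := exists_secondDiff_le φ
  have h0 : Integrable φ := φ.integrable
  have hw : 0 ≤ ∫ x : E3, wt x := integral_nonneg fun x => (wt_pos x).le
  have hI : 0 ≤ ∫ x, |φ x| := integral_nonneg fun x => abs_nonneg _
  refine ⟨8 * (A * ∫ x, wt x) + 4 * (4 * ∫ x, |φ x|), fun z =>
    div_pow_four_le_levyWeight (by positivity) (by positivity) (fun hz => ?_) ?_⟩
  · rw [← integral_const_mul, ← integral_mul_const]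
    exact integral_mono (integrable_secondDiff_left φ z).abs
      ((integrable_wt.const_mul A).mul_const _) fun x => h1 x z hz
  · calc ∫ x, |secondDiff φ x z| ≤ ∫ x, (2 * |φ x| + |φ (x + z)| + |φ (x - z)|) := by
          refine integral_mono (integrable_secondDiff_left φ z).abs
            (((h0.abs.const_mul 2).add (h0.abs.comp_add_right z)).add (h0.abs.comp_sub_right z))
            fun x => ?_
          simp only [secondDiff]
          refine (abs_sub _ _).trans (add_le_add_left ((abs_sub _ _).trans_eq ?_) _)
          rw [abs_mul, abs_two]
      _ = 4 * ∫ x, |φ x| := by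
          have h1 : Integrable fun x => 2 * |φ x| + |φ (x + z)| :=
            (h0.abs.const_mul 2).add (h0.abs.comp_add_right z)
          rw [integral_add h1 (h0.abs.comp_sub_right z), integral_add (h0.abs.const_mul 2)
            (h0.abs.comp_add_right z), integral_const_mul,
            integral_add_right_eq_self (fun x => |φ x|) z,
            integral_sub_right_eq_self (fun x => |φ x|) z]
          ring

lemma integrable_secondDiff_div (φ : SchwartzMap E3 ℝ) :
    Integrable (fun p : E3 × E3 => secondDiff φ p.1 p.2 / ‖p.2‖ ^ 4) (volume.prod volume) := by
  have hm := (measurable_secondDiff_div φ).aestronglyMeasurable (μ := volume.prod volume)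
  obtain ⟨C, hC⟩ := exists_integral_secondDiff_le φ
  refine (integrable_prod_iff' hm).2 ⟨Eventually.of_forall fun z =>
    (integrable_secondDiff_left φ z).div_const (‖z‖ ^ 4), ?_⟩
  refine (integrable_levyWeight.const_mul C).mono' hm.norm.prod_swap.integral_prod_right'
    (Eventually.of_forall fun z => ?_)
  rw [Real.norm_of_nonneg (integral_nonneg fun x => norm_nonneg _)]
  refine Eq.trans_le ?_ (hC z)
  rw [← integral_div]
  simp only [norm_div, norm_pow, Real.norm_eq_abs, abs_norm]

/-! ### The half-Laplacian as a Lebesgue integral of second differences -/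

lemma setIntegral_truncated_eq (φ : SchwartzMap E3 ℝ) (x : E3) {ε : ℝ} (hε : 0 < ε) :
    ∫ y in {y : E3 | ε < ‖x - y‖}, (φ x - φ y) / ‖x - y‖ ^ 4 =
      (1 / 2) * ∫ z, {z : E3 | ε < ‖z‖}.indicator (fun z => secondDiff φ x z / ‖z‖ ^ 4) z := by
  set g : E3 → ℝ := {z : E3 | ε < ‖z‖}.indicator fun z => (φ x - φ (x - z)) / ‖z‖ ^ 4 with hg
  have hmeas : ∀ c : E3, MeasurableSet {y : E3 | ε < ‖c - y‖} := fun c =>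
    measurableSet_lt measurable_const (by fun_prop)
  have hS : MeasurableSet {z : E3 | ε < ‖z‖} := measurableSet_lt measurable_const (by fun_prop)
  have hgm : Measurable g := by
    refine Measurable.indicator ?_ hS
    have := φ.continuous.measurable
    fun_prop
  obtain ⟨B, hB, hφ⟩ := φ.exists_norm_le_wt
  have hφ' : ∀ y, |φ y| ≤ B := fun y => (hφ y).trans (mul_le_of_le_one_right hB (wt_le_one y))
  have hgi : Integrable g := by
    refine (integrable_levyWeight.const_mul (8 * (2 * B / ε ^ 2) + 4 * (2 * B))).mono'
      hgm.aestronglyMeasurable (Eventually.of_forall fun z => ?_)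
    by_cases hz : ε < ‖z‖
    · rw [hg, Set.indicator_of_mem (by exact hz), norm_div, norm_pow, norm_norm, Real.norm_eq_abs]
      have h1 : |φ x - φ (x - z)| ≤ 2 * B :=
        (abs_sub _ _).trans (by linarith [hφ' x, hφ' (x - z)])
      refine div_pow_four_le_levyWeight (by positivity) (by positivity)
        (fun _ => h1.trans ?_) h1
      rw [div_mul_eq_mul_div, le_div_iff₀ (by positivity)]
      gcongr
    · rw [hg, Set.indicator_of_notMem (by exact hz), norm_zero]
      exact mul_nonneg (by positivity) (levyWeight_nonneg z)
  have h1 : ∫ y in {y : E3 | ε < ‖x - y‖}, (φ x - φ y) / ‖x - y‖ ^ 4 = ∫ z, g z := by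
    rw [← integral_indicator (hmeas x), ← integral_sub_left_eq_self g volume x]
    congr 1 with y
    simp only [hg, Set.indicator_apply, Set.mem_ofPred_eq, sub_sub_cancel]
  have h2 : ∫ z, g (-z) = ∫ z, g z := integral_neg_eq_self g volume
  have h3 : ∫ z, (g z + g (-z)) = (∫ z, g z) + ∫ z, g (-z) := integral_add hgi hgi.comp_neg
  rw [h1]
  have h4 : ∫ z, {z : E3 | ε < ‖z‖}.indicator (fun z => secondDiff φ x z / ‖z‖ ^ 4) z =
      ∫ z, (g z + g (-z)) := by
    congr 1 with z
    simp only [hg, Set.indicator_apply, Set.mem_ofPred_eq, norm_neg, sub_neg_eq_add]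
    split_ifs
    · rw [secondDiff]; ring
    · simp
  rw [h4, h3, h2]
  ring

lemma halfLap_eq (φ : SchwartzMap E3 ℝ) (x : E3) :
    halfLap φ x = 1 / (2 * π ^ 2) * ∫ z, secondDiff φ x z / ‖z‖ ^ 4 := by
  have hlim : Tendsto (fun ε : ℝ => ∫ z, {z : E3 | ε < ‖z‖}.indicator
      (fun z => secondDiff φ x z / ‖z‖ ^ 4) z) (nhdsWithin 0 (Set.Ioi 0))
      (nhds (∫ z, secondDiff φ x z / ‖z‖ ^ 4)) := by
    have hi := integrable_secondDiff_div_right φ x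
    refine tendsto_integral_filter_of_dominated_convergence
      (fun z => ‖secondDiff φ x z / ‖z‖ ^ 4‖) (Eventually.of_forall fun ε => ?_)
      (Eventually.of_forall fun ε => Eventually.of_forall fun z => norm_indicator_le_norm_self _ _)
      hi.norm (Eventually.of_forall fun z => ?_)
    · exact hi.aestronglyMeasurable.indicator (measurableSet_lt measurable_const (by fun_prop))
    · rcases eq_or_ne z 0 with rfl | hz
      · refine tendsto_const_nhds.congr fun ε => ?_
        rw [Set.indicator_apply]
        split_ifs <;> simp
      · refine tendsto_const_nhds.congr' ?_
        filter_upwards [nhdsWithin_le_nhds (Iio_mem_nhds (norm_pos_iff.2 hz))] with ε hε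
        rw [Set.indicator_of_mem (by exact hε)]
  refine Tendsto.limUnder_eq (Tendsto.congr' ?_ (hlim.const_mul (1 / (2 * π ^ 2))))
  filter_upwards [self_mem_nhdsWithin] with ε hε
  rw [setIntegral_truncated_eq φ x hε]
  field_simp

lemma integrable_halfLap (φ : SchwartzMap E3 ℝ) : Integrable (halfLap φ) := by
  rw [funext (halfLap_eq φ)]
  exact (integrable_secondDiff_div φ).integral_prod_left.const_mul _

lemma integral_halfLap (φ : SchwartzMap E3 ℝ) : ∫ x, halfLap φ x = 0 := by
  simp_rw [halfLap_eq φ]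
  rw [integral_const_mul, integral_integral_swap (integrable_secondDiff_div φ)]
  simp_rw [integral_div, integral_secondDiff_left φ, zero_div, integral_zero, mul_zero]

lemma exists_abs_halfLap_le (φ : SchwartzMap E3 ℝ) : ∃ C, ∀ x, |halfLap φ x| ≤ C := by
  obtain ⟨C, -, h⟩ := exists_secondDiff_div_le φ
  refine ⟨1 / (2 * π ^ 2) * ∫ z, C * levyWeight z, fun x => ?_⟩
  rw [halfLap_eq, abs_mul, abs_of_nonneg (by positivity : 0 ≤ 1 / (2 * π ^ 2))]
  refine mul_le_mul_of_nonneg_left ?_ (by positivity)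
  rw [← Real.norm_eq_abs]
  refine norm_integral_le_of_norm_le (integrable_levyWeight.const_mul C)
    (Eventually.of_forall fun z => ?_)
  rw [norm_div, norm_pow, norm_norm]
  exact h x z

/-! ### Gaussian integrals -/

lemma integral_rpow_neg_two_mul_comp_inv (g : ℝ → ℝ) :
    ∫ v in Set.Ioi (0:ℝ), v ^ (-2 : ℝ) * g v⁻¹ = ∫ v in Set.Ioi 0, g v := by
  rw [← integral_comp_rpow_Ioi g (p := -1) (by norm_num)]
  refine setIntegral_congr_fun measurableSet_Ioi fun v _ => ?_
  norm_num [rpow_neg_one]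

lemma integrableOn_rpow_neg_two_mul_comp_inv {g : ℝ → ℝ} :
    IntegrableOn (fun v : ℝ => v ^ (-2 : ℝ) * g v⁻¹) (Set.Ioi 0) ↔ IntegrableOn g (Set.Ioi 0) := by
  rw [← integrableOn_Ioi_comp_rpow_iff g (p := -1) (by norm_num)]
  refine integrableOn_congr_fun (fun v _ => ?_) measurableSet_Ioi
  norm_num [rpow_neg_one]

/-- A primitive of `v⁻² (1 - exp (-b v²))`. -/
noncomputable def gaussPrimitive (b v : ℝ) : ℝ :=
  -(v⁻¹ * (1 - exp (-b * v ^ 2))) + 2 * b * ∫ t in (0:ℝ)..v, exp (-b * t ^ 2)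

lemma hasDerivAt_gaussPrimitive (b : ℝ) {v : ℝ} (hv : v ≠ 0) :
    HasDerivAt (gaussPrimitive b) (v ^ (-2 : ℝ) * (1 - exp (-b * v ^ 2))) v := by
  have hc : Continuous fun t : ℝ => exp (-b * t ^ 2) := by fun_prop
  have h1 : HasDerivAt (fun v : ℝ => exp (-b * v ^ 2)) (exp (-b * v ^ 2) * (-b * (2 * v))) v := by
    simpa using ((hasDerivAt_pow 2 v).const_mul (-b)).exp
  have h2 := ((hasDerivAt_inv hv).mul (h1.const_sub 1)).neg.add
    ((intervalIntegral.integral_hasDerivAt_right (hc.intervalIntegrable 0 v)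
      (hc.stronglyMeasurableAtFilter _ _) hc.continuousAt).const_mul (2 * b))
  refine h2.congr_deriv ?_
  rw [show (-2 : ℝ) = ((-2 : ℤ) : ℝ) by norm_num, rpow_intCast, zpow_neg]
  norm_cast
  field_simp
  ring

lemma abs_inv_mul_one_sub_exp_le {b : ℝ} (hb : 0 ≤ b) (v : ℝ) :
    |v⁻¹ * (1 - exp (-b * v ^ 2))| ≤ b * |v| := by
  have h0 : 0 ≤ b * v ^ 2 := by positivity
  have h1 : exp (-b * v ^ 2) ≤ 1 := exp_le_one_iff.2 (by linarith)
  have h2 := add_one_le_exp (-b * v ^ 2)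
  rcases eq_or_ne v 0 with rfl | hv
  · simp
  rw [abs_mul, abs_inv, abs_of_nonneg (sub_nonneg.2 h1), inv_mul_le_iff₀ (abs_pos.2 hv)]
  nlinarith [sq_abs v]

lemma continuousAt_gaussPrimitive_zero {b : ℝ} (hb : 0 ≤ b) : ContinuousAt (gaussPrimitive b) 0 := by
  have hc : Continuous fun t : ℝ => exp (-b * t ^ 2) := by fun_prop
  refine ContinuousAt.add (ContinuousAt.neg ?_) (continuousAt_const.mul
    (intervalIntegral.continuous_primitive (fun _ _ => hc.intervalIntegrable _ _) 0).continuousAt)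
  rw [ContinuousAt, inv_zero, zero_mul]
  refine squeeze_zero_norm (abs_inv_mul_one_sub_exp_le hb) ?_
  have : Continuous fun v : ℝ => b * |v| := by fun_prop
  simpa using this.tendsto 0

lemma tendsto_gaussPrimitive {b : ℝ} (hb : 0 < b) :
    Tendsto (gaussPrimitive b) atTop (nhds √(π * b)) := by
  have h1 : Tendsto (fun v : ℝ => v⁻¹ * (1 - exp (-b * v ^ 2))) atTop (nhds 0) := by
    refine squeeze_zero_norm' ?_ tendsto_inv_atTop_zero
    filter_upwards [eventually_gt_atTop 0] with v hv
    have h1 : exp (-b * v ^ 2) ≤ 1 := exp_le_one_iff.2 (by nlinarith [sq_nonneg v])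
    have h2 := exp_pos (-b * v ^ 2)
    rw [Real.norm_of_nonneg (mul_nonneg (inv_nonneg.2 hv.le) (by linarith))]
    exact mul_le_of_le_one_right (inv_nonneg.2 hv.le) (by linarith)
  have h2 := intervalIntegral_tendsto_integral_Ioi 0 (integrable_exp_neg_mul_sq hb).integrableOn
    tendsto_id
  rw [integral_gaussian_Ioi] at h2
  have h3 := h1.neg.add (h2.const_mul (2 * b))
  have h4 : √(π * b) = -0 + 2 * b * (√(π / b) / 2) := by
    rw [show π * b = b ^ 2 * (π / b) by field_simp, sqrt_mul (by positivity),
      sqrt_sq hb.le]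
    ring
  rw [h4]
  exact h3

lemma integral_rpow_neg_two_mul_one_sub_exp {b : ℝ} (hb : 0 < b) :
    ∫ v in Set.Ioi (0:ℝ), v ^ (-2 : ℝ) * (1 - exp (-b * v ^ 2)) = √(π * b) := by
  rw [integral_Ioi_of_hasDerivAt_of_nonneg (continuousAt_gaussPrimitive_zero hb.le).continuousWithinAt
    (fun v hv => hasDerivAt_gaussPrimitive b (ne_of_gt hv)) (fun v hv => ?_)
    (tendsto_gaussPrimitive hb)]
  · simp [gaussPrimitive]
  · have : exp (-b * v ^ 2) ≤ 1 := exp_le_one_iff.2 (by nlinarith [sq_nonneg v])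
    exact mul_nonneg (rpow_nonneg (le_of_lt hv) _) (by linarith)

lemma integral_one_sub_exp_neg_div_sq {b : ℝ} (hb : 0 ≤ b) :
    ∫ w in Set.Ioi (0:ℝ), (1 - exp (-b * (w⁻¹) ^ 2)) = √(π * b) := by
  rcases hb.eq_or_lt with rfl | hb
  · simp
  rw [← integral_rpow_neg_two_mul_comp_inv, ← integral_rpow_neg_two_mul_one_sub_exp hb]
  simp only [inv_inv]

lemma integral_rpow_neg_two_mul_exp (b : ℝ) :
    ∫ w in Set.Ioi (0:ℝ), w ^ (-2 : ℝ) * exp (-b * (w⁻¹) ^ 2) = √(π / b) / 2 := by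
  rw [integral_rpow_neg_two_mul_comp_inv fun v => exp (-b * v ^ 2), integral_gaussian_Ioi]

lemma integrableOn_rpow_neg_two_mul_exp {b : ℝ} (hb : 0 < b) :
    IntegrableOn (fun w : ℝ => w ^ (-2 : ℝ) * exp (-b * (w⁻¹) ^ 2)) (Set.Ioi 0) :=
  integrableOn_rpow_neg_two_mul_comp_inv.2 (integrable_exp_neg_mul_sq hb).integrableOn

lemma integral_pow_mul_exp_neg_mul_sq {b : ℝ} (hb : 0 < b) (k : ℕ) :
    ∫ w in Set.Ioi (0:ℝ), w ^ k * exp (-b * w ^ 2) =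
      b ^ (-((k : ℝ) + 1) / 2) * (1 / 2) * Gamma (((k : ℝ) + 1) / 2) := by
  rw [← integral_rpow_mul_exp_neg_mul_rpow two_pos (by linarith [k.cast_nonneg (α := ℝ)]) hb]
  simp only [rpow_natCast, rpow_two]

lemma integrableOn_pow_mul_exp_neg_mul_sq {b : ℝ} (hb : 0 < b) (k : ℕ) :
    IntegrableOn (fun w : ℝ => w ^ k * exp (-b * w ^ 2)) (Set.Ioi 0) := by
  have := integrableOn_rpow_mul_exp_neg_mul_sq hb (s := k) (by linarith [k.cast_nonneg (α := ℝ)])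
  simpa only [rpow_natCast] using this

lemma integral_pow_three_mul_exp {b : ℝ} (hb : 0 < b) :
    ∫ w in Set.Ioi (0:ℝ), w ^ 3 * exp (-b * w ^ 2) = 1 / (2 * b ^ 2) := by
  rw [integral_pow_mul_exp_neg_mul_sq hb, show (((3:ℕ) : ℝ) + 1) / 2 = 1 + 1 by norm_num,
    show -(((3:ℕ) : ℝ) + 1) / 2 = -2 by norm_num, Gamma_add_one one_ne_zero, Gamma_one,
    rpow_neg hb.le, rpow_two]
  field_simp

lemma integral_mul_exp_neg_mul_sq {b : ℝ} (hb : 0 < b) :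
    ∫ w in Set.Ioi (0:ℝ), w * exp (-b * w ^ 2) = 1 / (2 * b) := by
  have := integral_pow_mul_exp_neg_mul_sq hb 1
  rw [show (((1:ℕ) : ℝ) + 1) / 2 = 1 by norm_num,
    show -(((1:ℕ) : ℝ) + 1) / 2 = -1 by norm_num, Gamma_one, rpow_neg_one] at this
  simp only [pow_one] at this
  rw [this]
  field_simp

/-- The Fourier transform of the Gaussian `exp (-π w² |v|²)` on `ℝ³`. -/
lemma integral_cexp_gaussian {w : ℝ} (hw : 0 < w) (η : E3) :
    ∫ v : E3, (exp (-(π * w ^ 2) * ‖v‖ ^ 2) : ℂ) *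
      Complex.exp (2 * π * Complex.I * (inner ℝ η v : ℝ)) =
      ((w⁻¹ ^ 3 * exp (-(π * ‖η‖ ^ 2) * w⁻¹ ^ 2) : ℝ) : ℂ) := by
  have hb : 0 < ((π * w ^ 2 : ℝ) : ℂ).re := by
    rw [Complex.ofReal_re]; positivity
  have h := GaussianFourier.integral_cexp_neg_mul_sq_norm_add_of_euclideanSpace hb
    (2 * π * Complex.I) η
  simp only [Complex.exp_add] at h
  have hπ : (π : ℂ) ≠ 0 := by exact_mod_cast pi_ne_zero
  have hw' : (w : ℂ) ≠ 0 := by exact_mod_cast hw.ne'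
  have e1 : ((π : ℂ) / ((π * w ^ 2 : ℝ) : ℂ)) ^ ((Fintype.card (Fin 3) : ℂ) / 2) =
      ((w⁻¹ ^ 3 : ℝ) : ℂ) := by
    rw [← Complex.ofReal_div, show π / (π * w ^ 2) = (w⁻¹) ^ (2:ℝ) by rw [rpow_two]; field_simp,
      show ((Fintype.card (Fin 3) : ℂ) / 2) = ((3 / 2 : ℝ) : ℂ) by simp,
      ← Complex.ofReal_cpow (by positivity), ← rpow_mul (by positivity)]
    norm_num
  rw [e1] at h
  rw [Complex.ofReal_mul, Complex.ofReal_exp]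
  convert h using 2
  · congr 1 with v
    push_cast
    rfl
  · congr 1
    push_cast
    rw [mul_pow, mul_pow, Complex.I_sq]
    field_simp
    ring

/-! ### The Fourier symbol of the half-Laplacian -/

/-- The character `t ↦ exp (2πit)`. -/
noncomputable def phase (t : ℝ) : ℂ := Complex.exp ((2 * π * t : ℝ) * Complex.I)

lemma norm_phase (t : ℝ) : ‖phase t‖ = 1 := Complex.norm_exp_ofReal_mul_I _

lemma continuous_phase : Continuous phase := by
  unfold phase
  fun_prop

lemma phase_add (s t : ℝ) : phase (s + t) = phase s * phase t := by
  rw [phase, phase, phase, ← Complex.exp_add]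
  congr 1
  push_cast
  ring

lemma phase_add_phase_neg (t : ℝ) : phase t + phase (-t) = ((2 * cos (2 * π * t) : ℝ) : ℂ) := by
  rw [phase, phase, Complex.ofReal_mul 2, Complex.ofReal_cos, Complex.ofReal_ofNat,
    Complex.two_cos]
  congr 2
  push_cast
  ring

lemma re_phase (t : ℝ) : (phase t).re = cos (2 * π * t) := Complex.exp_ofReal_mul_I_re _

lemma integral_exp_mul_phase {w : ℝ} (hw : 0 < w) (η : E3) :
    ∫ v : E3, (exp (-(π * w ^ 2) * ‖v‖ ^ 2) : ℂ) * phase (inner ℝ η v) =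
      ((w⁻¹ ^ 3 * exp (-(π * ‖η‖ ^ 2) * w⁻¹ ^ 2) : ℝ) : ℂ) := by
  rw [← integral_cexp_gaussian hw]
  congr 1 with v
  rw [phase]
  congr 2
  push_cast
  ring

lemma integrable_exp_neg_mul_norm_sq {b : ℝ} (hb : 0 < b) :
    Integrable fun v : E3 => exp (-b * ‖v‖ ^ 2) := by
  by_contra h
  have h1 := GaussianFourier.integral_rexp_neg_mul_sq_norm (V := E3) hb
  rw [integral_undef h] at h1
  have : 0 < (π / b) ^ ((Module.finrank ℝ E3 : ℝ) / 2) := by positivity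
  linarith

lemma integrable_exp_mul_phase {w : ℝ} (hw : 0 < w) (η : E3) :
    Integrable fun v : E3 => (exp (-(π * w ^ 2) * ‖v‖ ^ 2) : ℂ) * phase (inner ℝ η v) := by
  have h := integrable_exp_neg_mul_norm_sq (b := π * w ^ 2) (by positivity)
  have hc := continuous_phase
  refine h.mono' (by fun_prop) (Eventually.of_forall fun v => ?_)
  rw [norm_mul, norm_phase, mul_one, Complex.norm_real, Real.norm_of_nonneg (exp_pos _).le]

lemma integral_exp_mul_cos {w : ℝ} (hw : 0 < w) (η : E3) :
    ∫ v : E3, exp (-(π * w ^ 2) * ‖v‖ ^ 2) * cos (2 * π * inner ℝ η v) =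
      w⁻¹ ^ 3 * exp (-(π * ‖η‖ ^ 2) * w⁻¹ ^ 2) := by
  have h := congrArg Complex.re (integral_exp_mul_phase hw η)
  rw [Complex.ofReal_re] at h
  rw [← h]
  have := integral_re (integrable_exp_mul_phase hw η)
  simp only [RCLike.re_to_complex] at this
  rw [← this]
  congr 1 with v
  rw [Complex.re_ofReal_mul, re_phase]

lemma one_sub_cos_nonneg (t : ℝ) : 0 ≤ 1 - cos t := sub_nonneg.2 (cos_le_one t)

lemma integral_exp_mul_one_sub_cos {w : ℝ} (hw : 0 < w) (η : E3) :
    ∫ v : E3, exp (-(π * w ^ 2) * ‖v‖ ^ 2) * (1 - cos (2 * π * inner ℝ η v)) =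
      w⁻¹ ^ 3 * (1 - exp (-(π * ‖η‖ ^ 2) * w⁻¹ ^ 2)) := by
  have h := integrable_exp_neg_mul_norm_sq (b := π * w ^ 2) (by positivity)
  have h2 : Integrable fun v : E3 =>
      exp (-(π * w ^ 2) * ‖v‖ ^ 2) * cos (2 * π * inner ℝ η v) := by
    refine h.mono' (by fun_prop) (Eventually.of_forall fun v => ?_)
    rw [norm_mul, Real.norm_of_nonneg (exp_pos _).le]
    exact mul_le_of_le_one_right (exp_pos _).le (abs_cos_le_one _)
  have h0 := integral_exp_mul_cos hw 0
  simp only [inner_zero_left, mul_zero, cos_zero, mul_one, norm_zero, ne_eq, OfNat.ofNat_ne_zero,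
    not_false_eq_true, zero_pow, neg_zero, zero_mul, exp_zero] at h0
  simp_rw [mul_sub, mul_one]
  rw [integral_sub h h2, integral_exp_mul_cos hw, h0]

lemma integrable_one_sub_cos_div (η : E3) :
    Integrable fun z : E3 => (1 - cos (2 * π * inner ℝ η z)) / ‖z‖ ^ 4 := by
  refine (integrable_levyWeight.const_mul (8 * (2 * π ^ 2 * ‖η‖ ^ 2) + 4 * 2)).mono'
    (Measurable.aestronglyMeasurable (by fun_prop)) (Eventually.of_forall fun z => ?_)
  rw [norm_div, norm_pow, norm_norm, Real.norm_of_nonneg (one_sub_cos_nonneg _)]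
  refine div_pow_four_le_levyWeight (by positivity) two_pos.le (fun _ => ?_)
    (by linarith [neg_one_le_cos (2 * π * inner ℝ η z)])
  have h1 := one_sub_sq_div_two_le_cos (x := 2 * π * inner ℝ η z)
  have h2 : (inner ℝ η z) ^ 2 ≤ (‖η‖ * ‖z‖) ^ 2 := sq_le_sq.2 (by
    rw [abs_of_nonneg (by positivity : 0 ≤ ‖η‖ * ‖z‖)]
    exact abs_real_inner_le_norm η z)
  nlinarith [mul_le_mul_of_nonneg_left h2 (by positivity : 0 ≤ 2 * π ^ 2)]

lemma integral_one_sub_cos_div (η : E3) :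
    ∫ z : E3, (1 - cos (2 * π * inner ℝ η z)) / ‖z‖ ^ 4 = 2 * π ^ 3 * ‖η‖ := by
  set F : E3 → ℝ → ℝ := fun z w =>
    (1 - cos (2 * π * inner ℝ η z)) * (w ^ 3 * exp (-(π * ‖z‖ ^ 2) * w ^ 2)) with hF
  have hF0 : ∀ z, ∀ w ∈ Set.Ioi (0:ℝ), 0 ≤ F z w := fun z w hw =>
    mul_nonneg (one_sub_cos_nonneg _) (mul_nonneg (pow_nonneg (le_of_lt hw) 3) (exp_pos _).le)
  have hFw : ∀ z, ∫ w in Set.Ioi (0:ℝ), F z w =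
      (1 / (2 * π ^ 2)) * ((1 - cos (2 * π * inner ℝ η z)) / ‖z‖ ^ 4) := by
    intro z
    rw [hF, integral_const_mul]
    rcases eq_or_ne z 0 with rfl | hz
    · simp
    · have := norm_pos_iff.2 hz
      rw [integral_pow_three_mul_exp (by positivity)]
      field_simp
  have hm : AEStronglyMeasurable (Function.uncurry F)
      (volume.prod (volume.restrict (Set.Ioi (0:ℝ)))) := by
    refine Continuous.aestronglyMeasurable ?_
    rw [hF]
    unfold Function.uncurry
    fun_prop
  have hFint : Integrable (Function.uncurry F) (volume.prod (volume.restrict (Set.Ioi (0:ℝ)))) := by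
    refine (integrable_prod_iff hm).2 ⟨Eventually.of_forall fun z => ?_, ?_⟩
    · rcases eq_or_ne z 0 with rfl | hz
      · simp [Function.uncurry, hF]
      · have := norm_pos_iff.2 hz
        exact (integrableOn_pow_mul_exp_neg_mul_sq (b := π * ‖z‖ ^ 2) (by positivity)
          3).const_mul (1 - cos (2 * π * inner ℝ η z))
    · refine ((integrable_one_sub_cos_div η).const_mul (1 / (2 * π ^ 2))).congr
        (Eventually.of_forall fun z => ?_)
      dsimp only
      rw [← hFw]
      refine setIntegral_congr_fun measurableSet_Ioi fun w hw => ?_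
      exact (Real.norm_of_nonneg (hF0 z w hw)).symm
  have hswap := integral_integral_swap hFint
  simp_rw [hFw] at hswap
  rw [integral_const_mul] at hswap
  have h2 : ∫ w in Set.Ioi (0:ℝ), ∫ z, F z w = π * ‖η‖ := by
    rw [show π * ‖η‖ = √(π * (π * ‖η‖ ^ 2)) by
      rw [show π * (π * ‖η‖ ^ 2) = (π * ‖η‖) ^ 2 by ring, sqrt_sq (by positivity)],
      ← integral_one_sub_exp_neg_div_sq (by positivity)]
    refine setIntegral_congr_fun measurableSet_Ioi fun w hw => ?_
    have hw' : (0:ℝ) < w := hw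
    have : ∀ z, F z w = w ^ 3 *
        (exp (-(π * w ^ 2) * ‖z‖ ^ 2) * (1 - cos (2 * π * inner ℝ η z))) := by
      intro z
      rw [hF]
      dsimp only
      rw [show -(π * ‖z‖ ^ 2) * w ^ 2 = -(π * w ^ 2) * ‖z‖ ^ 2 by ring]
      ring
    simp_rw [this]
    rw [integral_const_mul, integral_exp_mul_one_sub_cos hw']
    field_simp
  rw [h2] at hswap
  field_simp at hswap
  linarith

/-- The Fourier transform of a real Schwartz function. -/
noncomputable def realFourier (φ : SchwartzMap E3 ℝ) : SchwartzMap E3 ℂ :=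
  FourierTransform.fourier (φ.postcompCLM Complex.ofRealCLM)

lemma integrable_realFourier_mul_phase (φ : SchwartzMap E3 ℝ) (x : E3) :
    Integrable fun ξ => realFourier φ ξ * phase (inner ℝ ξ x) := by
  have hc := continuous_phase
  have hc' := (realFourier φ).continuous
  refine (realFourier φ).integrable.norm.mono' (by fun_prop) (Eventually.of_forall fun ξ => ?_)
  rw [norm_mul, norm_phase, mul_one]

lemma integral_realFourier_mul_phase (φ : SchwartzMap E3 ℝ) (x : E3) :
    ∫ ξ, realFourier φ ξ * phase (inner ℝ ξ x) = φ x := by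
  have h : FourierTransform.fourierInv (realFourier φ) = φ.postcompCLM Complex.ofRealCLM :=
    FourierTransform.fourierInv_fourier_eq _
  have h2 := congrArg (fun f : SchwartzMap E3 ℂ => f x) h
  simp only [SchwartzMap.fourierInv_coe, Real.fourierInv_eq', SchwartzMap.postcompCLM_apply,
    Complex.ofRealCLM_apply] at h2
  rw [← h2]
  congr 1 with ξ
  rw [phase, smul_eq_mul, mul_comm]

lemma ofReal_secondDiff_eq (φ : SchwartzMap E3 ℝ) (x z : E3) :
    (secondDiff φ x z : ℂ) = ∫ ξ, realFourier φ ξ * phase (inner ℝ ξ x) *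
      ((2 * (1 - cos (2 * π * inner ℝ ξ z)) : ℝ) : ℂ) := by
  have h := integrable_realFourier_mul_phase φ
  have h1 : Integrable fun ξ => 2 * (realFourier φ ξ * phase (inner ℝ ξ x)) -
      realFourier φ ξ * phase (inner ℝ ξ (x + z)) := ((h x).const_mul 2).sub (h (x + z))
  rw [secondDiff]
  push_cast
  rw [← integral_realFourier_mul_phase, ← integral_realFourier_mul_phase φ (x + z),
    ← integral_realFourier_mul_phase φ (x - z), ← integral_const_mul,
    ← integral_sub ((h x).const_mul 2) (h _), ← integral_sub h1 (h _)]
  congr 1 with ξ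
  have h3 := phase_add_phase_neg (inner ℝ ξ z)
  push_cast at h3
  rw [sub_eq_add_neg x z, inner_add_right, inner_add_right, inner_neg_right, phase_add, phase_add]
  linear_combination (-(realFourier φ ξ * phase (inner ℝ ξ x))) * h3

lemma SchwartzMap.integrable_norm_mul (f : SchwartzMap E3 ℂ) :
    Integrable fun ξ => ‖ξ‖ * ‖f ξ‖ := by
  simpa using f.integrable_pow_mul volume 1

lemma ofReal_halfLap_eq (φ : SchwartzMap E3 ℝ) (x : E3) :
    (halfLap φ x : ℂ) =
      ∫ ξ, ((2 * π * ‖ξ‖ : ℝ) : ℂ) * (realFourier φ ξ * phase (inner ℝ ξ x)) := by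
  set F : E3 → E3 → ℂ := fun ξ z => realFourier φ ξ * phase (inner ℝ ξ x) *
      ((2 * ((1 - cos (2 * π * inner ℝ ξ z)) / ‖z‖ ^ 4) : ℝ) : ℂ) with hF
  have hm : AEStronglyMeasurable (Function.uncurry F) (volume.prod volume) := by
    have hc := continuous_phase.measurable
    have hc' := (realFourier φ).continuous.measurable
    refine Measurable.aestronglyMeasurable ?_
    rw [hF]
    unfold Function.uncurry
    fun_prop
  have hi : ∀ ξ : E3, Integrable fun z : E3 => 2 * ((1 - cos (2 * π * inner ℝ ξ z)) / ‖z‖ ^ 4) :=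
    fun ξ => (integrable_one_sub_cos_div ξ).const_mul 2
  have hFint : Integrable (Function.uncurry F) (volume.prod volume) := by
    refine (integrable_prod_iff hm).2 ⟨Eventually.of_forall fun ξ =>
    (hi ξ).ofReal.const_mul (realFourier φ ξ * phase (inner ℝ ξ x)), ?_⟩
    refine ((realFourier φ).integrable_norm_mul.const_mul (4 * π ^ 3)).congr
      (Eventually.of_forall fun ξ => ?_)
    simp only [Function.uncurry, hF, norm_mul, norm_phase, mul_one, Complex.norm_real, norm_div,
      norm_pow, norm_norm, Real.norm_of_nonneg (one_sub_cos_nonneg _), Real.norm_ofNat]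
    rw [integral_const_mul, integral_const_mul, integral_one_sub_cos_div]
    ring
  rw [halfLap_eq, Complex.ofReal_mul, ← integral_complex_ofReal]
  have h1 : ∀ z, ((secondDiff φ x z / ‖z‖ ^ 4 : ℝ) : ℂ) = ∫ ξ, F ξ z := by
    intro z
    rw [Complex.ofReal_div, ofReal_secondDiff_eq, ← integral_div]
    congr 1 with ξ
    rw [hF]
    push_cast
    ring
  simp_rw [h1]
  rw [← integral_integral_swap hFint, ← integral_const_mul]
  congr 1 with ξ
  rw [hF]
  dsimp only
  rw [integral_const_mul, integral_complex_ofReal, integral_const_mul, integral_one_sub_cos_div]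
  have : (π : ℂ) ≠ 0 := by exact_mod_cast pi_ne_zero
  push_cast
  field_simp

/-! ### The Riesz potential of the half-Laplacian -/

lemma integrable_inv_sq_mul_halfLap (φ : SchwartzMap E3 ℝ) (y : E3) :
    Integrable fun x => (‖x - y‖ ^ 2)⁻¹ * halfLap φ x := by
  have hH := integrable_halfLap φ
  obtain ⟨C, hC⟩ := exists_abs_halfLap_le φ
  have hC0 : 0 ≤ C := (abs_nonneg _).trans (hC 0)
  have hm : Measurable fun x : E3 => (‖x - y‖ ^ 2)⁻¹ := by fun_prop
  refine (((integrable_levyWeight.comp_sub_right y).const_mul (8 * C)).add hH.norm).mono'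
    (hm.aestronglyMeasurable.mul hH.aestronglyMeasurable) (Eventually.of_forall fun x => ?_)
  have h1 : (‖x - y‖ ^ 2)⁻¹ ≤ 8 * levyWeight (x - y) + 1 := by
    generalize x - y = z
    have hw := wt_pos z
    rcases le_or_gt ‖z‖ 1 with hz | hz
    · have h3 : 1 ≤ 8 * wt z := by
        rw [wt, ← div_eq_mul_inv, one_le_div (by positivity)]
        calc (1 + ‖z‖ ^ 2) ^ 3 ≤ (1 + 1 ^ 2) ^ 3 := by gcongr
          _ = 8 := by norm_num
      have h4 : (‖z‖ ^ 2)⁻¹ * 1 ≤ (‖z‖ ^ 2)⁻¹ * (8 * wt z) :=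
        mul_le_mul_of_nonneg_left h3 (by positivity)
      have h5 : 0 ≤ (1 + ‖z‖ ^ 2) * wt z := by positivity
      rw [levyWeight, rpow_neg (norm_nonneg z), rpow_two]
      linarith
    · have : (‖z‖ ^ 2)⁻¹ ≤ 1 := inv_le_one_of_one_le₀ (by nlinarith)
      linarith [levyWeight_nonneg z]
  rw [norm_mul, Real.norm_of_nonneg (by positivity : 0 ≤ (‖x - y‖ ^ 2)⁻¹), Pi.add_apply]
  refine (mul_le_mul_of_nonneg_right h1 (norm_nonneg _)).trans ?_
  have h2 : 8 * levyWeight (x - y) * ‖halfLap φ x‖ ≤ 8 * levyWeight (x - y) * C :=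
    mul_le_mul_of_nonneg_left (hC x) (mul_nonneg (by norm_num) (levyWeight_nonneg _))
  linarith

lemma integral_exp_mul_halfLap (φ : SchwartzMap E3 ℝ) (y : E3) {w : ℝ} (hw : 0 < w) :
    ((∫ x, exp (-(π * w ^ 2) * ‖x - y‖ ^ 2) * halfLap φ x : ℝ) : ℂ) =
      ∫ ξ, ((2 * π * ‖ξ‖ * (w⁻¹ ^ 3 * exp (-(π * ‖ξ‖ ^ 2) * w⁻¹ ^ 2)) : ℝ) : ℂ) *
        (realFourier φ ξ * phase (inner ℝ ξ y)) := by
  set F : E3 → E3 → ℂ := fun x ξ => (exp (-(π * w ^ 2) * ‖x - y‖ ^ 2) : ℂ) *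
    (((2 * π * ‖ξ‖ : ℝ) : ℂ) * (realFourier φ ξ * phase (inner ℝ ξ x))) with hF
  have hm : AEStronglyMeasurable (Function.uncurry F) (volume.prod volume) := by
    have hc := continuous_phase
    have hc' := (realFourier φ).continuous
    refine Continuous.aestronglyMeasurable ?_
    rw [hF]
    unfold Function.uncurry
    fun_prop
  have hFint : Integrable (Function.uncurry F) (volume.prod volume) := by
    have h1 := ((integrable_exp_neg_mul_norm_sq (b := π * w ^ 2) (by positivity)).comp_sub_right
      y).mul_prod ((realFourier φ).integrable_norm_mul.const_mul (2 * π))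
    refine h1.mono' hm (Eventually.of_forall fun p => le_of_eq ?_)
    simp only [Function.uncurry, hF, norm_mul, norm_phase, mul_one, Complex.norm_real, norm_norm,
      Real.norm_of_nonneg (exp_pos _).le, Real.norm_of_nonneg pi_nonneg, Real.norm_ofNat]
    ring
  have h2 : ∀ x, ((exp (-(π * w ^ 2) * ‖x - y‖ ^ 2) * halfLap φ x : ℝ) : ℂ) = ∫ ξ, F x ξ := by
    intro x
    rw [Complex.ofReal_mul, ofReal_halfLap_eq, ← integral_const_mul]
  rw [← integral_complex_ofReal]
  simp_rw [h2]
  rw [integral_integral_swap hFint]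
  congr 1 with ξ
  have h3 : ∀ x, F x ξ = ((2 * π * ‖ξ‖ : ℝ) : ℂ) * (realFourier φ ξ * phase (inner ℝ ξ y)) *
      ((exp (-(π * w ^ 2) * ‖x - y‖ ^ 2) : ℂ) * phase (inner ℝ ξ (x - y))) := by
    intro x
    have h4 : phase (inner ℝ ξ x) = phase (inner ℝ ξ y) * phase (inner ℝ ξ (x - y)) := by
      rw [← phase_add, ← inner_add_right, add_sub_cancel]
    rw [hF]
    dsimp only
    rw [h4]
    ring
  simp_rw [h3]
  rw [integral_const_mul, integral_sub_right_eq_self (fun x : E3 =>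
    (exp (-(π * w ^ 2) * ‖x‖ ^ 2) : ℂ) * phase (inner ℝ ξ x)) y, integral_exp_mul_phase hw]
  push_cast
  ring

lemma integral_inv_sq_mul_halfLap_eq_integral_Ioi (φ : SchwartzMap E3 ℝ) (y : E3) :
    ∫ x, (‖x - y‖ ^ 2)⁻¹ * halfLap φ x =
      2 * π * ∫ w in Set.Ioi (0:ℝ), w * ∫ x, exp (-(π * w ^ 2) * ‖x - y‖ ^ 2) * halfLap φ x := by
  have hae : ∀ᵐ x : E3, x ≠ y := Measure.ae_ne volume y
  set F : E3 → ℝ → ℝ := fun x w =>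
    halfLap φ x * (w * exp (-(π * ‖x - y‖ ^ 2) * w ^ 2)) with hF
  have hH := integrable_halfLap φ
  have hm : AEStronglyMeasurable (Function.uncurry F)
      (volume.prod (volume.restrict (Set.Ioi (0:ℝ)))) := by
    refine hH.aestronglyMeasurable.comp_fst.mul (Continuous.aestronglyMeasurable ?_)
    fun_prop
  have hker : ∀ x, x ≠ y → ∫ w in Set.Ioi (0:ℝ), w * exp (-(π * ‖x - y‖ ^ 2) * w ^ 2) =
      1 / (2 * π) * (‖x - y‖ ^ 2)⁻¹ := by
    intro x hx
    have := norm_pos_iff.2 (sub_ne_zero.2 hx)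
    rw [integral_mul_exp_neg_mul_sq (by positivity)]
    field_simp
  have hFint : Integrable (Function.uncurry F) (volume.prod (volume.restrict (Set.Ioi (0:ℝ)))) := by
    refine (integrable_prod_iff hm).2 ⟨?_, ?_⟩
    · filter_upwards [hae] with x hx
      have := norm_pos_iff.2 (sub_ne_zero.2 hx)
      have h := integrableOn_pow_mul_exp_neg_mul_sq (b := π * ‖x - y‖ ^ 2) (by positivity) 1
      simp only [pow_one] at h
      exact h.const_mul (halfLap φ x)
    · refine ((integrable_inv_sq_mul_halfLap φ y).norm.const_mul (1 / (2 * π))).congr ?_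
      filter_upwards [hae] with x hx
      rw [norm_mul, Real.norm_of_nonneg (by positivity : 0 ≤ (‖x - y‖ ^ 2)⁻¹), ← mul_assoc,
        ← hker x hx, mul_comm, ← integral_const_mul]
      refine setIntegral_congr_fun measurableSet_Ioi fun w hw => ?_
      simp only [Function.uncurry, hF]
      rw [norm_mul, Real.norm_of_nonneg (mul_nonneg (le_of_lt hw) (exp_pos _).le)]
  have hswap := integral_integral_swap hFint
  have h1 : ∫ x, ∫ w in Set.Ioi (0:ℝ), F x w =
      1 / (2 * π) * ∫ x, (‖x - y‖ ^ 2)⁻¹ * halfLap φ x := by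
    rw [← integral_const_mul]
    refine integral_congr_ae ?_
    filter_upwards [hae] with x hx
    rw [hF, integral_const_mul, hker x hx]
    ring
  have h2 : ∀ w, ∫ x, F x w = w * ∫ x, exp (-(π * w ^ 2) * ‖x - y‖ ^ 2) * halfLap φ x := by
    intro w
    rw [← integral_const_mul]
    congr 1 with x
    rw [hF]
    dsimp only
    rw [show -(π * ‖x - y‖ ^ 2) * w ^ 2 = -(π * w ^ 2) * ‖x - y‖ ^ 2 by ring]
    ring
  simp_rw [h2] at hswap
  rw [← hswap, h1]
  field_simp

/-- `(-Δ)^{1/2} φ` has Riesz potential `2π² φ` with respect to the kernel `|x|⁻²`. -/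
lemma integral_inv_sq_mul_halfLap (φ : SchwartzMap E3 ℝ) (y : E3) :
    ∫ x, (‖x - y‖ ^ 2)⁻¹ * halfLap φ x = 2 * π ^ 2 * φ y := by
  set F : ℝ → E3 → ℂ := fun w ξ =>
    ((2 * π * ‖ξ‖ * (w ^ (-2 : ℝ) * exp (-(π * ‖ξ‖ ^ 2) * w⁻¹ ^ 2)) : ℝ) : ℂ) *
      (realFourier φ ξ * phase (inner ℝ ξ y)) with hF
  have hm : AEStronglyMeasurable (Function.uncurry F)
      ((volume.restrict (Set.Ioi (0:ℝ))).prod volume) := by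
    have hc := continuous_phase.measurable
    have hc' := (realFourier φ).continuous.measurable
    refine Measurable.aestronglyMeasurable ?_
    rw [hF]
    unfold Function.uncurry
    fun_prop
  have hker : ∀ ξ : E3, ξ ≠ 0 →
      ∫ w in Set.Ioi (0:ℝ), w ^ (-2 : ℝ) * exp (-(π * ‖ξ‖ ^ 2) * w⁻¹ ^ 2) = 1 / (2 * ‖ξ‖) := by
    intro ξ hξ
    have := norm_pos_iff.2 hξ
    rw [integral_rpow_neg_two_mul_exp, show π / (π * ‖ξ‖ ^ 2) = (‖ξ‖⁻¹) ^ 2 by field_simp,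
      sqrt_sq (by positivity)]
    field_simp
  have hae : ∀ᵐ ξ : E3, ξ ≠ 0 := Measure.ae_ne volume 0
  have hFint : Integrable (Function.uncurry F)
      ((volume.restrict (Set.Ioi (0:ℝ))).prod volume) := by
    refine (integrable_prod_iff' hm).2 ⟨?_, ?_⟩
    · filter_upwards [hae] with ξ hξ
      have := norm_pos_iff.2 hξ
      exact ((integrableOn_rpow_neg_two_mul_exp (b := π * ‖ξ‖ ^ 2)
        (by positivity)).const_mul (2 * π * ‖ξ‖)).ofReal.mul_const
          (realFourier φ ξ * phase (inner ℝ ξ y))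
    · refine ((realFourier φ).integrable.norm.const_mul π).congr ?_
      filter_upwards [hae] with ξ hξ
      have hξ' := norm_pos_iff.2 hξ
      have h1 : π * ‖realFourier φ ξ‖ = 2 * π * ‖ξ‖ * ‖realFourier φ ξ‖ * (1 / (2 * ‖ξ‖)) := by
        field_simp
      rw [h1, ← hker ξ hξ, ← integral_const_mul]
      refine setIntegral_congr_fun measurableSet_Ioi fun w hw => ?_
      have hw' : (0:ℝ) < w := hw
      simp only [Function.uncurry, hF]
      rw [norm_mul, norm_mul, norm_phase, Complex.norm_real, Real.norm_of_nonneg (by positivity)]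
      ring
  have h1 : ∀ w ∈ Set.Ioi (0:ℝ),
      ((w * ∫ x, exp (-(π * w ^ 2) * ‖x - y‖ ^ 2) * halfLap φ x : ℝ) : ℂ) = ∫ ξ, F w ξ := by
    intro w hw
    have hw' : (0:ℝ) < w := hw
    rw [Complex.ofReal_mul, integral_exp_mul_halfLap φ y hw, ← integral_const_mul]
    congr 1 with ξ
    rw [hF]
    dsimp only
    rw [← mul_assoc, ← Complex.ofReal_mul, rpow_neg hw'.le, rpow_two]
    congr 2
    field_simp
  have h2 : ∫ ξ, ∫ w in Set.Ioi (0:ℝ), F w ξ = (π : ℂ) * φ y := by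
    rw [← integral_realFourier_mul_phase, ← integral_const_mul]
    refine integral_congr_ae ?_
    filter_upwards [hae] with ξ hξ
    have := norm_pos_iff.2 hξ
    rw [hF]
    dsimp only
    rw [integral_mul_const, integral_complex_ofReal, integral_const_mul, hker ξ hξ]
    congr 2
    field_simp
  apply Complex.ofReal_injective
  rw [integral_inv_sq_mul_halfLap_eq_integral_Ioi, Complex.ofReal_mul, ← integral_complex_ofReal,
    setIntegral_congr_fun measurableSet_Ioi h1, integral_integral_swap hFint, h2]
  push_cast
  ring

/-! ### The weak form of the equation -/

lemma WtBounded.integrable_inv_sq_mul_prod {f : E3 → ℝ} (hf : WtBounded f)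
    (φ : SchwartzMap E3 ℝ) :
    Integrable (fun p : E3 × E3 => (‖p.1 - p.2‖ ^ 2)⁻¹ * f p.2 * halfLap φ p.1)
      (volume.prod volume) := by
  have hH := integrable_halfLap φ
  have hfm := hf.meas
  have hm : AEStronglyMeasurable (fun p : E3 × E3 => (‖p.1 - p.2‖ ^ 2)⁻¹ * f p.2 * halfLap φ p.1)
      (volume.prod volume) := by
    refine AEStronglyMeasurable.mul (Measurable.aestronglyMeasurable ?_)
      hH.aestronglyMeasurable.comp_fst
    fun_prop
  have hrpow : ∀ x y : E3, (‖x - y‖ ^ 2)⁻¹ = ‖x - y‖ ^ (-2 : ℝ) := fun x y => by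
    rw [rpow_neg (norm_nonneg _), rpow_two]
  have hi : ∀ x, Integrable fun y => (‖x - y‖ ^ 2)⁻¹ * f y := fun x => by
    simpa only [hrpow] using hf.integrable_rpow_mul zero_le_two (by norm_num : (2:ℝ) < 3) x
  obtain ⟨M, hM⟩ := hf.exists_integral_rpow_mul_le zero_le_two (by norm_num : (2:ℝ) < 3)
  refine (integrable_prod_iff hm).2 ⟨Eventually.of_forall fun x => (hi x).mul_const (halfLap φ x), ?_⟩
  refine (hH.norm.const_mul M).mono' hm.norm.integral_prod_right'
    (Eventually.of_forall fun x => ?_)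
  rw [Real.norm_of_nonneg (integral_nonneg fun y => norm_nonneg _)]
  simp only [norm_mul]
  rw [integral_mul_const]
  refine mul_le_mul_of_nonneg_right (Eq.trans_le ?_ (hM x)) (norm_nonneg _)
  congr 1 with y
  rw [Real.norm_of_nonneg (by positivity), hrpow, Real.norm_eq_abs]

lemma LogSolution.integral_neg_lap_mul_halfLap {l c C : ℝ} {u : E3 → ℝ}
    (h : LogSolution l c C u) (φ : SchwartzMap E3 ℝ) :
    ∫ x, (-(lap u x)) * halfLap φ x = 2 * ∫ x, exp (3 * u x) * φ x := by
  have hFint := h.wtBounded.integrable_inv_sq_mul_prod φ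
  have h1 : ∀ x, (-(lap u x)) * halfLap φ x =
      1 / π ^ 2 * (∫ y, (‖x - y‖ ^ 2)⁻¹ * exp (3 * u y) * halfLap φ x) +
        6 * l * halfLap φ x := by
    intro x
    rw [h.lap_eq, integral_mul_const]
    ring
  simp_rw [h1]
  rw [integral_add (hFint.integral_prod_left.const_mul _) ((integrable_halfLap φ).const_mul _),
    integral_const_mul, integral_const_mul, integral_halfLap, integral_integral_swap hFint]
  have h2 : ∀ y, ∫ x, (‖x - y‖ ^ 2)⁻¹ * exp (3 * u y) * halfLap φ x =
      2 * π ^ 2 * (exp (3 * u y) * φ y) := by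
    intro y
    have := integral_inv_sq_mul_halfLap φ y
    rw [← mul_assoc, mul_comm (2 * π ^ 2), mul_assoc, ← this, ← integral_const_mul]
    congr 1 with x
    ring
  simp_rw [h2]
  rw [integral_const_mul]
  field_simp
  ring

lemma integrable_inv_one_add_pow_four : Integrable fun x : E3 => (1 + ‖x‖ ^ 4)⁻¹ := by
  refine (integrable_sq_mul_wt.const_mul 2).mono' (by fun_prop) (Eventually.of_forall fun x => ?_)
  have h1 : (1 + ‖x‖ ^ 2) * wt x = ((1 + ‖x‖ ^ 2) ^ 2)⁻¹ := by
    rw [wt]; field_simp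
  rw [Real.norm_of_nonneg (by positivity), h1, ← div_eq_mul_inv, inv_eq_one_div,
    div_le_div_iff₀ (by positivity) (by positivity)]
  nlinarith [sq_nonneg (‖x‖ ^ 2 - 1)]

lemma continuous_lap {u : E3 → ℝ} (hu : ContDiff ℝ (⊤ : ℕ∞) u) : Continuous (lap u) := by
  unfold lap
  refine continuous_finsetSum _ fun i _ => ?_
  have h1 : ContDiff ℝ 1 fun y => fderiv ℝ u y (EuclideanSpace.single i 1) :=
    (hu.fderiv_right (m := 1) (by norm_cast)).clm_apply contDiff_const
  exact (h1.continuous_fderiv one_ne_zero).clm_apply continuous_const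

lemma LogSolution.memL12_lap {l c C : ℝ} {u : E3 → ℝ} (h : LogSolution l c C u) :
    MemL12 (lap u) := by
  have hc := continuous_lap h.contDiff
  refine ⟨hc.locallyIntegrable, ?_⟩
  obtain ⟨M, hM⟩ := h.wtBounded.exists_integral_rpow_mul_le zero_le_two
    (by norm_num : (2:ℝ) < 3)
  have hb : ∀ x, |lap u x| ≤ 1 / π ^ 2 * M + 6 * l := by
    intro x
    have h1 : ∫ y, (‖x - y‖ ^ 2)⁻¹ * exp (3 * u y) ≤ M := by
      refine Eq.trans_le ?_ (hM x)
      congr 1 with y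
      rw [rpow_neg (norm_nonneg _), rpow_two, abs_of_pos (exp_pos _)]
    have h2 : 0 ≤ ∫ y, (‖x - y‖ ^ 2)⁻¹ * exp (3 * u y) :=
      integral_nonneg fun y => by positivity
    have h3 := mul_le_mul_of_nonneg_left h1 (by positivity : 0 ≤ 1 / π ^ 2)
    have h4 := mul_nonneg (by positivity : 0 ≤ 1 / π ^ 2) h2
    have := h.pos
    rw [h.lap_eq, abs_le]
    constructor <;> linarith
  refine (integrable_inv_one_add_pow_four.const_mul (1 / π ^ 2 * M + 6 * l)).mono'
    (hc.abs.measurable.div (by fun_prop)).aestronglyMeasurable (Eventually.of_forall fun x => ?_)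
  rw [Real.norm_of_nonneg (by positivity), div_eq_mul_inv]
  exact mul_le_mul_of_nonneg_right (hb x) (by positivity)

lemma LogSolution.isSolution {l c C : ℝ} {u : E3 → ℝ} (h : LogSolution l c C u) : IsSolution u :=
  ⟨h.contDiff, h.memL12_lap, h.wtBounded.integrable, h.integral_neg_lap_mul_halfLap⟩

/-- For every `V ∈ (0, 2π²)` the problem `(−Δ)^{3/2} u = 2 e^{3u}` in ℝ³ with volume `V`
admits a smooth solution. -/
theorem existence_of_solutions (V : ℝ) (hV0 : 0 < V) (hV1 : V < 2 * Real.pi ^ 2) :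
    ∃ u : E3 → ℝ, IsSolution u ∧ ∫ x, Real.exp (3 * u x) = V := by
  obtain ⟨l, c, C, u, hl, hm, hle, hV, hu⟩ := exists_solution_logPot hV0 hV1
  exact ⟨u, LogSolution.isSolution ⟨hl, hm, hle, hu⟩, hV⟩
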